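/- arXiv:1702.00666 — 2 statements merged into one kernel-verified Lean document; each statement's English description precedes it below -/
import Mathlib

section
/- The Poincaré series of H^*(D_8; 𝔽_2), i.e., the formal power series ∑_{i≥0} dim_{𝔽_2} H^i(D_8; 𝔽_2) t^i, equals 1/(1-t)², equivalently dim H^i(D_8; 𝔽_2) = i + 1 for all i ≥ 0. -/
open CategoryTheory

namespace D8
abbrev k := ZMod 2
abbrev C := Multiplicative (ZMod 2)
abbrev G := DihedralGroup 4

lemma rank_of_iso {M N : ModuleCat.{0} k} (e : M ≅ N) : Module.rank k M = Module.rank k N :=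
  e.toLinearEquiv.rank_eq

lemma rank_homology_zero (S : ShortComplex (ModuleCat.{0} k)) (hf : S.f = 0) (hg : S.g = 0) :
    Module.rank k S.homology = Module.rank k S.X₂ :=
  rank_of_iso (ShortComplex.LeftHomologyData.ofZeros S hf hg).homologyIso

lemma rank_H0_trivial (Γ : Type) [Group Γ] :
    Module.rank k (groupCohomology (Rep.trivial k Γ k) 0) = 1 := by
  rw [rank_of_iso (groupCohomology.H0Iso _)]
  have : (Rep.trivial k Γ k).ρ.invariants = ⊤ := by
    ext; simp [Representation.mem_invariants]
  rw [show Module.rank k (ModuleCat.of k (Rep.trivial k Γ k).ρ.invariants)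
    = Module.rank k (Rep.trivial k Γ k).ρ.invariants from rfl, this, rank_top]
  exact Module.rank_self k

lemma rank_C (i : ℕ) : Module.rank k (groupCohomology (Rep.trivial k C k) i) = 1 := by
  have hg : ∀ x : C, x ∈ Subgroup.zpowers (Multiplicative.ofAdd (1 : ZMod 2)) := by
    intro x
    rw [Subgroup.mem_zpowers_iff]
    refine ⟨((Multiplicative.toAdd x).val : ℤ), ?_⟩
    revert x
    decide
  have hn : (Rep.trivial k C k).norm.hom.toLinearMap = 0 := by
    ext
    simp [Rep.norm, Representation.norm]
    rfl
  have hs : (Rep.applyAsHom (Rep.trivial k C k) (Multiplicative.ofAdd (1 : ZMod 2)) - 𝟙 _).hom.toLinearMap = 0 := by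
    ext
    exact sub_self (1 : k)
  rcases Nat.even_or_odd i with h | h
  · by_cases h0 : i = 0
    · subst h0; exact rank_H0_trivial C
    · have : NeZero i := ⟨h0⟩
      rw [rank_of_iso (Rep.FiniteCyclicGroup.groupCohomologyIsoEven _ _ hg i h), rank_homology_zero]
      · exact Module.rank_self k
      · ext1; exact hn
      · ext1; exact hs
  · rw [rank_of_iso (Rep.FiniteCyclicGroup.groupCohomologyIsoOdd _ _ hg i h), rank_homology_zero]
    · exact Module.rank_self k
    · ext1; exact hs
    · ext1; exact hn

/-- coinduced module -/
noncomputable abbrev Co (ι : C →* G) : Rep k G :=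
  Rep.coind ι.range.subtype (Rep.trivial k ι.range k)

lemma rank_Co (ι : C →* G) (hι : Function.Injective ι) (i : ℕ) :
    Module.rank k (groupCohomology (Co ι) i) = 1 := by
  rw [rank_of_iso (groupCohomology.coindIso _ i), ← rank_C i]
  exact rank_of_iso (groupCohomology.mapIso (MonoidHom.ofInjective hι).symm
    (LinearEquiv.refl k k) (fun g => rfl) i)

noncomputable abbrev Fr : Rep k G :=
  Rep.coind (⊥ : Subgroup G).subtype (Rep.trivial k (⊥ : Subgroup G) k)

lemma Fr_zero (i : ℕ) : Limits.IsZero (groupCohomology Fr (i+1)) :=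
  (isZero_groupCohomology_succ_of_subsingleton _ i).of_iso (groupCohomology.coindIso _ _)

/-- pullback on cohomology with trivial coefficients -/
noncomputable abbrev pull {Γ Δ : Type} [Group Γ] [Group Δ] (f : Γ →* Δ) (i : ℕ) :
    groupCohomology (Rep.trivial k Δ k) i ⟶ groupCohomology (Rep.trivial k Γ k) i :=
  groupCohomology.map f (Rep.ofHom ⟨LinearMap.id, fun _ => rfl⟩) i

lemma pull_comp {Γ Δ E : Type} [Group Γ] [Group Δ] [Group E] (f : Γ →* Δ) (g : Δ →* E) (i : ℕ) :
    pull g i ≫ pull f i = pull (g.comp f) i := by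
  exact (groupCohomology.map_comp g f (Rep.ofHom ⟨LinearMap.id, fun _ => rfl⟩)
    (Rep.ofHom ⟨LinearMap.id, fun _ => rfl⟩) i).symm

lemma pull_id {Γ : Type} [Group Γ] (i : ℕ) : pull (MonoidHom.id Γ) i = 𝟙 _ :=
  groupCohomology.map_id _

lemma pull_one {Γ Δ : Type} [Group Γ] [Group Δ] (i : ℕ) :
    pull (1 : Γ →* Δ) (i+1) = 0 := by
  have : (1 : Γ →* Δ) = (1 : Unit →* Δ).comp (1 : Γ →* Unit) := by ext; simp
  rw [this, ← pull_comp]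
  have h : Limits.IsZero (groupCohomology (Rep.trivial k Unit k) (i+1)) :=
    isZero_groupCohomology_succ_of_subsingleton _ i
  rw [h.eq_of_tgt (pull _ _) 0, Limits.zero_comp]

/-- evaluation at one -/
noncomputable def ev (ι : C →* G) : Rep.res ι (Co ι) ⟶ Rep.trivial k C k :=
  Rep.ofHom ⟨(LinearMap.proj (1 : G)) ∘ₗ (Submodule.subtype _), fun c => by
    ext f
    have := f.2 ⟨ι c, c, rfl⟩ 1
    rw [mul_one] at this
    change f.1 (1 * ι c) = f.1 1
    rw [one_mul]
    exact this⟩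

/-- constants -/
noncomputable def cst (ι : C →* G) : Rep.trivial k G k ⟶ Co ι :=
  Rep.ofHom ⟨(LinearMap.pi fun _ => LinearMap.id).codRestrict _ (fun _ _ _ => rfl), fun g => by
    ext; rfl⟩

lemma cst_ev (ι : C →* G) (i : ℕ) :
    groupCohomology.map (MonoidHom.id G) (cst ι) i ≫ groupCohomology.map ι (ev ι) i = pull ι i := by
  rw [← groupCohomology.map_comp]
  rfl

/-- map on cohomology induced by a map of coefficients -/
noncomputable abbrev hm {A B : Rep k G} (φ : A ⟶ B) (i : ℕ) :
    groupCohomology A i ⟶ groupCohomology B i := groupCohomology.map (MonoidHom.id G) φ i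

lemma hm_comp {A B D : Rep k G} (φ : A ⟶ B) (ψ : B ⟶ D) (i : ℕ) :
    hm (φ ≫ ψ) i = hm φ i ≫ hm ψ i := groupCohomology.map_id_comp φ ψ i

lemma hm_add {A B : Rep k G} (φ ψ : A ⟶ B) (i : ℕ) :
    hm (φ + ψ) i = hm φ i + hm ψ i := by
  have : groupCohomology.cochainsMap (MonoidHom.id G) (φ + ψ) =
    groupCohomology.cochainsMap (MonoidHom.id G) φ +
      groupCohomology.cochainsMap (MonoidHom.id G) ψ := rfl
  change HomologicalComplex.homologyMap _ _ = _
  rw [this, HomologicalComplex.homologyMap_add]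
  rfl

def ix : C →* G where
  toFun c := if c = 1 then 1 else DihedralGroup.sr 0
  map_one' := rfl
  map_mul' := by decide

def iy : C →* G where
  toFun c := if c = 1 then 1 else DihedralGroup.sr 1
  map_one' := rfl
  map_mul' := by decide

def px : G →* C where
  toFun g := match g with
    | .r j => Multiplicative.ofAdd (ZMod.castHom (by decide : 2 ∣ 4) (ZMod 2) j)
    | .sr j => Multiplicative.ofAdd (1 + ZMod.castHom (by decide : 2 ∣ 4) (ZMod 2) j)
  map_one' := by decide
  map_mul' := by decide

def py : G →* C where
  toFun g := match g with
    | .r j => Multiplicative.ofAdd (ZMod.castHom (by decide : 2 ∣ 4) (ZMod 2) j)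
    | .sr j => Multiplicative.ofAdd (ZMod.castHom (by decide : 2 ∣ 4) (ZMod 2) j)
  map_one' := by decide
  map_mul' := by decide

lemma ix_inj : Function.Injective ix := by decide
lemma iy_inj : Function.Injective iy := by decide
lemma px_ix : px.comp ix = MonoidHom.id C := by ext x; revert x; decide
lemma px_iy : px.comp iy = 1 := by ext x; revert x; decide
lemma py_ix : py.comp ix = 1 := by ext x; revert x; decide
lemma py_iy : py.comp iy = MonoidHom.id C := by ext x; revert x; decide

noncomputable abbrev AA : Rep k G := Rep.of ((Co ix).ρ.prod (Co iy).ρ)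

noncomputable def fstA : AA ⟶ Co ix := Rep.ofHom ⟨LinearMap.fst k _ _, fun _ => rfl⟩
noncomputable def sndA : AA ⟶ Co iy := Rep.ofHom ⟨LinearMap.snd k _ _, fun _ => rfl⟩
noncomputable def inlA : Co ix ⟶ AA := Rep.ofHom ⟨LinearMap.inl k _ _, fun g => by
  ext x : 1
  exact Prod.ext rfl (map_zero ((Co iy).ρ g)).symm⟩
noncomputable def inrA : Co iy ⟶ AA := Rep.ofHom ⟨LinearMap.inr k _ _, fun g => by
  ext x : 1
  exact Prod.ext (map_zero ((Co ix).ρ g)).symm rfl⟩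

lemma tot : fstA ≫ inlA + sndA ≫ inrA = 𝟙 AA := by
  apply Rep.hom_ext
  apply Representation.IntertwiningMap.ext
  apply LinearMap.ext
  rintro ⟨a, b⟩
  exact Prod.ext (add_zero a) (zero_add b)

noncomputable def dg : Rep.trivial k G k ⟶ AA :=
  Rep.ofHom ⟨LinearMap.prod (cst ix).hom.toLinearMap (cst iy).hom.toLinearMap, fun _ => rfl⟩

lemma dg_fst : dg ≫ fstA = cst ix := rfl
lemma dg_snd : dg ≫ sndA = cst iy := rfl

lemma ev_surj (ι : C →* G) (p : G →* C) (h : p.comp ι = MonoidHom.id C) (i : ℕ) :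
    Function.Surjective (groupCohomology.map ι (ev ι) i) := by
  intro z
  refine ⟨hm (cst ι) i (pull p i z), ?_⟩
  have h1 := pull_comp ι p i
  rw [h, pull_id, ← cst_ev] at h1
  exact congr($h1 z)

lemma ev_inj (ι : C →* G) (hι : Function.Injective ι) (p : G →* C)
    (h : p.comp ι = MonoidHom.id C) (i : ℕ) :
    Function.Injective (groupCohomology.map ι (ev ι) i) := by
  have h1 := rank_Co ι hι i
  have h2 := rank_C i
  have f1 : FiniteDimensional k (groupCohomology (Co ι) i) :=
    Module.rank_lt_aleph0_iff.1 (by rw [h1]; exact Cardinal.one_lt_aleph0)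
  have f2 : FiniteDimensional k (groupCohomology (Rep.trivial k C k) i) :=
    Module.rank_lt_aleph0_iff.1 (by rw [h2]; exact Cardinal.one_lt_aleph0)
  refine (LinearMap.injective_iff_surjective_of_finrank_eq_finrank
    (f := (groupCohomology.map ι (ev ι) i).hom) ?_).2 (ev_surj ι p h i)
  rw [Module.finrank, Module.finrank, h1, h2]

noncomputable def E (i : ℕ) : groupCohomology AA i →ₗ[k]
    (groupCohomology (Rep.trivial k C k) i × groupCohomology (Rep.trivial k C k) i) :=
  LinearMap.prod (hm fstA i ≫ groupCohomology.map ix (ev ix) i).hom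
    (hm sndA i ≫ groupCohomology.map iy (ev iy) i).hom

lemma E_inj (i : ℕ) : Function.Injective (E i) := by
  rw [injective_iff_map_eq_zero]
  intro z hz
  have h1 : groupCohomology.map ix (ev ix) i (hm fstA i z) = 0 := congrArg Prod.fst hz
  have h2 : groupCohomology.map iy (ev iy) i (hm sndA i z) = 0 := congrArg Prod.snd hz
  have h1' : hm fstA i z = 0 := ev_inj ix ix_inj px px_ix i (by rw [h1, map_zero])
  have h2' : hm sndA i z = 0 := ev_inj iy iy_inj py py_iy i (by rw [h2, map_zero])
  have t : hm (fstA ≫ inlA + sndA ≫ inrA) i = 𝟙 _ := by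
    rw [tot]; exact groupCohomology.map_id _
  rw [hm_add, hm_comp, hm_comp] at t
  have t' : hm inlA i (hm fstA i z) + hm inrA i (hm sndA i z) = z := congr($t z)
  rw [h1', h2', map_zero, map_zero, add_zero] at t'
  exact t'.symm

lemma E_dg (i : ℕ) (w : groupCohomology (Rep.trivial k G k) i) :
    E i (hm dg i w) = (pull ix i w, pull iy i w) := by
  apply Prod.ext
  · have : hm dg i ≫ hm fstA i ≫ groupCohomology.map ix (ev ix) i = pull ix i := by
      rw [← Category.assoc, ← hm_comp, dg_fst, cst_ev]
    exact congr($this w)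
  · have : hm dg i ≫ hm sndA i ≫ groupCohomology.map iy (ev iy) i = pull iy i := by
      rw [← Category.assoc, ← hm_comp, dg_snd, cst_ev]
    exact congr($this w)

lemma E_dg_surj (i : ℕ) : ∀ z, ∃ w, E (i+1) (hm dg (i+1) w) = z := by
  rintro ⟨a, b⟩
  refine ⟨pull px (i+1) a + pull py (i+1) b, ?_⟩
  have e1 : pull ix (i+1) (pull px (i+1) a) = a := by
    have := pull_comp ix px (i+1)
    rw [px_ix, pull_id] at this
    exact congr($this a)
  have e2 : pull ix (i+1) (pull py (i+1) b) = 0 := by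
    have := pull_comp ix py (i+1)
    rw [py_ix, pull_one] at this
    exact congr($this b)
  have e3 : pull iy (i+1) (pull px (i+1) a) = 0 := by
    have := pull_comp iy px (i+1)
    rw [px_iy, pull_one] at this
    exact congr($this a)
  have e4 : pull iy (i+1) (pull py (i+1) b) = b := by
    have := pull_comp iy py (i+1)
    rw [py_iy, pull_id] at this
    exact congr($this b)
  rw [E_dg, map_add, map_add, e1, e2, e3, e4, add_zero, zero_add]

lemma dg_surj (i : ℕ) : Function.Surjective (hm dg (i+1)) := by
  intro z
  obtain ⟨w, hw⟩ := E_dg_surj i (E (i+1) z)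
  exact ⟨w, E_inj _ hw⟩

lemma rank_AA (i : ℕ) : Module.rank k (groupCohomology AA (i+1)) = 2 := by
  have := (LinearEquiv.ofBijective (E (i+1)) ⟨E_inj _, fun z => by
    obtain ⟨w, hw⟩ := E_dg_surj i z
    exact ⟨_, hw⟩⟩).rank_eq
  rw [this, rank_prod', rank_C]
  norm_num

/-- sum of values -/
noncomputable def sm : Fr ⟶ Rep.trivial k G k :=
  Rep.ofHom ⟨(∑ g : G, LinearMap.proj g) ∘ₗ (Submodule.subtype _), fun g => by
    apply LinearMap.ext
    intro f
    change (∑ g : G, LinearMap.proj (R := k) (φ := fun _ : G => k) g) _ =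
      (∑ g : G, LinearMap.proj (R := k) (φ := fun _ : G => k) g) _
    rw [LinearMap.sum_apply, LinearMap.sum_apply]
    exact Fintype.sum_equiv (Equiv.mulRight g) _ _ (fun _ => rfl)⟩

lemma sm_apply (f : Fr) : sm.hom f = ∑ g : G, f.1 g := by
  change (∑ g : G, LinearMap.proj (R := k) (φ := fun _ : G => k) g) _ = _
  rw [LinearMap.sum_apply]
  rfl

noncomputable abbrev KK : Rep k G := Rep.of (X := LinearMap.ker sm.hom.toLinearMap)
  { toFun g := (Fr.ρ g).restrict (fun x hx => by
      have := Rep.hom_comm_apply sm g x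
      rw [LinearMap.mem_ker] at hx ⊢
      exact this.trans hx)
    map_one' := by
      apply LinearMap.ext
      intro x
      exact Subtype.ext (congr($(map_one Fr.ρ) x.1))
    map_mul' a b := by
      apply LinearMap.ext
      intro x
      exact Subtype.ext (congr($(map_mul Fr.ρ a b) x.1)) }

noncomputable def inc : KK ⟶ Fr := Rep.ofHom ⟨Submodule.subtype _, fun _ => rfl⟩

lemma sum_inv (c : ZMod 4) (f : G → k) (hf : ∀ g, f (DihedralGroup.sr c * g) = f g) :
    ∑ g, f g = 0 := by
  refine Finset.sum_involution (fun g _ => DihedralGroup.sr c * g) ?_ ?_ ?_ ?_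
  · intro g _
    rw [hf]; exact CharTwo.add_self_eq_zero _
  · intro g _ _
    simp
    exact fun h => by cases h
  · intro g _
    exact Finset.mem_univ _
  · intro g _
    rw [← mul_assoc, DihedralGroup.sr_mul_self, one_mul]

lemma sum_G (f : G → k) : ∑ g, f g = f (.r 0) + f (.r 1) + f (.r 2) + f (.r 3)
    + (f (.sr 0) + f (.sr 1) + f (.sr 2) + f (.sr 3)) := by
  have : (Finset.univ : Finset G) =
    {.r 0, .r 1, .r 2, .r 3, .sr 0, .sr 1, .sr 2, .sr 3} := by decide
  rw [this, Finset.sum_insert (by decide), Finset.sum_insert (by decide),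
    Finset.sum_insert (by decide), Finset.sum_insert (by decide), Finset.sum_insert (by decide),
    Finset.sum_insert (by decide), Finset.sum_insert (by decide), Finset.sum_singleton]
  ring

lemma Co_x (f : Co ix) (g : G) : f.1 (DihedralGroup.sr 0 * g) = f.1 g :=
  f.2 ⟨DihedralGroup.sr 0, Multiplicative.ofAdd 1, rfl⟩ g

lemma Co_y (f : Co iy) (g : G) : f.1 (DihedralGroup.sr 1 * g) = f.1 g :=
  f.2 ⟨DihedralGroup.sr 1, Multiplicative.ofAdd 1, rfl⟩ g

lemma mk_x (f : G → k) (h : ∀ j, f (.sr j) = f (.r j)) :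
    f ∈ Representation.coindV ix.range.subtype (Rep.trivial k ix.range k).ρ := by
  rintro ⟨_, c, rfl⟩ g
  change f (ix c * g) = f g
  by_cases hc : c = 1
  · rw [hc, map_one, one_mul]
  · rw [show ix c = DihedralGroup.sr 0 from if_neg hc]
    rcases g with j | j <;> simp [h]

lemma mk_y (f : G → k) (h : ∀ j, f (.sr (1 + j)) = f (.r j)) :
    f ∈ Representation.coindV iy.range.subtype (Rep.trivial k iy.range k).ρ := by
  rintro ⟨_, c, rfl⟩ g
  change f (iy c * g) = f g
  by_cases hc : c = 1
  · rw [hc, map_one, one_mul]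
  · rw [show iy c = DihedralGroup.sr 1 from if_neg hc]
    rcases g with j | j
    · simp [h]
    · rw [DihedralGroup.sr_mul_sr, ← h]; simp

lemma mem_Fr (f : G → k) :
    f ∈ Representation.coindV (⊥ : Subgroup G).subtype (Rep.trivial k (⊥ : Subgroup G) k).ρ := by
  rintro ⟨s, hs⟩ g
  rw [Subgroup.mem_bot] at hs
  subst hs
  change f (1 * g) = f g
  rw [one_mul]

/-- sum map into functions -/
noncomputable def adL : AA.V →ₗ[k] Fr.V :=
  LinearMap.codRestrict _
    (LinearMap.coprod (Submodule.subtype _) (Submodule.subtype _)) (fun _ => mem_Fr _)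

lemma adL_apply (x : AA) (g : G) : (adL x).1 g = x.1.1 g + x.2.1 g := rfl

noncomputable def ad : AA ⟶ KK := Rep.ofHom ⟨adL.codRestrict _ (fun x => by
    rw [LinearMap.mem_ker]
    refine (sm_apply _).trans ?_
    change ∑ g : G, (x.1.1 g + x.2.1 g) = 0
    rw [Finset.sum_add_distrib, sum_inv 0 _ (Co_x x.1), sum_inv 1 _ (Co_y x.2), add_zero]),
  fun _ => rfl⟩

lemma ad_apply (x : AA) (g : G) : (ad.hom x).1.1 g = x.1.1 g + x.2.1 g := rfl

lemma dg_ad : dg ≫ ad = 0 := by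
  apply Rep.hom_ext
  apply Representation.IntertwiningMap.ext
  apply LinearMap.ext
  intro c
  apply Subtype.ext
  apply Subtype.ext
  funext g
  exact CharTwo.add_self_eq_zero (c : k)

lemma inc_sm : inc ≫ sm = 0 := by
  apply Rep.hom_ext
  apply Representation.IntertwiningMap.ext
  apply LinearMap.ext
  intro c
  exact c.2

noncomputable def S1 : ShortComplex (Rep k G) := ShortComplex.mk dg ad dg_ad
noncomputable def S2 : ShortComplex (Rep k G) := ShortComplex.mk inc sm inc_sm

lemma shortExact_mk {S : ShortComplex (Rep.{0} k G)} (h1 : Function.Injective S.f.hom)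
    (h2 : Function.Surjective S.g.hom) (h3 : ∀ x, S.g.hom x = 0 → ∃ y, S.f.hom y = x) :
    S.ShortExact where
  mono_f := (Rep.mono_iff_injective _).2 h1
  epi_g := (Rep.epi_iff_surjective _).2 h2
  exact := by
    rw [← ShortComplex.exact_map_iff_of_faithful S (forget₂ (Rep k G) (ModuleCat k)),
      ShortComplex.moduleCat_exact_iff]
    exact h3

lemma S2_exact : S2.ShortExact := by
  apply shortExact_mk
  · exact Subtype.val_injective
  · intro c
    refine ⟨⟨fun g => if g = 1 then c else 0, mem_Fr _⟩, ?_⟩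
    refine (sm_apply _).trans ?_
    change ∑ g : G, (if g = 1 then (c : k) else 0) = c
    simp
  · intro x hx
    exact ⟨⟨x, hx⟩, rfl⟩

lemma S1_exact : S1.ShortExact := by
  apply shortExact_mk
  · intro a b h
    exact congr($(h).1.1 1)
  · intro f
    have hs : ∑ g, f.1.1 g = 0 := (sm_apply _).symm.trans f.2
    rw [sum_G] at hs
    set φ : G → k := f.1.1 with hφ
    let a : ZMod 4 → k := ![0, φ (.sr 1) + φ (.r 0), φ (.sr 2) + φ (.r 1) + (φ (.sr 1) + φ (.r 0)),
      φ (.sr 3) + φ (.r 2) + (φ (.sr 2) + φ (.r 1) + (φ (.sr 1) + φ (.r 0)))]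
    let u : G → k := fun g => match g with
      | .r j => a j
      | .sr j => a j
    let v : G → k := fun g => match g with
      | .r j => φ (.r j) + a j
      | .sr j => φ (.r (j - 1)) + a (j - 1)
    refine ⟨(⟨u, mk_x _ fun j => rfl⟩, ⟨v, mk_y _ fun j => ?_⟩), ?_⟩
    · simp [v]
    · apply Subtype.ext
      apply Subtype.ext
      funext g
      refine (ad_apply _ g).trans ?_
      change u g + v g = φ g
      have two : ∀ x : k, x + x = 0 := CharTwo.add_self_eq_zero
      rcases g with j | j
      · change a j + (φ (.r j) + a j) = _
        linear_combination two (a j)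
      · change a j + (φ (.r (j - 1)) + a (j - 1)) = φ (.sr j)
        have e0 : a 0 = 0 := rfl
        have e1 : a 1 = φ (.sr 1) + φ (.r 0) := rfl
        have e2 : a 2 = φ (.sr 2) + φ (.r 1) + (φ (.sr 1) + φ (.r 0)) := rfl
        have e3 : a 3 = φ (.sr 3) + φ (.r 2) +
          (φ (.sr 2) + φ (.r 1) + (φ (.sr 1) + φ (.r 0))) := rfl
        fin_cases j
        · change a 0 + (φ (.r 3) + a 3) = φ (.sr 0)
          rw [e0, e3]
          linear_combination hs - two (φ (.sr 0))
        · change a 1 + (φ (.r 0) + a 0) = φ (.sr 1)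
          rw [e0, e1]
          linear_combination two (φ (.r 0))
        · change a 2 + (φ (.r 1) + a 1) = φ (.sr 2)
          rw [e2, e1]
          linear_combination two (φ (.r 1)) + two (φ (.sr 1) + φ (.r 0))
        · change a 3 + (φ (.r 2) + a 2) = φ (.sr 3)
          rw [e2, e3]
          linear_combination two (φ (.r 2)) + two (φ (.sr 2) + φ (.r 1) + (φ (.sr 1) + φ (.r 0)))
  · rintro ⟨x, y⟩ hxy
    have h : ∀ g, x.1 g + y.1 g = 0 := fun g => congr($(hxy).1.1 g)
    have heq : ∀ g, x.1 g = y.1 g := fun g => by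
      have := h g
      rwa [CharTwo.add_eq_zero] at this
    have xx : ∀ j, x.1 (.sr j) = x.1 (.r j) := fun j => by
      have := Co_x x (.r j)
      simpa using this
    have yy : ∀ j, x.1 (.sr (1 + j)) = x.1 (.r j) := fun j => by
      have := Co_y y (.r j)
      rw [heq, heq]
      simpa using this
    have st : ∀ j, x.1 (.r (1 + j)) = x.1 (.r j) := fun j => by rw [← xx, yy]
    have hc : ∀ g, x.1 g = x.1 (.r 0) := by
      have h1 := st 0
      have h2 := st 1
      have h3 := st 2
      have r : ∀ j, x.1 (.r j) = x.1 (.r 0) := by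
        intro j
        fin_cases j
        · rfl
        · exact h1
        · exact h2.trans h1
        · exact h3.trans (h2.trans h1)
      rintro (j | j)
      · exact r j
      · rw [xx, r]
    refine ⟨x.1 (.r 0), ?_⟩
    apply Prod.ext
    · apply Subtype.ext
      funext g
      exact (hc g).symm
    · apply Subtype.ext
      funext g
      exact (hc g).symm.trans (heq g)

/-- A map vanishing on (or hitting all of) invariants does so on degree zero cohomology. -/
lemma hm_zero_deg {A B : Rep.{0} k G} (φ : A ⟶ B)
    (h : ∀ x ∈ A.ρ.invariants, φ.hom x = 0) : hm φ 0 = 0 := by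
  have e := groupCohomology.map_id_comp_H0Iso_hom φ
  have z : (Rep.invariantsFunctor k G).map φ = 0 := by
    ext x
    exact Subtype.ext (h x.1 x.2)
  rw [z, Limits.comp_zero] at e
  rw [← cancel_mono (groupCohomology.H0Iso B).hom, Limits.zero_comp]
  exact e

lemma hm_surj_deg {A B : Rep.{0} k G} (φ : A ⟶ B)
    (h : ∀ y ∈ B.ρ.invariants, ∃ x ∈ A.ρ.invariants, φ.hom x = y) :
    Function.Surjective (hm φ 0) := by
  have e := groupCohomology.map_id_comp_H0Iso_hom φ
  have z : Epi ((Rep.invariantsFunctor k G).map φ) := by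
    rw [ModuleCat.epi_iff_surjective]
    rintro ⟨y, hy⟩
    obtain ⟨x, hx, hxy⟩ := h y hy
    exact ⟨⟨x, hx⟩, Subtype.ext hxy⟩
  rw [← ModuleCat.epi_iff_surjective]
  have e' : hm φ 0 = (groupCohomology.H0Iso A).hom ≫ (Rep.invariantsFunctor k G).map φ ≫
      (groupCohomology.H0Iso B).inv := by
    rw [← Category.assoc, ← e, Category.assoc, Iso.hom_inv_id, Category.comp_id]
  rw [e']
  infer_instance

lemma Fr_inv (f : Fr) (hf : f ∈ Fr.ρ.invariants) (g : G) : f.1 g = f.1 1 := by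
  have h1 : (Fr.ρ g f).1 1 = f.1 1 := congr($(hf g).1 1)
  have h2 : (Fr.ρ g f).1 1 = f.1 (1 * g) := rfl
  rw [← h1, h2, one_mul]

lemma hm_sm (i : ℕ) : hm sm i = 0 := by
  cases i with
  | zero =>
    apply hm_zero_deg
    intro f hf
    rw [sm_apply]
    apply sum_inv 0
    intro g
    rw [Fr_inv f hf, Fr_inv f hf g]
  | succ i => exact (Fr_zero i).eq_of_src _ _

lemma hm_ad_zero : Function.Surjective (hm ad 0) := by
  apply hm_surj_deg
  intro f hf
  have hf' : f.1 ∈ Fr.ρ.invariants := fun g => congr($(hf g).1)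
  refine ⟨(⟨fun _ => f.1.1 1, mk_x _ fun _ => rfl⟩, 0), ?_, ?_⟩
  · intro g
    exact Prod.ext rfl (map_zero ((Co iy).ρ g))
  · apply Subtype.ext
    apply Subtype.ext
    funext g
    refine (ad_apply _ g).trans ?_
    rw [Fr_inv _ hf' g]
    exact add_zero _

lemma rank_KK (i : ℕ) : Module.rank k (groupCohomology KK (i+1)) =
    Module.rank k (groupCohomology (Rep.trivial k G k) i) := by
  have hepi : Epi (groupCohomology.δ S2_exact i (i+1) rfl) :=
    groupCohomology.epi_δ_of_isZero S2_exact i (Fr_zero i)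
  have hmono : Mono (groupCohomology.δ S2_exact i (i+1) rfl) :=
    (groupCohomology.mapShortComplex₃_exact S2_exact (rfl : i + 1 = i + 1)).mono_g (hm_sm i)
  have := isIso_of_mono_of_epi (groupCohomology.δ S2_exact i (i+1) rfl)
  exact (rank_of_iso (asIso (groupCohomology.δ S2_exact i (i+1) rfl))).symm

lemma hm_ad_succ (i : ℕ) : hm ad (i+1) = 0 := by
  have : Epi (hm dg (i+1)) := (ModuleCat.epi_iff_surjective _).2 (dg_surj i)
  rw [← cancel_epi (hm dg (i+1)), ← hm_comp, dg_ad, Limits.comp_zero]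
  exact (groupCohomology.functor k G (i+1)).map_zero _ _

lemma rank_one : Module.rank k (groupCohomology (Rep.trivial k G k) 1) = 2 := by
  have hepi : Epi (hm ad 0) := (ModuleCat.epi_iff_surjective _).2 hm_ad_zero
  have hδ : groupCohomology.δ S1_exact 0 1 rfl = 0 := by
    have := (groupCohomology.mapShortComplex₃ S1_exact (rfl : 0 + 1 = 1)).zero
    exact (cancel_epi (hm ad 0)).1 (this.trans Limits.comp_zero.symm)
  have hmono : Mono (hm dg 1) :=
    (groupCohomology.mapShortComplex₁_exact S1_exact (rfl : 0 + 1 = 1)).mono_g hδ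
  rw [← rank_AA 0]
  exact (LinearEquiv.ofBijective (hm dg 1).hom
    ⟨(ModuleCat.mono_iff_injective _).1 hmono, dg_surj 0⟩).rank_eq

lemma rank_step (n : ℕ) : Module.rank k (groupCohomology (Rep.trivial k G k) (n+2)) =
    Module.rank k (groupCohomology (Rep.trivial k G k) n) + 2 := by
  have hmono : Mono (groupCohomology.δ S1_exact (n+1) (n+2) rfl) :=
    (groupCohomology.mapShortComplex₃_exact S1_exact (rfl : (n + 1) + 1 = n + 2)).mono_g
      (hm_ad_succ n)
  have hex : LinearMap.range (groupCohomology.δ S1_exact (n+1) (n+2) rfl).hom =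
      LinearMap.ker (hm dg (n+2)).hom :=
    (groupCohomology.mapShortComplex₁_exact S1_exact
      (rfl : (n + 1) + 1 = n + 2)).moduleCat_range_eq_ker
  have h := LinearMap.rank_eq_of_surjective (f := (hm dg (n+2)).hom) (dg_surj (n+1))
  have h' := (LinearEquiv.ofInjective (groupCohomology.δ S1_exact (n+1) (n+2) rfl).hom
    ((ModuleCat.mono_iff_injective _).1 hmono)).rank_eq
  rw [h, rank_AA, ← hex, ← rank_KK n, add_comm]
  exact congrArg (· + 2) h'.symm

lemma rank_main (n : ℕ) :
    Module.rank k (groupCohomology (Rep.trivial k G k) n) = ((n + 1 : ℕ) : Cardinal) := by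
  induction n using Nat.twoStepInduction with
  | zero => rw [rank_H0_trivial]; simp
  | one => rw [rank_one]; norm_num
  | more n ih _ => rw [rank_step, ih]; push_cast; ring

end D8


/-- The Poincaré series of `H^*(D₈; 𝔽₂)` is `∑ (i+1) tⁱ = 1/(1-t)²`, i.e. the
`𝔽₂`-dimension of the `i`-th mod-2 group cohomology of the dihedral group of
order 8 equals `i + 1` for every `i ≥ 0`.  (Here `DihedralGroup 4` is the
dihedral group of order `8`.) -/
theorem stmt_7 (i : ℕ) :
    Module.finrank (ZMod 2)
      (groupCohomology (Rep.trivial (ZMod 2) (DihedralGroup 4) (ZMod 2)) i)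
      = i + 1 := by
  rw [Module.finrank, D8.rank_main, Cardinal.toNat_natCast]
end

section
/- If S^l → S^m → S^n is a fibration of spheres with l, n ≥ 1, then n = l + 1 and m = 2n − 1. -/
/-- A continuous map is a Serre fibration if it has the homotopy lifting
property with respect to all cubes `[0,1]ᵏ`. -/
def IsSerreFibration {E B : Type} [TopologicalSpace E] [TopologicalSpace B]
    (p : C(E, B)) : Prop :=
  ∀ (k : ℕ) (h : C((Fin k → unitInterval) × unitInterval, B))
    (h₀ : C(Fin k → unitInterval, E)),
    (∀ y, p (h₀ y) = h (y, 0)) →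
    ∃ H : C((Fin k → unitInterval) × unitInterval, E),
      (∀ z, p (H z) = h z) ∧ (∀ y, H (y, 0) = h₀ y)

/-- The standard `n`-sphere. -/
abbrev Sph (n : ℕ) : Type := Metric.sphere (0 : EuclideanSpace ℝ (Fin (n + 1))) 1


/-! ### Algebra: subcomplexes of a differential `𝔽₂`-vector space -/

abbrev K2 := ZMod 2

section Algebra

variable {N : Type} [AddCommGroup N] [Module K2 N]

theorem k2_add_self (x : N) : x + x = 0 := ZModModule.add_self x

theorem k2_add_cancel (x y : N) : x + (x + y) = y := by
  rw [← add_assoc, k2_add_self, zero_add]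

theorem k2_eq_of_add_eq_zero {x y : N} (h : x + y = 0) : x = y := by
  have := k2_add_cancel x y
  rw [h, add_zero] at this
  exact this

/-- A graded family of subspaces, stable under the differential. -/
structure SubCx (d : N →ₗ[K2] N) where
  car : ℕ → Submodule K2 N
  step : ∀ k, ∀ x ∈ car (k + 1), d x ∈ car k
  zero : ∀ x ∈ car 0, d x = 0
  sq : ∀ x, d (d x) = 0

variable {d : N →ₗ[K2] N}

def SubCx.Z (G : SubCx d) (k : ℕ) : Submodule K2 N := G.car k ⊓ LinearMap.ker d

def SubCx.B (G : SubCx d) (k : ℕ) : Submodule K2 N := (G.car (k + 1)).map d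

theorem SubCx.mem_Z {G : SubCx d} {k : ℕ} {x : N} : x ∈ G.Z k ↔ x ∈ G.car k ∧ d x = 0 := by
  simp [SubCx.Z]

theorem SubCx.mem_B {G : SubCx d} {k : ℕ} {x : N} :
    x ∈ G.B k ↔ ∃ y ∈ G.car (k + 1), d y = x := by
  simp [SubCx.B]

/-- Homology of a subcomplex. -/
abbrev SubCx.H (G : SubCx d) (k : ℕ) : Type := (G.Z k) ⧸ (G.B k).comap (G.Z k).subtype

def SubCx.cls (G : SubCx d) (k : ℕ) : G.Z k →ₗ[K2] G.H k := Submodule.mkQ _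

theorem SubCx.cls_surj (G : SubCx d) (k : ℕ) (x : G.H k) : ∃ z, G.cls k z = x :=
  Submodule.mkQ_surjective _ x

theorem SubCx.cls_eq_zero (G : SubCx d) (k : ℕ) (z : G.Z k) :
    G.cls k z = 0 ↔ ∃ y ∈ G.car (k + 1), d y = z := by
  simp [SubCx.cls, ← SubCx.mem_B]

def SubCx.le (G G' : SubCx d) : Prop := ∀ k, G.car k ≤ G'.car k

theorem SubCx.le.Z {G G' : SubCx d} (h : G.le G') (k : ℕ) : G.Z k ≤ G'.Z k :=
  inf_le_inf_right _ (h k)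

def SubCx.inc {G G' : SubCx d} (h : G.le G') (k : ℕ) : G.H k →ₗ[K2] G'.H k :=
  Submodule.mapQ _ _ (Submodule.inclusion (h.Z k)) (by
    intro x hx
    simp only [Submodule.mem_comap, Submodule.subtype_apply, SubCx.mem_B] at hx ⊢
    obtain ⟨y, hy, e⟩ := hx
    exact ⟨y, h _ hy, by simpa using e⟩)

theorem SubCx.inc_cls {G G' : SubCx d} (h : G.le G') (k : ℕ) (z : G.Z k) :
    SubCx.inc h k (G.cls k z) = G'.cls k ⟨z, h.Z k z.2⟩ := rfl

theorem SubCx.inc_inc {G G' G'' : SubCx d} (h : G.le G') (h' : G'.le G'') (h'' : G.le G'')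
    (k : ℕ) (x : G.H k) : SubCx.inc h' k (SubCx.inc h k x) = SubCx.inc h'' k x := by
  obtain ⟨z, rfl⟩ := G.cls_surj k x
  rfl

theorem SubCx.inc_bij {G G' : SubCx d} (h : G.le G') (k : ℕ)
    (hs : ∀ z ∈ G'.Z k, ∃ w ∈ G.Z k, ∃ y ∈ G'.car (k + 1), z + w = d y)
    (hi : ∀ z ∈ G.Z k, ∀ y ∈ G'.car (k + 1), d y = z → ∃ y' ∈ G.car (k + 1), d y' = z) :
    Function.Bijective (SubCx.inc h k) := by
  constructor
  · rw [← LinearMap.ker_eq_bot, LinearMap.ker_eq_bot']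
    intro x hx
    obtain ⟨z, rfl⟩ := G.cls_surj k x
    rw [SubCx.inc_cls, SubCx.cls_eq_zero] at hx
    obtain ⟨y, hy, e⟩ := hx
    rw [SubCx.cls_eq_zero]
    exact hi z z.2 y hy e
  · intro x
    obtain ⟨z, rfl⟩ := G'.cls_surj k x
    obtain ⟨w, hw, y, hy, e⟩ := hs z z.2
    refine ⟨G.cls k ⟨w, hw⟩, ?_⟩
    rw [SubCx.inc_cls]
    apply k2_eq_of_add_eq_zero
    rw [← map_add, SubCx.cls_eq_zero]
    refine ⟨y, hy, ?_⟩
    rw [← e]; simp [add_comm]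

def SubCx.inf (P Q : SubCx d) : SubCx d where
  car k := P.car k ⊓ Q.car k
  step k x hx := ⟨P.step k x hx.1, Q.step k x hx.2⟩
  zero x hx := P.zero x hx.1
  sq := P.sq

def SubCx.sup (P Q : SubCx d) : SubCx d where
  car k := P.car k ⊔ Q.car k
  step k x hx := by
    obtain ⟨p, hp, q, hq, rfl⟩ := Submodule.mem_sup.1 hx
    rw [map_add]
    exact Submodule.add_mem_sup (P.step k p hp) (Q.step k q hq)
  zero x hx := by
    obtain ⟨p, hp, q, hq, rfl⟩ := Submodule.mem_sup.1 hx
    rw [map_add, P.zero p hp, Q.zero q hq, add_zero]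
  sq := P.sq

theorem SubCx.inf_le_l (P Q : SubCx d) : (P.inf Q).le P := fun _ => inf_le_left
theorem SubCx.inf_le_r (P Q : SubCx d) : (P.inf Q).le Q := fun _ => inf_le_right
theorem SubCx.le_sup_l (P Q : SubCx d) : P.le (P.sup Q) := fun _ => le_sup_left
theorem SubCx.le_sup_r (P Q : SubCx d) : Q.le (P.sup Q) := fun _ => le_sup_right

def SubCx.al (P Q : SubCx d) (k : ℕ) : (P.inf Q).H k →ₗ[K2] P.H k × Q.H k :=
  (SubCx.inc (P.inf_le_l Q) k).prod (SubCx.inc (P.inf_le_r Q) k)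

def SubCx.be (P Q : SubCx d) (k : ℕ) : P.H k × Q.H k →ₗ[K2] (P.sup Q).H k :=
  (SubCx.inc (P.le_sup_l Q) k).coprod (SubCx.inc (P.le_sup_r Q) k)

theorem SubCx.exact_al_be (P Q : SubCx d) (k : ℕ) :
    LinearMap.range (P.al Q k) = LinearMap.ker (P.be Q k) := by
  ext ⟨x, y⟩
  constructor
  · rintro ⟨w, hw⟩
    obtain ⟨z, rfl⟩ := (P.inf Q).cls_surj k w
    simp only [SubCx.al, LinearMap.prod_apply, Function.prod, Prod.mk.injEq] at hw
    rw [← hw.1, ← hw.2]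
    simp only [SubCx.be, LinearMap.mem_ker, LinearMap.coprod_apply, SubCx.inc_cls]
    exact k2_add_self _
  · intro h
    obtain ⟨x, rfl⟩ := P.cls_surj k x
    obtain ⟨y, rfl⟩ := Q.cls_surj k y
    simp only [SubCx.be, LinearMap.mem_ker, LinearMap.coprod_apply, SubCx.inc_cls, ← map_add] at h
    rw [SubCx.cls_eq_zero] at h
    obtain ⟨w, hw, e⟩ := h
    obtain ⟨p, hp, q, hq, rfl⟩ := Submodule.mem_sup.1 hw
    simp only [map_add, Submodule.coe_add] at e
    have hx := SubCx.mem_Z.1 x.2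
    have hy := SubCx.mem_Z.1 y.2
    have e2 : (x : N) + d p = y + d q := by
      apply k2_eq_of_add_eq_zero
      calc (x : N) + d p + (y + d q) = (d p + d q) + (x + y) := by abel
        _ = 0 := by rw [e]; exact k2_add_self _
    have hz : (x : N) + d p ∈ (P.inf Q).Z k := by
      rw [SubCx.mem_Z]
      refine ⟨⟨add_mem hx.1 (P.step k p hp), ?_⟩, ?_⟩
      · rw [e2]; exact add_mem hy.1 (Q.step k q hq)
      · rw [map_add, hx.2, P.sq, add_zero]
    refine ⟨(P.inf Q).cls k ⟨_, hz⟩, ?_⟩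
    simp only [SubCx.al, LinearMap.prod_apply, Function.prod, Prod.mk.injEq, SubCx.inc_cls]
    constructor
    · apply k2_eq_of_add_eq_zero
      rw [← map_add, SubCx.cls_eq_zero]
      refine ⟨p, hp, ?_⟩
      change d p = (x + d p) + x
      rw [add_comm, k2_add_cancel]
    · apply k2_eq_of_add_eq_zero
      rw [← map_add, SubCx.cls_eq_zero]
      refine ⟨q, hq, ?_⟩
      change d q = (x + d p) + y
      rw [e2, add_comm, k2_add_cancel]

/-- Auxiliary space used to define the connecting map. -/
def SubCx.M (P Q : SubCx d) (k : ℕ) : Submodule K2 (N × N) :=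
  (P.car k).prod (Q.car k) ⊓ LinearMap.ker (d.coprod d)

theorem SubCx.mem_M {P Q : SubCx d} {k : ℕ} {x : N × N} :
    x ∈ P.M Q k ↔ (x.1 ∈ P.car k ∧ x.2 ∈ Q.car k) ∧ d x.1 + d x.2 = 0 := by
  simp [SubCx.M]

def SubCx.Mpi (P Q : SubCx d) (k : ℕ) : P.M Q k →ₗ[K2] (P.sup Q).H k :=
  (P.sup Q).cls k ∘ₗ LinearMap.codRestrict _
    (((LinearMap.id (R := K2) (M := N)).coprod LinearMap.id) ∘ₗ (P.M Q k).subtype) (by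
      intro x
      have := SubCx.mem_M.1 x.2
      rw [SubCx.mem_Z]
      refine ⟨?_, ?_⟩
      · exact Submodule.add_mem_sup this.1.1 this.1.2
      · simpa using this.2)

def SubCx.Mde (P Q : SubCx d) (k : ℕ) : P.M Q (k + 1) →ₗ[K2] (P.inf Q).H k :=
  (P.inf Q).cls k ∘ₗ LinearMap.codRestrict _
    (d ∘ₗ (LinearMap.fst K2 N N) ∘ₗ (P.M Q (k + 1)).subtype) (by
      intro x
      have := SubCx.mem_M.1 x.2
      rw [SubCx.mem_Z]
      refine ⟨⟨P.step k _ this.1.1, ?_⟩, ?_⟩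
      · change d (x.1.1) ∈ _
        rw [k2_eq_of_add_eq_zero this.2]
        exact Q.step k _ this.1.2
      · exact P.sq _)

theorem SubCx.Mpi_surj (P Q : SubCx d) (k : ℕ) : Function.Surjective (P.Mpi Q k) := by
  intro x
  obtain ⟨z, rfl⟩ := (P.sup Q).cls_surj k x
  obtain ⟨hz1, hz2⟩ := SubCx.mem_Z.1 z.2
  obtain ⟨p, hp, q, hq, e⟩ := Submodule.mem_sup.1 hz1
  refine ⟨⟨(p, q), SubCx.mem_M.2 ⟨⟨hp, hq⟩, ?_⟩⟩, ?_⟩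
  · rw [← map_add, e, hz2]
  · change (P.sup Q).cls k ⟨p + q, _⟩ = _
    congr 1
    exact Subtype.ext e

theorem SubCx.exists_delta (P Q : SubCx d) (k : ℕ) :
    ∃ δ : (P.sup Q).H (k + 1) →ₗ[K2] (P.inf Q).H k,
      LinearMap.range (P.be Q (k + 1)) = LinearMap.ker δ ∧
      LinearMap.range δ = LinearMap.ker (P.al Q k) := by
  have hker : LinearMap.ker (P.Mpi Q (k + 1)) ≤ LinearMap.ker (P.Mde Q k) := by
    intro x hx
    obtain ⟨⟨hp, hq⟩, hd⟩ := SubCx.mem_M.1 x.2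
    have hx' : (P.sup Q).cls (k + 1) _ = 0 := hx
    rw [SubCx.cls_eq_zero] at hx'
    obtain ⟨y, hy, e⟩ := hx'
    obtain ⟨p', hp', q', hq', rfl⟩ := Submodule.mem_sup.1 hy
    change _ = x.1.1 + x.1.2 at e
    change (P.inf Q).cls k _ = 0
    rw [SubCx.cls_eq_zero]
    have e2 : x.1.1 + d p' = x.1.2 + d q' := by
      apply k2_eq_of_add_eq_zero
      rw [map_add] at e
      calc x.1.1 + d p' + (x.1.2 + d q') = (d p' + d q') + (x.1.1 + x.1.2) := by abel
        _ = 0 := by rw [e]; exact k2_add_self _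
    refine ⟨x.1.1 + d p', ⟨add_mem hp (P.step _ _ hp'), ?_⟩, ?_⟩
    · rw [e2]; exact add_mem hq (Q.step _ _ hq')
    · rw [map_add, P.sq, add_zero]; rfl
  let eqv := LinearMap.quotKerEquivOfSurjective (P.Mpi Q (k + 1)) (P.Mpi_surj Q (k + 1))
  let δ := (LinearMap.ker (P.Mpi Q (k + 1))).liftQ (P.Mde Q k) hker ∘ₗ eqv.symm.toLinearMap
  have hδ : ∀ x, δ (P.Mpi Q (k + 1) x) = P.Mde Q k x := by
    intro x
    have : eqv.symm (P.Mpi Q (k + 1) x) = Submodule.Quotient.mk x := by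
      rw [LinearEquiv.symm_apply_eq]; rfl
    simp only [δ, LinearMap.comp_apply, LinearEquiv.coe_coe, this]
    rfl
  refine ⟨δ, ?_, ?_⟩
  · ext w
    constructor
    · rintro ⟨⟨x, y⟩, rfl⟩
      obtain ⟨x, rfl⟩ := P.cls_surj _ x
      obtain ⟨y, rfl⟩ := Q.cls_surj _ y
      have hx := SubCx.mem_Z.1 x.2
      have hy := SubCx.mem_Z.1 y.2
      have hm : ((x : N), (y : N)) ∈ P.M Q (k + 1) :=
        SubCx.mem_M.2 ⟨⟨hx.1, hy.1⟩, by simp [hx.2, hy.2]⟩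
      have : P.be Q (k + 1) (P.cls _ x, Q.cls _ y) = P.Mpi Q (k + 1) ⟨_, hm⟩ := by
        simp only [SubCx.be, LinearMap.coprod_apply, SubCx.inc_cls, ← map_add]
        rfl
      rw [LinearMap.mem_ker, this, hδ]
      change (P.inf Q).cls k _ = 0
      rw [SubCx.cls_eq_zero]
      exact ⟨0, zero_mem _, by rw [map_zero]; exact hx.2.symm⟩
    · intro h
      obtain ⟨x, rfl⟩ := P.Mpi_surj Q _ w
      rw [LinearMap.mem_ker, hδ] at h
      change (P.inf Q).cls k _ = 0 at h
      rw [SubCx.cls_eq_zero] at h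
      obtain ⟨y, hy, e⟩ := h
      change d y = d x.1.1 at e
      obtain ⟨⟨hp, hq⟩, hd⟩ := SubCx.mem_M.1 x.2
      have h1 : x.1.1 + y ∈ P.Z (k + 1) :=
        SubCx.mem_Z.2 ⟨add_mem hp hy.1, by rw [map_add, e]; exact k2_add_self _⟩
      have h2 : x.1.2 + y ∈ Q.Z (k + 1) :=
        SubCx.mem_Z.2 ⟨add_mem hq hy.2, by rw [map_add, e, add_comm]; exact hd⟩
      refine ⟨(P.cls _ ⟨_, h1⟩, Q.cls _ ⟨_, h2⟩), ?_⟩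
      simp only [SubCx.be, LinearMap.coprod_apply, SubCx.inc_cls, ← map_add]
      change (P.sup Q).cls _ _ = (P.sup Q).cls _ _
      congr 1
      apply Subtype.ext
      change (x.1.1 + y) + (x.1.2 + y) = x.1.1 + x.1.2
      calc (x.1.1 + y) + (x.1.2 + y) = x.1.1 + x.1.2 + (y + y) := by abel
        _ = _ := by rw [k2_add_self, add_zero]
  · ext w
    constructor
    · rintro ⟨x, rfl⟩
      obtain ⟨x, rfl⟩ := P.Mpi_surj Q _ x
      rw [hδ]
      obtain ⟨⟨hp, hq⟩, hd⟩ := SubCx.mem_M.1 x.2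
      change ((P.cls k _, Q.cls k _) : P.H k × Q.H k) = 0
      rw [Prod.mk_eq_zero]
      constructor
      · rw [SubCx.cls_eq_zero]; exact ⟨_, hp, rfl⟩
      · rw [SubCx.cls_eq_zero]; exact ⟨_, hq, (k2_eq_of_add_eq_zero hd).symm⟩
    · intro h
      obtain ⟨z, rfl⟩ := (P.inf Q).cls_surj k w
      have h' : ((P.cls k _, Q.cls k _) : P.H k × Q.H k) = 0 := h
      rw [Prod.mk_eq_zero, SubCx.cls_eq_zero, SubCx.cls_eq_zero] at h'
      obtain ⟨⟨p, hp, ep⟩, ⟨q, hq, eq⟩⟩ := h'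
      have hm : (p, q) ∈ P.M Q (k + 1) :=
        SubCx.mem_M.2 ⟨⟨hp, hq⟩, by
          change d p + d q = 0
          rw [ep, eq]; exact k2_add_self _⟩
      refine ⟨P.Mpi Q _ ⟨_, hm⟩, ?_⟩
      rw [hδ]
      change (P.inf Q).cls k _ = _
      congr 1
      exact Subtype.ext ep

theorem SubCx.be_surj_zero (P Q : SubCx d) : Function.Surjective (P.be Q 0) := by
  intro w
  obtain ⟨x, rfl⟩ := P.Mpi_surj Q _ w
  obtain ⟨⟨hp, hq⟩, hd⟩ := SubCx.mem_M.1 x.2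
  refine ⟨(P.cls _ ⟨_, SubCx.mem_Z.2 ⟨hp, P.zero _ hp⟩⟩,
    Q.cls _ ⟨_, SubCx.mem_Z.2 ⟨hq, Q.zero _ hq⟩⟩), ?_⟩
  simp only [SubCx.be, LinearMap.coprod_apply, SubCx.inc_cls, ← map_add]
  rfl

open Module in
theorem SubCx.mv_zero (P Q : SubCx d) [FiniteDimensional K2 (P.H 0)]
    [FiniteDimensional K2 (Q.H 0)] :
    FiniteDimensional K2 ((P.sup Q).H 0) ∧
    finrank K2 ((P.sup Q).H 0) + finrank K2 (LinearMap.range (P.al Q 0)) =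
      finrank K2 (P.H 0) + finrank K2 (Q.H 0) := by
  have hs := P.be_surj_zero Q
  refine ⟨Module.Finite.of_surjective _ hs, ?_⟩
  have h1 := LinearMap.finrank_range_add_finrank_ker (P.be Q 0)
  rw [LinearMap.range_eq_top.2 hs, finrank_top, ← SubCx.exact_al_be, finrank_prod] at h1
  exact h1

open Module in
theorem SubCx.mv_succ (P Q : SubCx d) (k : ℕ) [FiniteDimensional K2 (P.H (k + 1))]
    [FiniteDimensional K2 (Q.H (k + 1))] [FiniteDimensional K2 ((P.inf Q).H k)] :
    FiniteDimensional K2 ((P.sup Q).H (k + 1)) ∧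
    finrank K2 ((P.sup Q).H (k + 1)) + finrank K2 (LinearMap.range (P.al Q (k + 1))) +
      finrank K2 (LinearMap.range (P.al Q k)) =
      finrank K2 (P.H (k + 1)) + finrank K2 (Q.H (k + 1)) + finrank K2 ((P.inf Q).H k) := by
  obtain ⟨δ, h1, h2⟩ := P.exists_delta Q k
  have hfin : FiniteDimensional K2 ((P.sup Q).H (k + 1)) := by
    have : Module.Finite K2 (LinearMap.ker δ) := by
      rw [← h1]; infer_instance
    have : Module.Finite K2 (_ ⧸ LinearMap.ker δ) :=
      Module.Finite.equiv δ.quotKerEquivRange.symm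
    exact Module.Finite.of_submodule_quotient (LinearMap.ker δ)
  refine ⟨hfin, ?_⟩
  have e1 := LinearMap.finrank_range_add_finrank_ker (P.be Q (k + 1))
  have e2 := LinearMap.finrank_range_add_finrank_ker δ
  have e3 := LinearMap.finrank_range_add_finrank_ker (P.al Q k)
  rw [← SubCx.exact_al_be, finrank_prod] at e1
  rw [← h1, h2] at e2
  omega

end Algebra


/-! ### Cubical chains -/

section Cubes

abbrev II := unitInterval

abbrev Cube (k : ℕ) (X : Type) [TopologicalSpace X] : Type := C(Fin k → II, X)

abbrev PS (X : Type) [TopologicalSpace X] : Type := C(II, X)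

variable {X Y W : Type} [TopologicalSpace X] [TopologicalSpace Y] [TopologicalSpace W]

def insMap {k : ℕ} (i : Fin (k + 1)) (e : II) : C(Fin k → II, Fin (k + 1) → II) :=
  ⟨fun y => i.insertNth (α := fun _ => II) e y, by fun_prop⟩

def face {k : ℕ} (i : Fin (k + 1)) (e : II) (s : Cube (k + 1) X) : Cube k X :=
  s.comp (insMap i e)

def tailMap (k : ℕ) : C(Fin (k + 1) → II, Fin k → II) := ⟨fun y j => y j.succ, by fun_prop⟩

def dgn {k : ℕ} (s : Cube k X) : Cube (k + 1) X := s.comp (tailMap k)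

def curC {k : ℕ} (s : Cube (k + 1) X) : Cube k (PS X) :=
  ContinuousMap.curry (s.comp ⟨fun p : (Fin k → II) × II => Fin.cons (α := fun _ => II) p.2 p.1,
    by
      refine continuous_pi fun j => ?_
      refine Fin.cases ?_ (fun j => ?_) j
      · simp only [Fin.cons_zero]; fun_prop
      · simp only [Fin.cons_succ]; fun_prop⟩)

def uncC {k : ℕ} (s : Cube k (PS X)) : Cube (k + 1) X :=
  ⟨fun y => s (fun j => y j.succ) (y 0), by fun_prop⟩

theorem curC_apply {k : ℕ} (s : Cube (k + 1) X) (y : Fin k → II) (t : II) :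
    curC s y t = s (Fin.cons (α := fun _ => II) t y) := rfl

theorem uncC_apply {k : ℕ} (s : Cube k (PS X)) (y : Fin (k + 1) → II) :
    uncC s y = s (fun j => y j.succ) (y 0) := rfl

@[simp] theorem unc_cur {k : ℕ} (s : Cube (k + 1) X) : uncC (curC s) = s := by
  ext y
  rw [uncC_apply, curC_apply]
  congr 1
  exact Fin.cons_self_tail y

@[simp] theorem cur_unc {k : ℕ} (s : Cube k (PS X)) : curC (uncC s) = s := by
  ext y t
  rw [curC_apply, uncC_apply]
  simp

def evM (e : II) : C(PS X, X) := ⟨fun g => g e, by fun_prop⟩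

def constM : C(X, PS X) := ⟨fun x => ContinuousMap.const II x, ContinuousMap.continuous_const'⟩

def preM (e : C(II, II)) : C(PS X, PS X) := ⟨fun g => g.comp e, ContinuousMap.continuous_precomp e⟩

def postM (f : C(X, Y)) : C(PS X, PS Y) := ⟨fun g => f.comp g, ContinuousMap.continuous_postcomp f⟩

theorem face_zero {k : ℕ} (e : II) (s : Cube (k + 1) X) : face 0 e s = (evM e).comp (curC s) := by
  ext y
  change s _ = s _
  congr 1
  simp [insMap]

theorem face_succ {k : ℕ} (i : Fin (k + 1)) (e : II) (s : Cube (k + 2) X) :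
    face i.succ e s = uncC (face i e (curC s)) := by
  ext y
  change s _ = s _
  congr 1
  simp only [insMap, ContinuousMap.coe_mk]
  have : y = Fin.cons (α := fun _ => II) (y 0) (fun j => y j.succ) := (Fin.cons_self_tail y).symm
  conv_lhs => rw [this]
  rw [Fin.insertNth_succ_cons]

theorem dgn_eq {k : ℕ} (s : Cube k X) : dgn s = uncC (constM.comp s) := rfl

/-! Unnormalized chains -/

abbrev Ch (k : ℕ) (X : Type) [TopologicalSpace X] : Type := Cube k X →₀ K2

noncomputable def one {k : ℕ} (s : Cube k X) : Ch k X := Finsupp.single s 1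

noncomputable def lin {k : ℕ} {M : Type} [AddCommGroup M] [Module K2 M] (f : Cube k X → M) :
    Ch k X →ₗ[K2] M := Finsupp.linearCombination K2 f

@[simp] theorem lin_one {k : ℕ} {M : Type} [AddCommGroup M] [Module K2 M] (f : Cube k X → M)
    (s : Cube k X) : lin f (one s) = f s := by
  simp [lin, one]

theorem ch_ext {k : ℕ} {M : Type} [AddCommGroup M] [Module K2 M] {f g : Ch k X →ₗ[K2] M}
    (h : ∀ s, f (one s) = g (one s)) : f = g := by
  apply Finsupp.lhom_ext'
  intro s
  apply LinearMap.ext_ring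
  exact h s

noncomputable def push {k : ℕ} (f : C(X, Y)) : Ch k X →ₗ[K2] Ch k Y := lin fun s => one (f.comp s)
noncomputable def cur {k : ℕ} : Ch (k + 1) X →ₗ[K2] Ch k (PS X) := lin fun s => one (curC s)
noncomputable def unc {k : ℕ} : Ch k (PS X) →ₗ[K2] Ch (k + 1) X := lin fun s => one (uncC s)

@[simp] theorem push_one {k : ℕ} (f : C(X, Y)) (s : Cube k X) :
    push f (one s) = one (f.comp s) := lin_one _ _
@[simp] theorem cur_one {k : ℕ} (s : Cube (k + 1) X) : cur (one s) = one (curC s) := lin_one _ _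
@[simp] theorem unc_one {k : ℕ} (s : Cube k (PS X)) : unc (one s) = one (uncC s) := lin_one _ _

@[simp] theorem cur_unc' {k : ℕ} (x : Ch k (PS X)) : cur (unc x) = x := by
  have : (cur ∘ₗ unc : Ch k (PS X) →ₗ[K2] _) = LinearMap.id := ch_ext (by simp)
  exact LinearMap.congr_fun this x

@[simp] theorem unc_cur' {k : ℕ} (x : Ch (k + 1) X) : unc (cur x) = x := by
  have : (unc ∘ₗ cur : Ch (k + 1) X →ₗ[K2] _) = LinearMap.id := ch_ext (by simp)
  exact LinearMap.congr_fun this x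

theorem push_push {k : ℕ} (f : C(X, Y)) (g : C(Y, W)) (x : Ch k X) :
    push g (push f x) = push (g.comp f) x := by
  have : (push g ∘ₗ push f : Ch k X →ₗ[K2] _) = push (g.comp f) :=
    ch_ext (by simp [ContinuousMap.comp_assoc])
  exact LinearMap.congr_fun this x

theorem push_id {k : ℕ} (x : Ch k X) : push (ContinuousMap.id X) x = x := by
  have : (push (ContinuousMap.id X) : Ch k X →ₗ[K2] _) = LinearMap.id := ch_ext (by simp)
  exact LinearMap.congr_fun this x

theorem push_unc {k : ℕ} (f : C(X, Y)) (x : Ch k (PS X)) :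
    push f (unc x) = unc (push (postM f) x) := by
  have : (push f ∘ₗ unc : Ch k (PS X) →ₗ[K2] _) = unc ∘ₗ push (postM f) :=
    ch_ext (by intro s; simp; rfl)
  exact LinearMap.congr_fun this x

theorem cur_push {k : ℕ} (f : C(X, Y)) (x : Ch (k + 1) X) :
    cur (push f x) = push (postM f) (cur x) := by
  rw [← unc_cur' x, push_unc]; simp

noncomputable def bd (k : ℕ) : Ch (k + 1) X →ₗ[K2] Ch k X :=
  lin fun s => ∑ i, (one (face i 0 s) + one (face i 1 s))

theorem bd_zero_unc (x : Ch 0 (PS X)) :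
    bd 0 (unc x) = push (evM 0) x + push (evM 1) x := by
  have : (bd 0 ∘ₗ unc : Ch 0 (PS X) →ₗ[K2] _) = push (evM 0) + push (evM 1) :=
    ch_ext (by intro s; simp [bd, face_zero])
  exact LinearMap.congr_fun this x

theorem bd_succ_unc {k : ℕ} (x : Ch (k + 1) (PS X)) :
    bd (k + 1) (unc x) = push (evM 0) x + push (evM 1) x + unc (bd k x) := by
  have : (bd (k + 1) ∘ₗ unc : Ch (k + 1) (PS X) →ₗ[K2] _) =
      push (evM 0) + push (evM 1) + unc ∘ₗ bd k :=
    ch_ext (by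
      intro s
      simp only [LinearMap.comp_apply, unc_one, bd, lin_one, LinearMap.add_apply, push_one,
        map_sum, map_add]
      rw [Fin.sum_univ_succ]
      simp [face_zero, face_succ])
  exact LinearMap.congr_fun this x

theorem bd_push {k : ℕ} (f : C(X, Y)) (x : Ch (k + 1) X) :
    bd k (push f x) = push f (bd k x) := by
  have : (bd k ∘ₗ push f : Ch (k + 1) X →ₗ[K2] _) = push f ∘ₗ bd k :=
    ch_ext (by
      intro s
      simp only [LinearMap.comp_apply, bd, lin_one, push_one, map_sum, map_add]
      rfl)
  exact LinearMap.congr_fun this x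

theorem bd_bd : ∀ (k : ℕ) {X : Type} [TopologicalSpace X] (x : Ch (k + 2) X),
    bd k (bd (k + 1) x) = 0
  | 0, X, _, x => by
    rw [← unc_cur' x, bd_succ_unc]
    simp only [map_add, bd_push, bd_zero_unc]
    set y := bd 0 (cur x)
    calc _ = (push (evM 0) y + push (evM 0) y) + (push (evM 1) y + push (evM 1) y) := by abel
      _ = 0 := by simp [k2_add_self]
  | k + 1, X, _, x => by
    rw [← unc_cur' x, bd_succ_unc]
    simp only [map_add, bd_push, bd_succ_unc, bd_bd k, map_zero, add_zero]
    set y := bd (k + 1) (cur x)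
    calc _ = (push (evM 0) y + push (evM 0) y) + (push (evM 1) y + push (evM 1) y) := by abel
      _ = 0 := by simp [k2_add_self]

/-! Subdivision -/

noncomputable def sdA : C(II, II) := ⟨fun t => ⟨(t : ℝ) / 3, by
  have := t.2.1; have := t.2.2; constructor <;> linarith⟩, by fun_prop⟩
noncomputable def sdB : C(II, II) := ⟨fun t => ⟨(1 + (t : ℝ)) / 3, by
  have := t.2.1; have := t.2.2; constructor <;> linarith⟩, by fun_prop⟩
noncomputable def sdC : C(II, II) := ⟨fun t => ⟨1 - (t : ℝ) / 3, by
  have := t.2.1; have := t.2.2; constructor <;> linarith⟩, by fun_prop⟩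
noncomputable def sdG : C(II × II, II) := ⟨fun p => ⟨(p.1 : ℝ) * (1 - p.2) + p.2 * ((1 + p.1) / 3), by
  have h1 := p.1.2.1; have h2 := p.1.2.2; have h3 := p.2.2.1; have h4 := p.2.2.2
  constructor
  · have := mul_nonneg h1 (sub_nonneg.2 h4)
    have := mul_nonneg h3 (by linarith : (0 : ℝ) ≤ (1 + p.1) / 3)
    linarith
  · have := mul_nonneg (sub_nonneg.2 h2) (sub_nonneg.2 h4)
    have := mul_nonneg h3 (by linarith : (0 : ℝ) ≤ 1 - (1 + p.1) / 3)
    nlinarith⟩, by fun_prop⟩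

/-- Precomposition with the square `sdG`. -/
noncomputable def tauM : C(PS X, PS (PS X)) :=
  ContinuousMap.curry ⟨fun p : PS X × II =>
    (ContinuousMap.curry (p.1.comp (sdG.comp ContinuousMap.prodSwap))) p.2, by
      have h1 : Continuous fun p : PS X × II => p.1.comp (sdG.comp ContinuousMap.prodSwap) :=
        (ContinuousMap.continuous_precomp _).comp continuous_fst
      have h2 := ContinuousMap.continuous_curry (X := II) (Y := II) (Z := X)
      have h3 := h2.comp h1
      exact continuous_eval.comp (h3.prodMk continuous_snd)⟩

theorem tauM_apply (g : PS X) (s t : II) : tauM g s t = g (sdG (t, s)) := rfl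

theorem tau_ev0 : (evM 0).comp (tauM (X := X)) = ContinuousMap.id _ := by
  ext g t
  change g (sdG (t, 0)) = g t
  congr 1; ext; simp [sdG]
theorem tau_ev1 : (evM 1).comp (tauM (X := X)) = preM sdB := by
  ext g t
  change g (sdG (t, 1)) = g (sdB t)
  congr 1; ext; simp [sdG, sdB]
theorem tau_pev0 : (postM (evM 0)).comp (tauM (X := X)) = preM sdA := by
  ext g t
  change g (sdG (0, t)) = g (sdA t)
  congr 1; ext; simp [sdG, sdA]; ring
theorem tau_pev1 : (postM (evM 1)).comp (tauM (X := X)) = preM sdC := by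
  ext g t
  change g (sdG (1, t)) = g (sdC t)
  congr 1; ext; simp [sdG, sdC]; ring

noncomputable def ES {k : ℕ} : Ch k (PS X) →ₗ[K2] Ch k (PS X) :=
  push (preM sdA) + push (preM sdB) + push (preM sdC)

noncomputable def Sd : ∀ (k : ℕ) (X : Type) [TopologicalSpace X], Ch k X →ₗ[K2] Ch k X
  | 0, _, _ => LinearMap.id
  | k + 1, X, _ => unc ∘ₗ Sd k (PS X) ∘ₗ ES ∘ₗ cur

noncomputable def Dh : ∀ (k : ℕ) (X : Type) [TopologicalSpace X], Ch k X →ₗ[K2] Ch (k + 1) X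
  | 0, _, _ => 0
  | k + 1, X, _ => unc ∘ₗ unc ∘ₗ push tauM ∘ₗ cur + unc ∘ₗ Dh k (PS X) ∘ₗ ES ∘ₗ cur

theorem Sd_unc {k : ℕ} (x : Ch k (PS X)) : Sd (k + 1) X (unc x) = unc (Sd k (PS X) (ES x)) := by
  simp [Sd]

theorem Dh_unc {k : ℕ} (x : Ch k (PS X)) :
    Dh (k + 1) X (unc x) = unc (unc (push tauM x)) + unc (Dh k (PS X) (ES x)) := by
  simp [Dh]

theorem ES_push_post {k : ℕ} (f : C(X, Y)) (x : Ch k (PS X)) :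
    ES (push (postM f) x) = push (postM f) (ES x) := by
  simp only [ES, LinearMap.add_apply, map_add, push_push]
  rfl

theorem push_tau {k : ℕ} (f : C(X, Y)) (x : Ch k (PS X)) :
    push tauM (push (postM f) x) = push (postM (postM f)) (push tauM x) := by
  simp only [push_push]; rfl

theorem Sd_push : ∀ (k : ℕ) {X Y : Type} [TopologicalSpace X] [TopologicalSpace Y] (f : C(X, Y))
    (x : Ch k X), Sd k Y (push f x) = push f (Sd k X x)
  | 0, X, Y, _, _, f, x => rfl
  | k + 1, X, Y, _, _, f, x => by
    rw [← unc_cur' x, push_unc, Sd_unc, ES_push_post, Sd_push k, Sd_unc, push_unc]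

theorem Dh_push : ∀ (k : ℕ) {X Y : Type} [TopologicalSpace X] [TopologicalSpace Y] (f : C(X, Y))
    (x : Ch k X), Dh k Y (push f x) = push f (Dh k X x)
  | 0, X, Y, _, _, f, x => by simp [Dh]
  | k + 1, X, Y, _, _, f, x => by
    rw [← unc_cur' x, push_unc, Dh_unc, ES_push_post, Dh_push k, Dh_unc, map_add, push_unc,
      push_unc, push_unc, push_tau]

theorem bd_ES {k : ℕ} (x : Ch (k + 1) (PS X)) : bd k (ES x) = ES (bd k x) := by
  simp only [ES, LinearMap.add_apply, map_add, bd_push]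

theorem push_ev_ES {k : ℕ} (x : Ch k (PS X)) :
    push (evM 0) (ES x) + push (evM 1) (ES x) = push (evM 0) x + push (evM 1) x := by
  simp only [ES, LinearMap.add_apply, map_add, push_push]
  have h1 : (evM 0).comp (preM (X := X) sdA) = evM 0 := by
    ext g; change g (sdA 0) = g 0; congr 1; ext; simp [sdA]
  have h2 : (evM 1).comp (preM (X := X) sdA) = (evM 0).comp (preM (X := X) sdB) := by
    ext g; change g (sdA 1) = g (sdB 0); congr 1; ext; simp [sdA, sdB]
  have h3 : (evM 1).comp (preM (X := X) sdC) = (evM 1).comp (preM (X := X) sdB) := by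
    ext g; change g (sdC 1) = g (sdB 1); congr 1; ext; simp [sdC, sdB]; norm_num
  have h4 : (evM 0).comp (preM (X := X) sdC) = evM 1 := by
    ext g; change g (sdC 0) = g 1; congr 1; ext; simp [sdC]
  rw [h1, h2, h3, h4]
  set a := push (evM 0) x
  set b := push (evM 1) x
  set c := push ((evM 0).comp (preM sdB)) x
  set e := push ((evM 1).comp (preM sdB)) x
  calc _ = a + b + (c + c) + (e + e) := by abel
    _ = _ := by simp [k2_add_self]

theorem bd_Sd : ∀ (k : ℕ) {X : Type} [TopologicalSpace X] (x : Ch (k + 1) X),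
    bd k (Sd (k + 1) X x) = Sd k X (bd k x)
  | 0, X, _, x => by
    rw [← unc_cur' x, Sd_unc, bd_zero_unc, bd_zero_unc]
    simp only [Sd, LinearMap.id_apply]
    exact push_ev_ES _
  | k + 1, X, _, x => by
    rw [← unc_cur' x, Sd_unc, bd_succ_unc, bd_succ_unc, bd_Sd k, map_add, map_add, Sd_unc,
      ← Sd_push, ← Sd_push, bd_ES, ← map_add, ← map_add, push_ev_ES]

theorem push_tau_sum {k : ℕ} (x : Ch k (PS X)) :
    push (evM 0) (push tauM x) + push (evM 1) (push tauM x) +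
      (push (postM (evM 0)) (push tauM x) + push (postM (evM 1)) (push tauM x)) = x + ES x := by
  simp only [push_push, tau_ev0, tau_ev1, tau_pev0, tau_pev1, push_id, ES, LinearMap.add_apply]
  abel

theorem bd_Dh_zero (x : Ch 0 X) : bd 0 (Dh 0 X x) = x + Sd 0 X x := by
  simp [Dh, Sd, k2_add_self]

theorem bd_Dh : ∀ (k : ℕ) {X : Type} [TopologicalSpace X] (x : Ch (k + 1) X),
    bd (k + 1) (Dh (k + 1) X x) + Dh k X (bd k x) = x + Sd (k + 1) X x
  | 0, X, _, x => by
    rw [← unc_cur' x, Dh_unc, Sd_unc]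
    simp only [Dh, LinearMap.zero_apply, map_zero, add_zero, Sd, LinearMap.id_apply]
    rw [bd_succ_unc, bd_zero_unc, push_unc, push_unc, ← map_add, ← map_add, ← map_add,
      ← push_tau_sum (cur x)]
    congr 1
    abel
  | k + 1, X, _, x => by
    rw [← unc_cur' x, Dh_unc, Sd_unc]
    generalize cur x = y
    have h1 := bd_Dh k (ES y)
    have h2 := push_tau_sum y
    have hE : push (evM 0) (Dh (k + 1) (PS X) (ES y)) + push (evM 1) (Dh (k + 1) (PS X) (ES y)) =
        Dh (k + 1) X (push (evM 0) y) + Dh (k + 1) X (push (evM 1) y) := by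
      rw [← Dh_push, ← Dh_push, ← map_add, push_ev_ES, map_add]
    have e1 : bd (k + 2) (unc (unc (push tauM y))) =
        unc (y + ES y) + unc (unc (push tauM (bd k y))) := by
      rw [bd_succ_unc, bd_succ_unc, push_unc, push_unc, ← push_tau_sum y, bd_push]
      simp only [map_add]
      abel
    have e2 : bd (k + 2) (unc (Dh (k + 1) (PS X) (ES y))) =
        Dh (k + 1) X (push (evM 0) y) + Dh (k + 1) X (push (evM 1) y) +
          unc (bd (k + 1) (Dh (k + 1) (PS X) (ES y))) := by
      rw [bd_succ_unc, hE]
    have e3 : Dh (k + 1) X (bd (k + 1) (unc y)) =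
        Dh (k + 1) X (push (evM 0) y) + Dh (k + 1) X (push (evM 1) y) +
          (unc (unc (push tauM (bd k y))) + unc (Dh k (PS X) (bd k (ES y)))) := by
      rw [bd_succ_unc, map_add, map_add, Dh_unc, bd_ES]
    have e4 : unc (bd (k + 1) (Dh (k + 1) (PS X) (ES y))) + unc (Dh k (PS X) (bd k (ES y))) =
        unc (ES y) + unc (Sd (k + 1) (PS X) (ES y)) := by
      rw [← map_add, h1, map_add]
    rw [map_add, e1, e2, e3]
    generalize Dh (k + 1) X (push (evM 0) y) + Dh (k + 1) X (push (evM 1) y) = A at *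
    generalize unc (unc (push tauM (bd k y))) = B at *
    generalize unc (bd (k + 1) (Dh (k + 1) (PS X) (ES y))) = C at *
    generalize unc (Dh k (PS X) (bd k (ES y))) = E at *
    calc _ = unc (y + ES y) + (B + B) + (A + A) + (C + E) := by abel
      _ = unc y + (unc (ES y) + unc (ES y)) + unc (Sd (k + 1) (PS X) (ES y)) := by
        rw [e4, k2_add_self, k2_add_self, map_add]; abel
      _ = _ := by rw [k2_add_self, add_zero]

/-! Degenerate cubes are respected -/

theorem ES_const {k : ℕ} (x : Ch k X) : ES (push constM x) = push constM x := by
  simp only [ES, LinearMap.add_apply, push_push]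
  change push constM x + push constM x + push constM x = _
  rw [k2_add_self, zero_add]

/-- Chains in a subset -/
noncomputable def ChIn (k : ℕ) (A : Set X) : Submodule K2 (Ch k X) :=
  Finsupp.supported K2 K2 {s : Cube k X | ∀ y, s y ∈ A}

theorem one_mem {k : ℕ} {A : Set X} {s : Cube k X} (h : ∀ y, s y ∈ A) : one s ∈ ChIn k A :=
  Finsupp.single_mem_supported _ _ h

theorem chIn_le {k : ℕ} {A : Set X} {M : Type} [AddCommGroup M] [Module K2 M] (f : Ch k X →ₗ[K2] M)
    (S : Submodule K2 M) (h : ∀ s : Cube k X, (∀ y, s y ∈ A) → f (one s) ∈ S) :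
    ∀ x ∈ ChIn k A, f x ∈ S := by
  have : ChIn k A ≤ S.comap f := by
    rw [ChIn, Finsupp.supported_eq_span_single, Submodule.span_le]
    rintro _ ⟨s, hs, rfl⟩
    exact h s hs
  exact this

def PA (A : Set X) : Set (PS X) := {g | ∀ t, g t ∈ A}

theorem cur_mem {k : ℕ} {A : Set X} : ∀ x ∈ ChIn (k + 1) A, cur x ∈ ChIn k (PA A) :=
  chIn_le _ _ fun s hs => by
    rw [cur_one]; exact one_mem fun y t => hs _

theorem unc_mem {k : ℕ} {A : Set X} : ∀ x ∈ ChIn k (PA A), unc x ∈ ChIn (k + 1) A :=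
  chIn_le _ _ fun s hs => by
    rw [unc_one]; exact one_mem fun y => hs _ _

theorem push_mem {k : ℕ} {A : Set X} {B : Set Y} (f : C(X, Y)) (h : ∀ a ∈ A, f a ∈ B) :
    ∀ x ∈ ChIn k A, push f x ∈ ChIn k B :=
  chIn_le _ _ fun s hs => by
    rw [push_one]; exact one_mem fun y => h _ (hs _)

theorem ES_mem {k : ℕ} {A : Set X} (x : Ch k (PS X)) (hx : x ∈ ChIn k (PA A)) :
    ES x ∈ ChIn k (PA A) := by
  have key : ∀ e : C(II, II), push (preM e) x ∈ ChIn k (PA A) := fun e =>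
    push_mem (A := PA A) (B := PA A) (preM e) (fun g hg t => hg _) x hx
  exact add_mem (add_mem (key _) (key _)) (key _)

theorem Sd_mem : ∀ (k : ℕ) {X : Type} [TopologicalSpace X] {A : Set X},
    ∀ x ∈ ChIn k A, Sd k X x ∈ ChIn k A
  | 0, X, _, A, x, hx => hx
  | k + 1, X, _, A, x, hx => by
    rw [← unc_cur' x, Sd_unc]
    exact unc_mem _ (Sd_mem k _ (ES_mem _ (cur_mem _ hx)))

theorem Dh_mem : ∀ (k : ℕ) {X : Type} [TopologicalSpace X] {A : Set X},
    ∀ x ∈ ChIn k A, Dh k X x ∈ ChIn (k + 1) A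
  | 0, X, _, A, x, hx => by simp [Dh]
  | k + 1, X, _, A, x, hx => by
    rw [← unc_cur' x, Dh_unc]
    refine add_mem (unc_mem _ (unc_mem _ (push_mem tauM ?_ _ (cur_mem _ hx))))
      (unc_mem _ (Dh_mem k _ (ES_mem _ (cur_mem _ hx))))
    intro g hg s t
    exact hg _

theorem bd_mem {k : ℕ} {A : Set X} : ∀ x ∈ ChIn (k + 1) A, bd k x ∈ ChIn k A :=
  chIn_le _ _ fun s hs => by
    rw [bd, lin_one]
    exact sum_mem fun i _ => add_mem (one_mem fun y => hs _) (one_mem fun y => hs _)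

/-! Size of subdivided cubes -/

noncomputable def LipC {k : ℕ} (r : ℕ) (s : Cube k X) : Submodule K2 (Ch k X) :=
  Finsupp.supported K2 K2 {s' : Cube k X | ∃ f : C(Fin k → II, Fin k → II),
    LipschitzWith ((1 / 3) ^ r) f ∧ s' = s.comp f}

theorem lipC_le {k : ℕ} {r : ℕ} {s : Cube k X} {M : Type} [AddCommGroup M] [Module K2 M]
    (g : Ch k X →ₗ[K2] M) (S : Submodule K2 M)
    (h : ∀ f : C(Fin k → II, Fin k → II), LipschitzWith ((1 / 3) ^ r) f → g (one (s.comp f)) ∈ S) :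
    ∀ x ∈ LipC r s, g x ∈ S := by
  have : LipC r s ≤ S.comap g := by
    rw [LipC, Finsupp.supported_eq_span_single, Submodule.span_le]
    rintro _ ⟨s, ⟨f, hf, rfl⟩, rfl⟩
    exact h f hf
  exact this

def LipS (e : C(II, II)) : Prop := ∀ s t, dist (e s) (e t) ≤ 1 / 3 * dist s t

theorem lip_sdA : LipS sdA := by
  intro s t
  simp only [Subtype.dist_eq, Real.dist_eq, sdA, ContinuousMap.coe_mk]
  rw [← sub_div, abs_div, abs_of_pos (by norm_num : (0 : ℝ) < 3)]; linarith
theorem lip_sdB : LipS sdB := by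
  intro s t
  simp only [Subtype.dist_eq, Real.dist_eq, sdB, ContinuousMap.coe_mk]
  rw [← sub_div, abs_div, abs_of_pos (by norm_num : (0 : ℝ) < 3)]
  rw [add_sub_add_left_eq_sub]; linarith
theorem lip_sdC : LipS sdC := by
  intro s t
  simp only [Subtype.dist_eq, Real.dist_eq, sdC, ContinuousMap.coe_mk]
  rw [sub_sub_sub_cancel_left, ← sub_div, abs_div, abs_of_pos (by norm_num : (0 : ℝ) < 3),
    abs_sub_comm]; linarith

theorem Sd_lip : ∀ (k : ℕ) {X : Type} [TopologicalSpace X] (s : Cube k X),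
    Sd k X (one s) ∈ LipC 1 s
  | 0, X, _, s => by
    refine Finsupp.single_mem_supported _ _ ⟨ContinuousMap.id _, ?_, rfl⟩
    exact LipschitzWith.of_dist_le_mul fun x y => by
      rw [Subsingleton.elim x y]; simp
  | k + 1, X, _, s => by
    rw [← unc_cur' (one s), Sd_unc, cur_one]
    have key : ∀ e : C(II, II), LipS e →
        unc (Sd k (PS X) (push (preM e) (one (curC s)))) ∈ LipC 1 s := by
      intro e he
      rw [push_one]
      refine lipC_le unc (LipC 1 s) ?_ _ (Sd_lip k _)
      intro f hf
      rw [unc_one]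
      refine Finsupp.single_mem_supported _ _
        ⟨⟨fun y => Fin.cons (α := fun _ => II) (e (y 0)) (f fun j => y j.succ), ?_⟩, ?_, rfl⟩
      · refine continuous_pi fun j => ?_
        refine Fin.cases ?_ (fun j => ?_) j
        · simp only [Fin.cons_zero]; fun_prop
        · simp only [Fin.cons_succ]; fun_prop
      · refine LipschitzWith.of_dist_le_mul fun x y => ?_
        have hc : ((((1 : NNReal) / 3) ^ 1 : NNReal) : ℝ) = 1 / 3 := by simp
        rw [hc, dist_pi_le_iff (by positivity)]
        intro j
        refine Fin.cases ?_ (fun j => ?_) j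
        · simp only [ContinuousMap.coe_mk, Fin.cons_zero]
          refine (he _ _).trans ?_
          gcongr
          exact dist_le_pi_dist x y 0
        · simp only [ContinuousMap.coe_mk, Fin.cons_succ]
          have h1 := hf.dist_le_mul (fun j => x j.succ) (fun j => y j.succ)
          rw [hc] at h1
          refine (dist_le_pi_dist _ _ j).trans (h1.trans ?_)
          gcongr
          rw [dist_pi_le_iff dist_nonneg]
          intro j
          exact dist_le_pi_dist x y j.succ
    simp only [ES, LinearMap.add_apply, map_add]
    exact add_mem (add_mem (key _ lip_sdA) (key _ lip_sdB)) (key _ lip_sdC)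

theorem Sd_iter_lip (k : ℕ) (s : Cube k X) (r : ℕ) : ((Sd k X) ^ r) (one s) ∈ LipC r s := by
  induction r with
  | zero =>
    refine Finsupp.single_mem_supported _ _ ⟨ContinuousMap.id _, ?_, rfl⟩
    simpa using LipschitzWith.id
  | succ r ih =>
    rw [pow_succ', Module.End.mul_apply]
    refine lipC_le (Sd k X) (LipC (r + 1) s) ?_ _ ih
    intro f hf
    have h1 := lipC_le (LinearMap.id) (LipC (r + 1) s) (fun g hg => ?_) _ (Sd_lip k (s.comp f))
    · exact h1
    · refine Finsupp.single_mem_supported _ _ ⟨f.comp g, ?_, rfl⟩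
      rw [pow_succ]
      simpa using hf.comp hg

/-- After enough subdivisions, a cube in `U ∪ V` is a sum of cubes in `U` or in `V`. -/
theorem Sd_small (k : ℕ) (s : Cube k X) {U V : Set X} (hU : IsOpen U) (hV : IsOpen V)
    (h : ∀ y, s y ∈ U ∪ V) :
    ∃ r₀, ∀ r ≥ r₀, ((Sd k X) ^ r) (one s) ∈ ChIn k U ⊔ ChIn k V := by
  obtain ⟨δ, hδ, hb⟩ := lebesgue_number_lemma_of_metric (s := (Set.univ : Set (Fin k → II)))
    (c := fun b : Bool => if b then s ⁻¹' U else s ⁻¹' V) isCompact_univ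
    (by rintro (_ | _)
        · simpa using hV.preimage s.continuous
        · simpa using hU.preimage s.continuous)
    (by intro y _
        rcases h y with h | h
        · exact Set.mem_iUnion.2 ⟨true, by simpa using h⟩
        · exact Set.mem_iUnion.2 ⟨false, by simpa using h⟩)
  obtain ⟨r₀, hr₀⟩ := exists_pow_lt_of_lt_one hδ (by norm_num : (1 / 3 : ℝ) < 1)
  refine ⟨r₀, fun r hr => ?_⟩
  refine lipC_le LinearMap.id _ (fun f hf => ?_) _ (Sd_iter_lip k s r)
  obtain ⟨b, hb⟩ := hb (f 0) trivial
  have hf' : ∀ y, f y ∈ Metric.ball (f 0) δ := by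
    intro y
    rw [Metric.mem_ball]
    have h1 := hf.dist_le_mul y 0
    have h2 : dist y 0 ≤ 1 := by
      rw [dist_pi_le_iff zero_le_one]
      intro j
      rw [Subtype.dist_eq, Real.dist_eq, abs_le]
      have := (y j).2.1; have := (y j).2.2
      constructor <;> simp <;> linarith
    have h3 : ((((1 : NNReal) / 3) ^ r : NNReal) : ℝ) = (1 / 3) ^ r := by simp
    rw [h3] at h1
    have h4 : (1 / 3 : ℝ) ^ r ≤ (1 / 3) ^ r₀ := pow_le_pow_of_le_one (by norm_num) (by norm_num) hr
    have h5 : (0 : ℝ) ≤ (1 / 3) ^ r := by positivity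
    nlinarith
  cases b
  · refine Submodule.mem_sup_right (one_mem fun y => ?_)
    simpa using hb (hf' y)
  · refine Submodule.mem_sup_left (one_mem fun y => ?_)
    simpa using hb (hf' y)

end Cubes


/-! ### Normalized chains -/

section Normalized

variable {X Y : Type} [TopologicalSpace X] [TopologicalSpace Y]

def IsDeg {k : ℕ} (s : Cube k X) : Prop := ∃ (j : ℕ) (r : Cube j X) (h : k = j + 1),
  s = cast (by rw [h]) (dgn r)

theorem isDeg_zero (s : Cube 0 X) : ¬ IsDeg s := by
  rintro ⟨j, r, h, _⟩; omega

theorem isDeg_succ {k : ℕ} (s : Cube (k + 1) X) : IsDeg s ↔ ∃ r, s = dgn r := by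
  constructor
  · rintro ⟨j, r, h, e⟩
    obtain rfl : k = j := by omega
    exact ⟨r, e⟩
  · rintro ⟨r, e⟩
    exact ⟨k, r, rfl, e⟩

theorem face_dgn {k : ℕ} (e : II) (r : Cube k X) : face 0 e (dgn r) = r := by
  ext y
  change r _ = r _
  congr 1

theorem isDeg_iff {k : ℕ} (s : Cube (k + 1) X) : IsDeg s ↔ s = dgn (face 0 0 s) := by
  rw [isDeg_succ]
  constructor
  · rintro ⟨r, rfl⟩; rw [face_dgn]
  · intro h; exact ⟨_, h⟩

abbrev NC (X : Type) [TopologicalSpace X] : Type := {c : Σ k, Cube k X // ¬ IsDeg c.2}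

abbrev NN (X : Type) [TopologicalSpace X] : Type := NC X →₀ K2

open Classical in
noncomputable def sN {k : ℕ} (s : Cube k X) : NN X :=
  if h : IsDeg s then 0 else Finsupp.single ⟨⟨k, s⟩, h⟩ 1

theorem sN_deg {k : ℕ} {s : Cube k X} (h : IsDeg s) : sN s = 0 := by simp [sN, h]
theorem sN_nondeg {k : ℕ} {s : Cube k X} (h : ¬ IsDeg s) :
    sN s = Finsupp.single ⟨⟨k, s⟩, h⟩ 1 := by simp [sN, h]

noncomputable def qq (k : ℕ) : Ch k X →ₗ[K2] NN X := lin sN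

@[simp] theorem qq_one {k : ℕ} (s : Cube k X) : qq k (one s) = sN s := lin_one _ _

theorem qq_deg {k : ℕ} (x : Ch k X) : qq (k + 1) (unc (push constM x)) = 0 := by
  have : (qq (k + 1) ∘ₗ unc ∘ₗ push constM : Ch k X →ₗ[K2] _) = 0 :=
    ch_ext (by
      intro s
      simp only [LinearMap.comp_apply, push_one, unc_one, qq_one, LinearMap.zero_apply]
      exact sN_deg ((isDeg_succ _).2 ⟨s, rfl⟩))
  exact LinearMap.congr_fun this x

section lift
variable {M : Type} [AddCommGroup M] [Module K2 M]

/-- Linear maps out of normalized chains. -/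
noncomputable def liftN (f : ∀ k, Ch k X →ₗ[K2] M) : NN X →ₗ[K2] M :=
  Finsupp.linearCombination K2 fun c => f c.1.1 (one c.1.2)

theorem liftN_qq (f : ∀ k, Ch k X →ₗ[K2] M)
    (hf : ∀ (k : ℕ) (x : Ch k X), f (k + 1) (unc (push constM x)) = 0) (k : ℕ) (x : Ch k X) :
    liftN f (qq k x) = f k x := by
  have : (liftN f ∘ₗ qq k : Ch k X →ₗ[K2] _) = f k :=
    ch_ext (by
      intro s
      simp only [LinearMap.comp_apply, qq_one]
      by_cases h : IsDeg s
      · rw [sN_deg h, map_zero]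
        cases k with
        | zero => exact absurd h (isDeg_zero s)
        | succ k =>
          obtain ⟨r, rfl⟩ := (isDeg_succ s).1 h
          have := hf k (one r)
          rw [push_one, unc_one] at this
          exact this.symm
      · rw [sN_nondeg h, liftN]
        simp)
  exact LinearMap.congr_fun this x

theorem nn_ext {f g : NN X →ₗ[K2] M} (h : ∀ k x, f (qq k x) = g (qq k x)) : f = g := by
  apply Finsupp.lhom_ext'
  intro c
  apply LinearMap.ext_ring
  have := h c.1.1 (one c.1.2)
  rw [qq_one, sN_nondeg c.2] at this
  exact this

end lift

noncomputable def dfam : ∀ k, Ch k X →ₗ[K2] NN X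
  | 0 => 0
  | k + 1 => qq k ∘ₗ bd k

theorem dfam_deg : ∀ (k : ℕ) (x : Ch k X), dfam (k + 1) (unc (push constM x)) = 0
  | 0, x => by
    change qq 0 (bd 0 _) = 0
    rw [bd_zero_unc, push_push, push_push]
    have : (evM 0).comp (constM (X := X)) = (evM 1).comp constM := rfl
    rw [this, k2_add_self, map_zero]
  | k + 1, x => by
    change qq (k + 1) (bd (k + 1) _) = 0
    rw [bd_succ_unc, push_push, push_push]
    have : (evM 0).comp (constM (X := X)) = (evM 1).comp constM := rfl
    rw [this, k2_add_self, zero_add, bd_push, qq_deg]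

noncomputable def dN : NN X →ₗ[K2] NN X := liftN dfam

theorem dN_zero (x : Ch 0 X) : dN (qq 0 x) = 0 := by
  rw [dN, liftN_qq _ dfam_deg]; rfl
theorem dN_succ (k : ℕ) (x : Ch (k + 1) X) : dN (qq (k + 1) x) = qq k (bd k x) := by
  rw [dN, liftN_qq _ dfam_deg]; rfl

theorem dN_dN (x : NN X) : dN (dN x) = 0 := by
  have : (dN ∘ₗ dN : NN X →ₗ[K2] NN X) = 0 := nn_ext (by
    intro k x
    simp only [LinearMap.comp_apply, LinearMap.zero_apply]
    match k, x with
    | 0, x => rw [dN_zero, map_zero]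
    | 1, x => rw [dN_succ, dN_zero]
    | k + 2, x => rw [dN_succ, dN_succ, bd_bd, map_zero])
  exact LinearMap.congr_fun this x

noncomputable def SdN : NN X →ₗ[K2] NN X := liftN fun k => qq k ∘ₗ Sd k X

theorem SdN_qq (k : ℕ) (x : Ch k X) : SdN (qq k x) = qq k (Sd k X x) := by
  rw [SdN, liftN_qq]
  · rfl
  · intro k x
    rw [LinearMap.comp_apply, Sd_unc, ES_const, Sd_push, qq_deg]

theorem push_tau_const {k : ℕ} (x : Ch k X) :
    push tauM (push constM x) = push constM (push constM x) := by
  rw [push_push, push_push]; rfl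

noncomputable def DhN : NN X →ₗ[K2] NN X := liftN fun k => qq (k + 1) ∘ₗ Dh k X

theorem DhN_qq (k : ℕ) (x : Ch k X) : DhN (qq k x) = qq (k + 1) (Dh k X x) := by
  rw [DhN, liftN_qq]
  · rfl
  · intro k x
    rw [LinearMap.comp_apply, Dh_unc, ES_const, Dh_push, map_add, qq_deg, push_tau_const]
    have : unc (push constM (push (constM (X := X)) x)) = push constM (unc (push constM x)) := by
      rw [push_unc, push_push, push_push]; rfl
    rw [this, qq_deg, add_zero]

theorem dN_SdN (x : NN X) : dN (SdN x) = SdN (dN x) := by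
  have : (dN ∘ₗ SdN : NN X →ₗ[K2] NN X) = SdN ∘ₗ dN := nn_ext (by
    intro k x
    simp only [LinearMap.comp_apply]
    match k, x with
    | 0, x => rw [SdN_qq, dN_zero, dN_zero, map_zero]
    | k + 1, x => rw [SdN_qq, dN_succ, dN_succ, SdN_qq, bd_Sd])
  exact LinearMap.congr_fun this x

theorem dN_DhN (x : NN X) : x + SdN x = dN (DhN x) + DhN (dN x) := by
  have : (LinearMap.id + SdN : NN X →ₗ[K2] NN X) = dN ∘ₗ DhN + DhN ∘ₗ dN := nn_ext (by
    intro k x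
    simp only [LinearMap.comp_apply, LinearMap.add_apply, LinearMap.id_apply]
    match k, x with
    | 0, x =>
      rw [SdN_qq, DhN_qq, dN_succ, dN_zero, map_zero, add_zero, bd_Dh_zero, map_add]
    | k + 1, x =>
      rw [SdN_qq, DhN_qq, dN_succ, dN_succ, DhN_qq, ← map_add, ← map_add, bd_Dh])
  exact LinearMap.congr_fun this x

/-! Chains in subsets -/

noncomputable def Nin (k : ℕ) (A : Set X) : Submodule K2 (NN X) :=
  Finsupp.supported K2 K2 {c : NC X | c.1.1 = k ∧ ∀ y, c.1.2 y ∈ A}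

theorem sN_mem {k : ℕ} {A : Set X} {s : Cube k X} (h : ∀ y, s y ∈ A) : sN s ∈ Nin k A := by
  by_cases hs : IsDeg s
  · rw [sN_deg hs]; exact zero_mem _
  · rw [sN_nondeg hs]; exact Finsupp.single_mem_supported _ _ ⟨rfl, h⟩

theorem qq_mem {k : ℕ} {A : Set X} : ∀ x ∈ ChIn k A, qq k x ∈ Nin k A :=
  chIn_le _ _ fun s hs => by rw [qq_one]; exact sN_mem hs

theorem nin_le {k : ℕ} {A : Set X} {M : Type} [AddCommGroup M] [Module K2 M] (f : NN X →ₗ[K2] M)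
    (S : Submodule K2 M) (h : ∀ s : Cube k X, (∀ y, s y ∈ A) → f (sN s) ∈ S) :
    ∀ x ∈ Nin k A, f x ∈ S := by
  have : Nin k A ≤ S.comap f := by
    rw [Nin, Finsupp.supported_eq_span_single, Submodule.span_le]
    rintro _ ⟨⟨⟨j, s⟩, hn⟩, ⟨hj, hs⟩, rfl⟩
    simp only at hj hs hn
    subst hj
    have := h s hs
    rw [sN_nondeg hn] at this
    exact this
  exact this

theorem nin_eq_map {k : ℕ} {A : Set X} : ∀ x ∈ Nin k A, ∃ c ∈ ChIn k A, qq k c = x := by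
  have := nin_le (A := A) (k := k) LinearMap.id ((ChIn k A).map (qq k)) (fun s hs =>
    ⟨one s, one_mem hs, by simp⟩)
  intro x hx
  obtain ⟨c, hc, e⟩ := this x hx
  exact ⟨c, hc, e⟩

theorem nin_inter {k : ℕ} (A B : Set X) : Nin k A ⊓ Nin k B = Nin k (A ∩ B) := by
  rw [Nin, Nin, Nin, ← Finsupp.supported_inter]
  congr 1
  ext c
  simp only [Set.mem_inter_iff, Set.mem_ofPred_eq]
  constructor
  · rintro ⟨⟨h1, h2⟩, _, h3⟩; exact ⟨h1, fun y => ⟨h2 y, h3 y⟩⟩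
  · rintro ⟨h1, h2⟩; exact ⟨⟨h1, fun y => (h2 y).1⟩, h1, fun y => (h2 y).2⟩

theorem nin_mono {k : ℕ} {A B : Set X} (h : A ⊆ B) : Nin k A ≤ Nin k B :=
  Finsupp.supported_mono fun _ hc => ⟨hc.1, fun y => h (hc.2 y)⟩

theorem dN_mem {k : ℕ} {A : Set X} : ∀ x ∈ Nin (k + 1) A, dN x ∈ Nin k A := by
  intro x hx
  obtain ⟨c, hc, rfl⟩ := nin_eq_map x hx
  rw [dN_succ]
  exact qq_mem _ (bd_mem _ hc)

theorem DhN_mem {k : ℕ} {A : Set X} : ∀ x ∈ Nin k A, DhN x ∈ Nin (k + 1) A := by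
  intro x hx
  obtain ⟨c, hc, rfl⟩ := nin_eq_map x hx
  rw [DhN_qq]
  exact qq_mem _ (Dh_mem _ _ hc)

theorem SdN_mem {k : ℕ} {A : Set X} : ∀ x ∈ Nin k A, SdN x ∈ Nin k A := by
  intro x hx
  obtain ⟨c, hc, rfl⟩ := nin_eq_map x hx
  rw [SdN_qq]
  exact qq_mem _ (Sd_mem _ _ hc)

/-- The complex of normalized cubical chains in `A`. -/
noncomputable def cx (A : Set X) : SubCx (dN (X := X)) where
  car k := Nin k A
  step k := dN_mem
  zero x hx := by
    obtain ⟨c, hc, rfl⟩ := nin_eq_map x hx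
    exact dN_zero c
  sq := dN_dN

theorem cx_le {A B : Set X} (h : A ⊆ B) : (cx A).le (cx B) := fun _ => nin_mono h

theorem cx_inf (A B : Set X) : (cx A).inf (cx B) = cx (A ∩ B) := by
  simp only [SubCx.inf, cx, nin_inter]

/-! Small chains -/

theorem exists_TN (r : ℕ) : ∃ T : NN X →ₗ[K2] NN X,
    (∀ k (A : Set X), ∀ x ∈ Nin k A, T x ∈ Nin (k + 1) A) ∧
    (∀ x, x + (SdN ^ r) x = dN (T x) + T (dN x)) := by
  have hS : ∀ r k (A : Set X), ∀ x ∈ Nin k A, ((SdN (X := X)) ^ r) x ∈ Nin k A := by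
    intro r
    induction r with
    | zero => intro k A x hx; simpa using hx
    | succ r ih =>
      intro k A x hx
      rw [pow_succ', Module.End.mul_apply]
      exact SdN_mem _ (ih _ _ _ hx)
  have hd : ∀ r x, dN (((SdN (X := X)) ^ r) x) = (SdN ^ r) (dN x) := by
    intro r
    induction r with
    | zero => intro x; simp
    | succ r ih =>
      intro x
      rw [pow_succ', Module.End.mul_apply, Module.End.mul_apply, dN_SdN, ih]
  induction r with
  | zero => exact ⟨0, fun k A x _ => by simp, fun x => by simp [k2_add_self]⟩
  | succ r ih =>
    obtain ⟨T, hT, hT'⟩ := ih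
    refine ⟨T + DhN ∘ₗ (SdN ^ r), fun k A x hx => add_mem (hT k A x hx)
      (DhN_mem _ (hS _ _ _ _ hx)), fun x => ?_⟩
    have h1 := hT' x
    have h2 := dN_DhN ((SdN ^ r) x)
    rw [hd] at h2
    simp only [LinearMap.add_apply, LinearMap.comp_apply, map_add, pow_succ',
      Module.End.mul_apply]
    calc _ = (x + (SdN ^ r) x) + ((SdN ^ r) x + SdN ((SdN ^ r) x)) := by
            rw [add_assoc, k2_add_cancel]
      _ = _ := by rw [h1, h2]; abel

theorem exists_small {k : ℕ} {U V : Set X} (hU : IsOpen U) (hV : IsOpen V) (x : NN X)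
    (hx : x ∈ Nin k (U ∪ V)) : ∃ r, (SdN ^ r) x ∈ Nin k U ⊔ Nin k V := by
  obtain ⟨c, hc, rfl⟩ := nin_eq_map x hx
  have hq : ∀ r c, ((SdN (X := X)) ^ r) (qq k c) = qq k (((Sd k X) ^ r) c) := by
    intro r
    induction r with
    | zero => intro x; simp
    | succ r ih =>
      intro x
      rw [pow_succ', Module.End.mul_apply, pow_succ', Module.End.mul_apply, ih, SdN_qq]
  have h1 : ∃ r₀, ∀ r ≥ r₀, ((Sd k X) ^ r) c ∈ ChIn k U ⊔ ChIn k V := by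
    rw [ChIn, Finsupp.supported_eq_span_single] at hc
    clear hx
    induction hc using Submodule.span_induction with
    | mem x h =>
      obtain ⟨s, hs, rfl⟩ := h
      exact Sd_small k s hU hV hs
    | zero => exact ⟨0, fun r _ => by simp⟩
    | add x y _ _ hx hy =>
      obtain ⟨r1, h1⟩ := hx
      obtain ⟨r2, h2⟩ := hy
      refine ⟨max r1 r2, fun r hr => ?_⟩
      rw [map_add]
      exact add_mem (h1 r (le_of_max_le_left hr)) (h2 r (le_of_max_le_right hr))
    | smul a x _ hx =>
      obtain ⟨r1, h1⟩ := hx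
      refine ⟨r1, fun r hr => ?_⟩
      rw [map_smul]
      exact Submodule.smul_mem _ _ (h1 r hr)
  obtain ⟨r, hr⟩ := h1
  refine ⟨r, ?_⟩
  rw [hq]
  obtain ⟨a, ha, b, hb, e⟩ := Submodule.mem_sup.1 (hr r le_rfl)
  rw [← e, map_add]
  exact Submodule.add_mem_sup (qq_mem _ ha) (qq_mem _ hb)

theorem cx_sup_le (U V : Set X) : ((cx U).sup (cx V)).le (cx (U ∪ V)) := fun _ =>
  sup_le (nin_mono Set.subset_union_left) (nin_mono Set.subset_union_right)

theorem cx_sup_bij {U V : Set X} (hU : IsOpen U) (hV : IsOpen V) (k : ℕ) :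
    Function.Bijective (SubCx.inc (cx_sup_le U V) k) := by
  have hT2 : ∀ (T : NN X →ₗ[K2] NN X)
    (_ : ∀ k (A : Set X), ∀ x ∈ Nin k A, T x ∈ Nin (k + 1) A) (k : ℕ),
    ∀ x ∈ Nin k U ⊔ Nin k V, T x ∈ Nin (k + 1) U ⊔ Nin (k + 1) V := by
    intro T hT k x hx
    obtain ⟨a, ha, b, hb, rfl⟩ := Submodule.mem_sup.1 hx
    rw [map_add]
    exact Submodule.add_mem_sup (hT _ _ _ ha) (hT _ _ _ hb)
  have hd : ∀ r x, dN (((SdN (X := X)) ^ r) x) = (SdN ^ r) (dN x) := by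
    intro r
    induction r with
    | zero => intro x; simp
    | succ r ih =>
      intro x
      rw [pow_succ', Module.End.mul_apply, Module.End.mul_apply, dN_SdN, ih]
  apply SubCx.inc_bij
  · intro z hz
    rw [SubCx.mem_Z] at hz
    obtain ⟨r, hr⟩ := exists_small hU hV z hz.1
    obtain ⟨T, hT, hT'⟩ := exists_TN (X := X) r
    refine ⟨(SdN ^ r) z, SubCx.mem_Z.2 ⟨hr, ?_⟩, T z, hT _ _ _ hz.1, ?_⟩
    · rw [hd, hz.2, map_zero]
    · rw [hT', hz.2, map_zero, add_zero]
  · intro z hz y hy e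
    rw [SubCx.mem_Z] at hz
    obtain ⟨r, hr⟩ := exists_small hU hV y hy
    obtain ⟨T, hT, hT'⟩ := exists_TN (X := X) r
    refine ⟨(SdN ^ r) y + T z, add_mem hr (hT2 T hT _ _ hz.1), ?_⟩
    have h1 := hT' z
    rw [hz.2, map_zero, add_zero] at h1
    rw [map_add, hd, e, ← h1, add_comm z, k2_add_cancel]

/-- Homology groups of subsets -/
abbrev HS (k : ℕ) (A : Set X) : Type := (cx A).H k

noncomputable def alS (U V : Set X) (k : ℕ) : HS k (U ∩ V) →ₗ[K2] HS k U × HS k V :=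
  (SubCx.inc (cx_le Set.inter_subset_left) k).prod (SubCx.inc (cx_le Set.inter_subset_right) k)

theorem alS_al (U V : Set X) (k : ℕ) : Module.finrank K2 (LinearMap.range (alS U V k)) =
    Module.finrank K2 (LinearMap.range ((cx U).al (cx V) k)) := by
  have key : ∀ (G : SubCx (dN (X := X))) (_ : (cx U).inf (cx V) = G) (h1 : G.le (cx U))
      (h2 : G.le (cx V)), Module.finrank K2 (LinearMap.range ((SubCx.inc h1 k).prod
        (SubCx.inc h2 k))) = Module.finrank K2 (LinearMap.range ((cx U).al (cx V) k)) := by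
    rintro G rfl h1 h2
    rfl
  exact key _ (cx_inf U V) _ _

theorem mvS_zero {U V : Set X} (hU : IsOpen U) (hV : IsOpen V) [FiniteDimensional K2 (HS 0 U)]
    [FiniteDimensional K2 (HS 0 V)] : FiniteDimensional K2 (HS 0 (U ∪ V)) ∧
    Module.finrank K2 (HS 0 (U ∪ V)) + Module.finrank K2 (LinearMap.range (alS U V 0)) =
      Module.finrank K2 (HS 0 U) + Module.finrank K2 (HS 0 V) := by
  obtain ⟨h1, h2⟩ := SubCx.mv_zero (cx U) (cx V)
  let e := LinearEquiv.ofBijective _ (cx_sup_bij hU hV 0)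
  refine ⟨e.finiteDimensional, ?_⟩
  rw [alS_al, ← e.finrank_eq]
  exact h2

theorem mvS_succ {U V : Set X} (hU : IsOpen U) (hV : IsOpen V) (k : ℕ)
    [FiniteDimensional K2 (HS (k + 1) U)]
    [FiniteDimensional K2 (HS (k + 1) V)] [FiniteDimensional K2 (HS k (U ∩ V))] :
    FiniteDimensional K2 (HS (k + 1) (U ∪ V)) ∧
    Module.finrank K2 (HS (k + 1) (U ∪ V)) + Module.finrank K2 (LinearMap.range (alS U V (k + 1)))
      + Module.finrank K2 (LinearMap.range (alS U V k)) =
      Module.finrank K2 (HS (k + 1) U) + Module.finrank K2 (HS (k + 1) V) +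
        Module.finrank K2 (HS k (U ∩ V)) := by
  have key : ∀ (G : SubCx (dN (X := X))) (_ : (cx U).inf (cx V) = G),
    FiniteDimensional K2 (G.H k) → FiniteDimensional K2 (((cx U).inf (cx V)).H k) ∧
      Module.finrank K2 (G.H k) = Module.finrank K2 (((cx U).inf (cx V)).H k) := by
    rintro G rfl h
    exact ⟨h, rfl⟩
  obtain ⟨h3, h4⟩ := key _ (cx_inf U V) inferInstance
  obtain ⟨h1, h2⟩ := SubCx.mv_succ (cx U) (cx V) k
  let e := LinearEquiv.ofBijective _ (cx_sup_bij hU hV (k + 1))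
  refine ⟨e.finiteDimensional, ?_⟩
  rw [alS_al, alS_al, ← e.finrank_eq, h4]
  exact h2

/-! Embeddings -/

noncomputable def pushN (g : C(X, Y)) : NN X →ₗ[K2] NN Y := liftN fun k => qq k ∘ₗ push g

theorem pushN_qq (g : C(X, Y)) (k : ℕ) (x : Ch k X) : pushN g (qq k x) = qq k (push g x) := by
  rw [pushN, liftN_qq]
  · rfl
  · intro k x
    rw [LinearMap.comp_apply, push_unc, push_push]
    have : (postM g).comp (constM (X := X)) = constM.comp g := rfl
    rw [this, ← push_push, qq_deg]

theorem pushN_sN (g : C(X, Y)) {k : ℕ} (s : Cube k X) : pushN g (sN s) = sN (g.comp s) := by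
  rw [← qq_one, pushN_qq, push_one, qq_one]

theorem dN_pushN (g : C(X, Y)) (x : NN X) : dN (pushN g x) = pushN g (dN x) := by
  have : (dN ∘ₗ pushN g : NN X →ₗ[K2] NN Y) = pushN g ∘ₗ dN := nn_ext (by
    intro k x
    simp only [LinearMap.comp_apply]
    match k, x with
    | 0, x => rw [pushN_qq, dN_zero, dN_zero, map_zero]
    | k + 1, x => rw [pushN_qq, dN_succ, dN_succ, pushN_qq, bd_push])
  exact LinearMap.congr_fun this x

open Classical in
theorem pushN_inj (g : C(X, Y)) (hg : Function.Injective g) : Function.Injective (pushN g) := by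
  let f : ∀ k, Ch k Y →ₗ[K2] NN X := fun k => lin fun t =>
    if h : ∃ s : Cube k X, t = g.comp s then sN h.choose else 0
  have hgc : ∀ {k : ℕ} {s s' : Cube k X}, g.comp s = g.comp s' → s = s' := by
    intro k s s' h
    ext y
    exact hg (DFunLike.congr_fun h y)
  have hf : ∀ k (s : Cube k X), f k (one (g.comp s)) = sN s := by
    intro k s
    have h : ∃ s' : Cube k X, g.comp s = g.comp s' := ⟨s, rfl⟩
    simp only [f, lin_one]
    rw [dif_pos h, ← hgc h.choose_spec]
  have hdeg : ∀ (k : ℕ) (x : Ch k Y), f (k + 1) (unc (push constM x)) = 0 := by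
    intro k x
    have : (f (k + 1) ∘ₗ unc ∘ₗ push constM : Ch k Y →ₗ[K2] _) = 0 := ch_ext (by
      intro r
      simp only [LinearMap.comp_apply, push_one, unc_one, LinearMap.zero_apply]
      by_cases h : ∃ s : Cube (k + 1) X, uncC (constM.comp r) = g.comp s
      · obtain ⟨s, hs⟩ := h
        rw [hs, hf]
        apply sN_deg
        rw [isDeg_iff]
        apply hgc
        rw [← hs]
        have h2 : g.comp (dgn (face 0 0 s)) = dgn (face 0 0 (g.comp s)) := rfl
        rw [h2, ← hs, ← dgn_eq, face_dgn]
      · simp only [f, lin_one]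
        rw [dif_neg h])
    exact LinearMap.congr_fun this x
  have : (liftN f ∘ₗ pushN g : NN X →ₗ[K2] NN X) = LinearMap.id := nn_ext (by
    intro k x
    rw [LinearMap.comp_apply, pushN_qq, liftN_qq _ hdeg, LinearMap.id_apply]
    have : (f k ∘ₗ push g : Ch k X →ₗ[K2] NN X) = qq k := ch_ext (by
      intro s
      rw [LinearMap.comp_apply, push_one, hf, qq_one])
    exact LinearMap.congr_fun this x)
  intro a b hab
  have ha := LinearMap.congr_fun this a
  have hb := LinearMap.congr_fun this b
  rw [LinearMap.comp_apply, hab] at ha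
  rw [LinearMap.comp_apply] at hb
  simpa using ha.symm.trans hb

theorem embed_equiv (g : C(X, Y)) (hg : Topology.IsEmbedding g) (k : ℕ) :
    Nonempty (HS k (Set.univ : Set X) ≃ₗ[K2] HS k (Set.range g)) := by
  have hcar : ∀ k, ∀ x ∈ Nin k (Set.univ : Set X), pushN g x ∈ Nin k (Set.range g) :=
    fun k => nin_le _ _ fun s _ => by
      rw [pushN_sN]; exact sN_mem fun y => ⟨_, rfl⟩
  have hsur : ∀ k, ∀ x ∈ Nin k (Set.range g), ∃ w ∈ Nin k (Set.univ : Set X), pushN g w = x := by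
    intro k x hx
    have := nin_le (A := Set.range g) (k := k) LinearMap.id
      ((Nin k (Set.univ : Set X)).map (pushN g)) (fun t ht => by
        choose f hf using ht
        have hc : Continuous f := by
          rw [hg.continuous_iff]
          convert t.continuous
          exact funext hf
        refine ⟨sN ⟨f, hc⟩, sN_mem fun _ => trivial, ?_⟩
        rw [pushN_sN]
        congr 1
        ext y
        exact hf y)
    exact this x hx
  have hZ : ∀ x ∈ (cx (Set.univ : Set X)).Z k, pushN g x ∈ (cx (Set.range g)).Z k := by
    intro x hx
    rw [SubCx.mem_Z] at hx ⊢
    exact ⟨hcar k x hx.1, by rw [dN_pushN, hx.2, map_zero]⟩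
  let F : HS k (Set.univ : Set X) →ₗ[K2] HS k (Set.range g) :=
    Submodule.mapQ _ _ ((pushN g).restrict hZ) (by
      intro x hx
      simp only [Submodule.mem_comap, Submodule.subtype_apply, SubCx.mem_B] at hx ⊢
      obtain ⟨y, hy, e⟩ := hx
      exact ⟨pushN g y, hcar _ _ hy, by rw [dN_pushN, e]; rfl⟩)
  have hF : ∀ z, F ((cx Set.univ).cls k z) = (cx (Set.range g)).cls k ⟨pushN g z, hZ z z.2⟩ :=
    fun z => rfl
  refine ⟨LinearEquiv.ofBijective F ⟨?_, ?_⟩⟩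
  · rw [← LinearMap.ker_eq_bot, LinearMap.ker_eq_bot']
    intro x hx
    obtain ⟨z, rfl⟩ := SubCx.cls_surj _ k x
    rw [hF, SubCx.cls_eq_zero] at hx
    obtain ⟨y, hy, e⟩ := hx
    obtain ⟨w, hw, rfl⟩ := hsur _ _ hy
    rw [SubCx.cls_eq_zero]
    refine ⟨w, hw, pushN_inj g hg.injective ?_⟩
    rw [← dN_pushN, e]
  · intro x
    obtain ⟨z, rfl⟩ := SubCx.cls_surj _ k x
    have hz := SubCx.mem_Z.1 z.2
    obtain ⟨w, hw, e⟩ := hsur _ _ hz.1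
    refine ⟨(cx Set.univ).cls k ⟨w, SubCx.mem_Z.2 ⟨hw, pushN_inj g hg.injective ?_⟩⟩, ?_⟩
    · rw [← dN_pushN, e, hz.2, map_zero]
    · rw [hF]
      congr 1
      exact Subtype.ext e

/-! Empty set and points -/

theorem nin_empty (k : ℕ) : Nin k (∅ : Set X) = ⊥ := by
  rw [eq_bot_iff]
  exact nin_le LinearMap.id ⊥ fun s hs => absurd (hs 0) (by simp)

theorem nin_point (k : ℕ) (b : X) : Nin (k + 1) ({b} : Set X) = ⊥ := by
  rw [eq_bot_iff]
  refine nin_le LinearMap.id ⊥ fun s hs => ?_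
  have : IsDeg s := by
    rw [isDeg_succ]
    refine ⟨ContinuousMap.const _ b, ?_⟩
    ext y
    exact hs y
  rw [sN_deg this]; simp

theorem H_of_bot (A : Set X) (k : ℕ) (h : Nin k A = ⊥) : Subsingleton (HS k A) := by
  refine ⟨fun a b => ?_⟩
  obtain ⟨z, rfl⟩ := SubCx.cls_surj _ k a
  obtain ⟨w, rfl⟩ := SubCx.cls_surj _ k b
  congr 1
  ext1
  have h1 : (z : NN X) ∈ Nin k A := (SubCx.mem_Z.1 z.2).1
  have h2 : (w : NN X) ∈ Nin k A := (SubCx.mem_Z.1 w.2).1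
  rw [h] at h1 h2
  rw [(Submodule.mem_bot _).1 h1, (Submodule.mem_bot _).1 h2]

theorem H_empty (k : ℕ) : Subsingleton (HS k (∅ : Set X)) := H_of_bot _ _ (nin_empty k)

theorem H_point_succ (k : ℕ) (b : X) : Subsingleton (HS (k + 1) ({b} : Set X)) :=
  H_of_bot _ _ (nin_point k b)

theorem H_point_zero (b : X) : Module.finrank K2 (HS 0 ({b} : Set X)) = 1 := by
  let s : Cube 0 X := ContinuousMap.const _ b
  have hs : sN s ∈ (cx ({b} : Set X)).Z 0 :=
    SubCx.mem_Z.2 ⟨sN_mem fun y => rfl, (cx ({b} : Set X)).zero _ (sN_mem fun y => rfl)⟩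
  rw [finrank_eq_one_iff']
  refine ⟨(cx ({b} : Set X)).cls 0 ⟨sN s, hs⟩, ?_, ?_⟩
  · intro h
    rw [SubCx.cls_eq_zero] at h
    obtain ⟨y, hy, e⟩ := h
    change y ∈ Nin 1 {b} at hy
    rw [nin_point, Submodule.mem_bot] at hy
    rw [hy, map_zero] at e
    change 0 = sN s at e
    rw [sN_nondeg (isDeg_zero s)] at e
    exact one_ne_zero (Finsupp.single_eq_zero.1 e.symm)
  · intro w
    obtain ⟨z, rfl⟩ := SubCx.cls_surj _ 0 w
    have h1 : (z : NN X) ∈ Nin 0 {b} := (SubCx.mem_Z.1 z.2).1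
    have h2 : ∀ x ∈ Nin 0 ({b} : Set X), x ∈ Submodule.span K2 {sN s} :=
      nin_le LinearMap.id _ fun t ht => by
        have : t = s := by ext y; exact ht y
        rw [this]
        exact Submodule.mem_span_singleton_self _
    obtain ⟨c, hc⟩ := Submodule.mem_span_singleton.1 (h2 _ h1)
    refine ⟨c, ?_⟩
    rw [← map_smul]
    congr 1
    exact Subtype.ext hc

end Normalized

/-! ### Relative lifting -/

section Lifting

variable {E B : Type} [TopologicalSpace E] [TopologicalSpace B]

def JJ (k : ℕ) : Set ((Fin k → II) × II) := {z | z.2 = 0 ∨ ∃ i, z.1 i = 0 ∨ z.1 i = 1}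

section Retract

variable {k : ℕ}

noncomputable def rM (z : (Fin k → II) × II) : ℝ :=
  max ‖fun i => 2 * (z.1 i : ℝ) - 1‖ ((2 - (z.2 : ℝ)) / 2)

theorem abs_coord_le (x : II) : |2 * (x : ℝ) - 1| ≤ 1 := by
  have h1 := x.2.1; have h2 := x.2.2
  rw [abs_le]; constructor <;> linarith

theorem rM_pos (z : (Fin k → II) × II) : 1 / 2 ≤ rM z := by
  have := z.2.2.2
  exact le_max_of_le_right (by linarith)

theorem rM_le (z : (Fin k → II) × II) : rM z ≤ 1 := by
  have := z.2.2.1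
  refine max_le ((pi_norm_le_iff_of_nonneg zero_le_one).2 fun i => abs_coord_le _) (by linarith)

theorem continuous_rM : Continuous (rM (k := k)) := by
  unfold rM; fun_prop

noncomputable def lamM (z : (Fin k → II) × II) : ℝ := (rM z)⁻¹

theorem continuous_lamM : Continuous (lamM (k := k)) :=
  continuous_rM.inv₀ fun z => by have := rM_pos z; linarith

theorem lamM_ge (z : (Fin k → II) × II) : 1 ≤ lamM z :=
  (one_le_inv₀ (by have := rM_pos z; linarith)).2 (rM_le z)

theorem lamM_le (z : (Fin k → II) × II) : lamM z ≤ 2 := by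
  rw [lamM, inv_le_comm₀ (by have := rM_pos z; linarith) (by norm_num)]
  have := rM_pos z; linarith

noncomputable def clampI (x : ℝ) : II := Set.projIcc 0 1 zero_le_one x

theorem continuous_clampI : Continuous clampI := continuous_projIcc (h := zero_le_one)

theorem clampI_coe (x : II) : clampI x = x := Set.projIcc_val _ _

noncomputable def uM (z : (Fin k → II) × II) : II := clampI (lamM z - 1)

theorem uM_coe (z : (Fin k → II) × II) : (uM z : ℝ) = lamM z - 1 := by
  have h1 := lamM_ge z; have h2 := lamM_le z
  have := clampI_coe ⟨lamM z - 1, by constructor <;> linarith⟩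
  exact congrArg Subtype.val this

noncomputable def RM (w : ((Fin k → II) × II) × II) : (Fin k → II) × II :=
  (fun i => clampI ((max (lamM w.1 - w.2) 1 * (2 * (w.1.1 i : ℝ) - 1) + 1) / 2),
    clampI (2 - max (lamM w.1 - w.2) 1 * (2 - (w.1.2 : ℝ))))

theorem continuous_RM : Continuous (RM (k := k)) := by
  have h := continuous_lamM (k := k)
  have h' := continuous_clampI
  unfold RM
  fun_prop

theorem continuous_uM : Continuous (uM (k := k)) := by
  have h := continuous_lamM (k := k)
  have h' := continuous_clampI
  unfold uM
  fun_prop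

theorem RM_uM (z : (Fin k → II) × II) : RM (z, uM z) = z := by
  have h : max (lamM z - uM z) 1 = 1 := by rw [uM_coe]; simp
  unfold RM
  simp only [h]
  refine Prod.ext ?_ ?_
  · funext i
    simp only
    rw [show ((1 * (2 * (z.1 i : ℝ) - 1) + 1) / 2) = (z.1 i : ℝ) by ring, clampI_coe]
  · simp only
    rw [show (2 - 1 * (2 - (z.2 : ℝ))) = (z.2 : ℝ) by ring, clampI_coe]

theorem RM_zero_mem (z : (Fin k → II) × II) : RM (z, 0) ∈ JJ k := by
  have h1 := lamM_ge z
  have h : max (lamM z - ((0 : II) : ℝ)) 1 = lamM z := by simp [h1]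
  have hr := rM_pos z
  have hl : lamM z * rM z = 1 := inv_mul_cancel₀ (by linarith)
  rcases le_total ‖fun i => 2 * (z.1 i : ℝ) - 1‖ ((2 - (z.2 : ℝ)) / 2) with hc | hc
  · left
    have : rM z = (2 - (z.2 : ℝ)) / 2 := max_eq_right hc
    rw [this] at hl
    simp only [RM, h]
    rw [show 2 - lamM z * (2 - (z.2 : ℝ)) = ((0 : II) : ℝ) by simp; linarith, clampI_coe]
  · right
    have hm : rM z = ‖fun i => 2 * (z.1 i : ℝ) - 1‖ := max_eq_left hc
    have : ∃ i, rM z ≤ |2 * (z.1 i : ℝ) - 1| := by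
      by_contra hcon
      push Not at hcon
      have := (pi_norm_lt_iff (x := fun i => 2 * (z.1 i : ℝ) - 1) (r := rM z) (by linarith)).2 hcon
      rw [← hm] at this
      exact lt_irrefl _ this
    obtain ⟨i, hi⟩ := this
    have hi2 : |2 * (z.1 i : ℝ) - 1| ≤ rM z := by
      rw [hm]; exact norm_le_pi_norm (fun i => 2 * (z.1 i : ℝ) - 1) i
    have hi3 := le_antisymm hi2 hi
    refine ⟨i, ?_⟩
    simp only [RM, h]
    rcases abs_cases (2 * (z.1 i : ℝ) - 1) with ⟨ha, _⟩ | ⟨ha, _⟩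
    · right
      rw [← ha, hi3, hl]
      rw [show ((1 : ℝ) + 1) / 2 = ((1 : II) : ℝ) by simp, clampI_coe]
    · left
      have : (2 * (z.1 i : ℝ) - 1) = - rM z := by linarith
      rw [this, mul_neg, hl]
      rw [show (-(1 : ℝ) + 1) / 2 = ((0 : II) : ℝ) by simp, clampI_coe]

theorem uM_zero {z : (Fin k → II) × II} (hz : z ∈ JJ k) : uM z = 0 := by
  have : rM z = 1 := by
    refine le_antisymm (rM_le z) ?_
    rcases hz with h | ⟨i, h⟩
    · refine le_max_of_le_right ?_
      rw [h]; simp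
    · refine le_max_of_le_left ?_
      refine le_trans ?_ (norm_le_pi_norm (fun i => 2 * (z.1 i : ℝ) - 1) i)
      rcases h with h | h <;> rw [h] <;> norm_num
  ext
  rw [uM_coe, lamM, this]; simp

end Retract

variable {p : C(E, B)}

theorem rel_hlp (hp : IsSerreFibration p) {k : ℕ} (h : C((Fin k → II) × II, B))
    (g : (Fin k → II) × II → E) (hg : ContinuousOn g (JJ k)) (hgp : ∀ z ∈ JJ k, p (g z) = h z) :
    ∃ H : C((Fin k → II) × II, E), (∀ z, p (H z) = h z) ∧ ∀ z ∈ JJ k, H z = g z := by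
  let dec : C(Fin (k + 1) → II, (Fin k → II) × II) := ⟨fun w => (fun j => w j.succ, w 0), by fun_prop⟩
  let enc : C((Fin k → II) × II, Fin (k + 1) → II) :=
    ⟨fun z => Fin.cons (α := fun _ => II) z.2 z.1, by
      refine continuous_pi fun j => ?_
      refine Fin.cases ?_ (fun j => ?_) j
      · simp only [Fin.cons_zero]; fun_prop
      · simp only [Fin.cons_succ]; fun_prop⟩
  have hde : ∀ z, dec (enc z) = z := fun z => by simp [dec, enc]
  have hR := continuous_RM (k := k)
  let h' : C((Fin (k + 1) → II) × II, B) :=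
    ⟨fun w => h (RM (dec w.1, w.2)), by fun_prop⟩
  let h₀ : C(Fin (k + 1) → II, E) := ⟨fun w => g (RM (dec w, 0)), by
    refine hg.comp_continuous (by fun_prop) fun w => RM_zero_mem _⟩
  obtain ⟨H, H1, H2⟩ := hp (k + 1) h' h₀ (fun y => hgp _ (RM_zero_mem _))
  have hu := continuous_uM (k := k)
  refine ⟨⟨fun z => H (enc z, uM z), by fun_prop⟩, fun z => ?_, fun z hz => ?_⟩
  · change p (H _) = _
    rw [H1]
    change h (RM (dec (enc z), uM z)) = h z
    rw [hde, RM_uM]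
  · change H _ = _
    rw [uM_zero hz, H2]
    change g (RM (dec (enc z), 0)) = g z
    rw [hde, ← uM_zero hz, RM_uM]

theorem glue_closed {ι Z : Type} [Finite ι] [TopologicalSpace Z] (C : ι → Set Z)
    (hC : ∀ a, IsClosed (C a)) (f : ι → Z → E) (hf : ∀ a, ContinuousOn (f a) (C a))
    (hff : ∀ a b, ∀ z, z ∈ C a → z ∈ C b → f a z = f b z) (f₀ : Z → E) :
    ∃ g : Z → E, ContinuousOn g (⋃ a, C a) ∧ ∀ a, ∀ z ∈ C a, g z = f a z := by
  classical
  let g : Z → E := fun z => if h : ∃ a, z ∈ C a then f h.choose z else f₀ z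
  have hg : ∀ a, ∀ z ∈ C a, g z = f a z := by
    intro a z hz
    have h : ∃ a, z ∈ C a := ⟨a, hz⟩
    simp only [g]
    rw [dif_pos h]
    exact hff _ _ _ h.choose_spec hz
  refine ⟨g, ?_, hg⟩
  exact (locallyFinite_of_finite C).continuousOn_iUnion hC fun a => (hf a).congr (hg a)

end Lifting


/-! ### Compatible lifts of cubes and the prism operator -/

section Prism

variable {E B : Type} [TopologicalSpace E] [TopologicalSpace B]

/-- A contraction of the subset `A` onto the point `c`, relative to `c`. -/
structure Contr (A : Set B) (c : B) where
  h : B × II → B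
  cont : ContinuousOn h (A ×ˢ Set.univ)
  mem : ∀ x ∈ A, ∀ t, h (x, t) ∈ A
  h0 : ∀ x ∈ A, h (x, 0) = x
  h1 : ∀ x ∈ A, h (x, 1) = c
  hc : ∀ t, h (c, t) = c
  cA : c ∈ A

def IsEnd (e : II) : Prop := e = 0 ∨ e = 1

/-- cubes lying over `A` -/
def Over (p : C(E, B)) (A : Set B) {k : ℕ} (s : Cube k E) : Prop := ∀ y, p (s y) ∈ A

theorem Over.face {p : C(E, B)} {A : Set B} {k : ℕ} {s : Cube (k + 1) E} (hs : Over p A s)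
    (i : Fin (k + 1)) (e : II) : Over p A (face i e s) := fun _ => hs _

theorem over_dgn {p : C(E, B)} {A : Set B} {k : ℕ} {s : Cube k E} (hs : Over p A (dgn s)) :
    Over p A s := by
  have := hs.face 0 0
  rwa [face_dgn] at this

abbrev LTy (E : Type) [TopologicalSpace E] (k : ℕ) : Type := Cube k E → C((Fin k → II) × II, E)

structure LInv (p : C(E, B)) {A : Set B} {c : B} (K : Contr A c) (k : ℕ) (L : LTy E k) : Prop where
  a : ∀ s, Over p A s → ∀ y, L s (y, 0) = s y
  b : ∀ s, Over p A s → ∀ y t, p (L s (y, t)) = K.h (p (s y), t)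
  g1 : ∀ s : Cube (k + 1) E, Over p A s → ∀ i j e f y y' t, IsEnd e → IsEnd f →
    insMap i e y = insMap j f y' → L (face i e s) (y, t) = L (face j f s) (y', t)
  g2 : ∀ s : Cube k E, Over p A s → ∀ i e y t, IsEnd e →
    L (face i e (dgn s)) (y, t) = L s (tailMap k (insMap i e y), t)

structure LCompat (p : C(E, B)) (A : Set B) {k : ℕ} (L : LTy E k) (L' : LTy E (k + 1)) : Prop where
  c1 : ∀ s : Cube (k + 1) E, Over p A s → ∀ i e y t, IsEnd e →
    L' s (insMap i e y, t) = L (face i e s) (y, t)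
  c2 : ∀ s : Cube k E, Over p A s → ∀ z t, L' (dgn s) (z, t) = L s (tailMap k z, t)

theorem insMap_self {k : ℕ} (i : Fin (k + 1)) (z : Fin (k + 1) → II) :
    insMap i (z i) (fun j => z (i.succAbove j)) = z :=
  Fin.insertNth_self_removeNth i z

theorem insMap_same {k : ℕ} (i : Fin (k + 1)) (e : II) (y : Fin k → II) : insMap i e y i = e := by
  simp [insMap]

theorem insMap_above {k : ℕ} (i : Fin (k + 1)) (e : II) (y : Fin k → II) (j : Fin k) :
    insMap i e y (i.succAbove j) = y j := by
  simp [insMap]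

theorem insMap_comm {k : ℕ} (i : Fin (k + 2)) (j : Fin (k + 1)) (e f : II) (w : Fin k → II) :
    insMap i e (insMap j f w) = insMap (i.succAbove j) f (insMap (j.predAbove i) e w) := by
  simp only [insMap, ContinuousMap.coe_mk]
  rw [Fin.insertNth_eq_iff]
  constructor
  · have h := insMap_above (i.succAbove j) f (insMap (j.predAbove i) e w) (j.predAbove i)
    rw [Fin.succAbove_succAbove_predAbove, insMap_same] at h
    exact h.symm
  · rw [Fin.insertNth_eq_iff]
    constructor
    · simp [Fin.removeNth]
    · funext r
      simp only [Fin.removeNth]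
      rw [← Fin.succAbove_succAbove_succAbove_predAbove, Fin.insertNth_apply_succAbove,
        Fin.insertNth_apply_succAbove]

theorem insMap_inj {k : ℕ} {i : Fin (k + 1)} {e f : II} {y y' : Fin k → II}
    (h : insMap i e y = insMap i f y') : e = f ∧ y = y' := by
  constructor
  · have := congrFun h i
    rwa [insMap_same, insMap_same] at this
  · funext j
    have := congrFun h (i.succAbove j)
    rwa [insMap_above, insMap_above] at this

theorem face_succ_dgn {k : ℕ} (i : Fin (k + 1)) (e : II) (s : Cube (k + 1) E) :
    face i.succ e (dgn s) = dgn (face i e s) := by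
  rw [face_succ, dgn_eq, cur_unc, dgn_eq]; rfl

theorem tail_ins_zero {k : ℕ} (e : II) (y : Fin k → II) : tailMap k (insMap 0 e y) = y := by
  funext j
  exact insMap_above 0 e y j

theorem tail_ins_succ {k : ℕ} (i : Fin (k + 1)) (e : II) (y : Fin (k + 1) → II) :
    tailMap (k + 1) (insMap i.succ e y) = insMap i e (tailMap k y) := by
  have : y = Fin.cons (α := fun _ => II) (y 0) (fun j => y j.succ) := (Fin.cons_self_tail y).symm
  simp only [tailMap, insMap, ContinuousMap.coe_mk]
  conv_lhs => rw [this]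
  rw [Fin.insertNth_succ_cons]
  simp

variable {p : C(E, B)} {A : Set B} {c : B}

def homA (p : C(E, B)) (K : Contr A c) {k : ℕ} (s : Cube k E) (hs : Over p A s) :
    C((Fin k → II) × II, B) :=
  ⟨fun z => K.h (p (s z.1), z.2), K.cont.comp_continuous (by fun_prop) fun z => ⟨hs _, trivial⟩⟩

theorem linv_base (hp : IsSerreFibration p) (K : Contr A c) : ∃ L : LTy E 0, LInv p K 0 L := by
  have h : ∀ s : Cube 0 E, ∃ H : C((Fin 0 → II) × II, E), Over p A s →
      (∀ y, H (y, 0) = s y) ∧ (∀ y t, p (H (y, t)) = K.h (p (s y), t)) := by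
    intro s
    by_cases hs : Over p A s
    · obtain ⟨H, h1, h2⟩ := hp 0 (homA p K s hs) s (fun y => (K.h0 _ (hs y)).symm)
      exact ⟨H, fun _ => ⟨h2, fun y t => h1 (y, t)⟩⟩
    · exact ⟨s.comp ContinuousMap.fst, fun h => absurd h hs⟩
  choose L hL using h
  refine ⟨L, fun s hs => (hL s hs).1, fun s hs => (hL s hs).2, ?_, ?_⟩
  · intro s hs i j e f y y' t _ _ h
    obtain rfl : i = j := Subsingleton.elim (α := Fin 1) _ _
    obtain ⟨rfl, rfl⟩ := insMap_inj h
    rfl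
  · intro s hs i e y t _
    obtain rfl : i = 0 := Subsingleton.elim (α := Fin 1) _ _
    rw [face_dgn, tail_ins_zero]

theorem linv_one (hp : IsSerreFibration p) (K : Contr A c) {k : ℕ} {L : LTy E k} (hL : LInv p K k L)
    (s : Cube (k + 1) E) (hs : Over p A s) : ∃ H : C((Fin (k + 1) → II) × II, E),
      (∀ y, H (y, 0) = s y) ∧ (∀ y t, p (H (y, t)) = K.h (p (s y), t)) ∧
      (∀ i e y t, IsEnd e → H (insMap i e y, t) = L (face i e s) (y, t)) ∧
      (∀ r, s = dgn r → ∀ z t, H (z, t) = L r (tailMap k z, t)) := by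
  by_cases hd : ∃ r, s = dgn r
  · obtain ⟨r, rfl⟩ := hd
    have hr := over_dgn hs
    refine ⟨(L r).comp ((tailMap k).prodMap (ContinuousMap.id II)), ?_, ?_, ?_, ?_⟩
    · intro y; exact hL.a r hr _
    · intro y t; exact hL.b r hr _ _
    · intro i e y t he; exact (hL.g2 r hr i e y t he).symm
    · intro r' h
      have := congrArg (face 0 0) h
      rw [face_dgn, face_dgn] at this
      subst this
      intro z t; rfl
  · let en : Bool → II := fun b => if b then 1 else 0
    have hen : ∀ b, IsEnd (en b) := by
      rintro (_ | _)
      · left; rfl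
      · right; rfl
    let C : Option (Fin (k + 1) × Bool) → Set ((Fin (k + 1) → II) × II) := fun o => match o with
      | none => {z | z.2 = 0}
      | some a => {z | z.1 a.1 = en a.2}
    let f : Option (Fin (k + 1) × Bool) → ((Fin (k + 1) → II) × II) → E := fun o => match o with
      | none => fun z => s z.1
      | some a => fun z => L (face a.1 (en a.2) s) (fun j => z.1 (a.1.succAbove j), z.2)
    have hCz : ∀ a : Fin (k + 1) × Bool, ∀ z : ((Fin (k + 1) → II) × II), z ∈ C (some a) →
        insMap a.1 (en a.2) (fun j => z.1 (a.1.succAbove j)) = z.1 := by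
      intro a z hz
      have hz' : z.1 a.1 = en a.2 := hz
      rw [← hz', insMap_self]
    have h0 : ∀ a, ∀ z : ((Fin (k + 1) → II) × II), z ∈ C none → z ∈ C (some a) → f (some a) z = f none z := by
      intro a z hz hz'
      have hz0 : z.2 = 0 := hz
      simp only [f]
      rw [hz0, hL.a _ (hs.face _ _)]
      change s (insMap _ _ _) = _
      rw [hCz a z hz']
    obtain ⟨g, hg1, hg2⟩ := glue_closed (E := E) C (by
        rintro (_ | a)
        · exact isClosed_eq continuous_snd continuous_const
        · exact isClosed_eq (by fun_prop) continuous_const) f (by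
        rintro (_ | a)
        · exact Continuous.continuousOn (by fun_prop)
        · exact Continuous.continuousOn (by fun_prop)) (by
        rintro (_ | a) (_ | b) z hz hz'
        · rfl
        · exact (h0 b z hz hz').symm
        · exact h0 a z hz' hz
        · refine hL.g1 s hs _ _ _ _ _ _ _ (hen _) (hen _) ?_
          rw [hCz a z hz, hCz b z hz']) (fun z => s z.1)
    have hJ : JJ (k + 1) = ⋃ a, C a := by
      ext z
      simp only [JJ, Set.mem_iUnion]
      constructor
      · rintro (h | ⟨i, h | h⟩)
        · exact ⟨none, h⟩
        · exact ⟨some (i, false), h⟩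
        · exact ⟨some (i, true), h⟩
      · rintro ⟨_ | ⟨i, _ | _⟩, h⟩
        · left; exact h
        · right; exact ⟨i, Or.inl h⟩
        · right; exact ⟨i, Or.inr h⟩
    obtain ⟨H, H1, H2⟩ := rel_hlp hp (homA p K s hs) g (hJ ▸ hg1) (by
      intro z hz
      rw [hJ] at hz
      obtain ⟨o, ho⟩ := Set.mem_iUnion.1 hz
      rw [hg2 o z ho]
      match o, ho with
      | none, ho =>
        have hz0 : z.2 = 0 := ho
        change p (s z.1) = K.h (p (s z.1), z.2)
        rw [hz0, K.h0 _ (hs _)]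
      | some a, ho =>
        change p (L _ _) = K.h (p (s z.1), z.2)
        rw [hL.b _ (hs.face _ _)]
        change K.h (p (s (insMap _ _ _)), z.2) = _
        rw [hCz a z ho])
    refine ⟨H, ?_, fun y t => H1 (y, t), ?_, fun r hr => absurd ⟨r, hr⟩ hd⟩
    · intro y
      have : (y, (0 : II)) ∈ C none := rfl
      rw [H2 _ (by rw [hJ]; exact Set.mem_iUnion.2 ⟨none, this⟩), hg2 none _ this]
    · intro i e y t he
      obtain ⟨b, rfl⟩ : ∃ b, e = en b := by
        rcases he with rfl | rfl
        · exact ⟨false, rfl⟩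
        · exact ⟨true, rfl⟩
      have : (insMap i (en b) y, t) ∈ C (some (i, b)) := insMap_same _ _ _
      rw [H2 _ (by rw [hJ]; exact Set.mem_iUnion.2 ⟨some (i, b), this⟩), hg2 (some (i, b)) _ this]
      simp only [f, insMap_above]

theorem linv_step (hp : IsSerreFibration p) (K : Contr A c) {k : ℕ} {L : LTy E k}
    (hL : LInv p K k L) : ∃ L' : LTy E (k + 1), LInv p K (k + 1) L' ∧ LCompat p A L L' := by
  have h : ∀ s : Cube (k + 1) E, ∃ H : C((Fin (k + 1) → II) × II, E), Over p A s →
      (∀ y, H (y, 0) = s y) ∧ (∀ y t, p (H (y, t)) = K.h (p (s y), t)) ∧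
      (∀ i e y t, IsEnd e → H (insMap i e y, t) = L (face i e s) (y, t)) ∧
      (∀ r, s = dgn r → ∀ z t, H (z, t) = L r (tailMap k z, t)) := by
    intro s
    by_cases hs : Over p A s
    · obtain ⟨H, h⟩ := linv_one hp K hL s hs
      exact ⟨H, fun _ => h⟩
    · exact ⟨s.comp ContinuousMap.fst, fun h => absurd h hs⟩
  choose L' hL' using h
  have hC : LCompat p A L L' := by
    refine ⟨fun s hs => (hL' s hs).2.2.1, fun s hs => ?_⟩
    exact (hL' (dgn s) (fun y => hs _)).2.2.2 s rfl
  refine ⟨L', ⟨fun s hs => (hL' s hs).1, fun s hs => (hL' s hs).2.1, ?_, ?_⟩, hC⟩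
  · intro s hs i j e f y y' t he hf h
    by_cases hij : i = j
    · subst hij
      obtain ⟨rfl, rfl⟩ := insMap_inj h
      rfl
    · obtain ⟨j', rfl⟩ := Fin.exists_succAbove_eq (Ne.symm hij)
      have hy : y j' = f := by
        have := congrFun h (i.succAbove j')
        rwa [insMap_above, insMap_same] at this
      set w : Fin k → II := fun r => y (j'.succAbove r) with hw
      have hyw : y = insMap j' f w := by rw [← hy, insMap_self]
      rw [hyw, insMap_comm] at h
      have h' := (insMap_inj h).2
      rw [hyw, ← h', hC.c1 _ (hs.face _ _) _ _ _ _ hf, hC.c1 _ (hs.face _ _) _ _ _ _ he]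
      congr 2
      ext v
      change s (insMap _ _ (insMap _ _ v)) = s (insMap _ _ (insMap _ _ v))
      rw [insMap_comm]
  · intro s hs i e y t he
    refine Fin.cases ?_ (fun i => ?_) i
    · rw [face_dgn, tail_ins_zero]
    · rw [face_succ_dgn, tail_ins_succ, hC.c2 _ (hs.face _ _), hC.c1 _ hs _ _ _ _ he]

theorem exists_lifts (hp : IsSerreFibration p) (K : Contr A c) :
    ∃ L : ∀ k, LTy E k, (∀ k, LInv p K k (L k)) ∧ ∀ k, LCompat p A (L k) (L (k + 1)) := by
  choose L0 h0 using linv_base hp K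
  choose st hst using fun (k : ℕ) (L : {L : LTy E k // LInv p K k L}) => linv_step hp K L.2
  let S : ∀ k, {L : LTy E k // LInv p K k L} := fun k =>
    Nat.rec (motive := fun k => {L : LTy E k // LInv p K k L}) ⟨L0, h0⟩
      (fun k L => ⟨st k L, (hst k L).1⟩) k
  exact ⟨fun k => (S k).1, fun k => (S k).2, fun k => (hst k (S k)).2⟩

def prism {k : ℕ} (H : C((Fin k → II) × II, E)) : Cube (k + 1) E :=
  ⟨fun z => H (fun j => z j.castSucc, z (Fin.last k)), by fun_prop⟩

def endC {k : ℕ} (H : C((Fin k → II) × II, E)) : Cube k E := ⟨fun y => H (y, 1), by fun_prop⟩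

theorem face_last {k : ℕ} (H : C((Fin k → II) × II, E)) (e : II) (y : Fin k → II) :
    face (Fin.last k) e (prism H) y = H (y, e) := by
  change H (_, _) = H (y, e)
  congr 2
  · funext j
    have := insMap_above (Fin.last k) e y j
    rwa [Fin.succAbove_last] at this
  · exact insMap_same _ _ _

theorem dN_sN_succ {k : ℕ} (s : Cube (k + 1) E) :
    dN (sN s) = ∑ i, (sN (face i 0 s) + sN (face i 1 s)) := by
  rw [← qq_one, dN_succ, bd, lin_one]
  simp

theorem insMap_castSucc {k : ℕ} (i : Fin (k + 1)) (e : II) (z : Fin (k + 1) → II) :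
    (fun j : Fin (k + 1) => insMap i.castSucc e z j.castSucc) = insMap i e (fun j => z j.castSucc) ∧
    insMap i.castSucc e z (Fin.last (k + 1)) = z (Fin.last k) := by
  constructor
  · simp only [insMap, ContinuousMap.coe_mk]
    symm
    rw [Fin.insertNth_eq_iff]
    constructor
    · simp
    · funext j
      simp only [Fin.removeNth]
      rw [← Fin.castSucc_succAbove_castSucc, Fin.insertNth_apply_succAbove]
  · have h := insMap_above i.castSucc e z (Fin.last k)
    rwa [Fin.succAbove_ne_last_last (Fin.castSucc_lt_last i).ne] at h

theorem face_castSucc_prism {k : ℕ} (H : C((Fin (k + 1) → II) × II, E)) (H' : C((Fin k → II) × II, E))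
    (i : Fin (k + 1)) (e : II) (h : ∀ y t, H (insMap i e y, t) = H' (y, t)) :
    face i.castSucc e (prism H) = prism H' := by
  ext z
  change H (_, _) = H' (_, _)
  rw [← h]
  congr 2
  · exact (insMap_castSucc i e z).1
  · exact (insMap_castSucc i e z).2

theorem prism_dgn {k : ℕ} (H : C((Fin (k + 1) → II) × II, E)) (H' : C((Fin k → II) × II, E))
    (h : ∀ y t, H (y, t) = H' (tailMap k y, t)) : prism H = dgn (prism H') := by
  ext z
  change H (_, _) = H' (_, _)
  rw [h]
  rfl

theorem exists_prism (hp : IsSerreFibration p) (K : Contr A c) :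
    ∃ P : NN E →ₗ[K2] NN E,
      (∀ k, ∀ x ∈ Nin k (p ⁻¹' A), P x ∈ Nin (k + 1) (p ⁻¹' A)) ∧
      (∀ k, ∀ x ∈ Nin k (p ⁻¹' {c}), P x ∈ Nin (k + 1) (p ⁻¹' {c})) ∧
      (∀ k, ∀ x ∈ Nin k (p ⁻¹' A), x + dN (P x) + P (dN x) ∈ Nin k (p ⁻¹' {c})) := by
  classical
  obtain ⟨L, hL, hC⟩ := exists_lifts hp K
  let f : ∀ k, Ch k E →ₗ[K2] NN E := fun k => lin fun s =>
    if Over p A s then sN (prism (L k s)) else 0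
  have hdeg : ∀ (k : ℕ) (x : Ch k E), f (k + 1) (unc (push constM x)) = 0 := by
    intro k x
    have : (f (k + 1) ∘ₗ unc ∘ₗ push constM : Ch k E →ₗ[K2] _) = 0 := ch_ext (by
      intro r
      simp only [LinearMap.comp_apply, push_one, unc_one, LinearMap.zero_apply, f, lin_one]
      rw [← dgn_eq]
      split_ifs with h
      · apply sN_deg
        rw [isDeg_succ]
        exact ⟨_, prism_dgn _ _ ((hC k).c2 r (over_dgn h))⟩
      · rfl)
    exact LinearMap.congr_fun this x
  have hP : ∀ k (s : Cube k E), Over p A s → liftN f (sN s) = sN (prism (L k s)) := by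
    intro k s hs
    rw [← qq_one, liftN_qq _ hdeg]
    simp only [f, lin_one, hs, if_true]
  have hend : ∀ k (s : Cube k E), Over p A s → face (Fin.last k) 1 (prism (L k s)) = endC (L k s) := by
    intro k s hs
    ext y
    rw [face_last]; rfl
  have hst : ∀ k (s : Cube k E), Over p A s → face (Fin.last k) 0 (prism (L k s)) = s := by
    intro k s hs
    ext y
    rw [face_last, (hL k).a s hs]
  have key : ∀ k (s : Cube k E), Over p A s →
      sN s + dN (liftN f (sN s)) + liftN f (dN (sN s)) = sN (endC (L k s)) := by
    intro k s hs
    rw [hP k s hs, dN_sN_succ, Fin.sum_univ_castSucc, hst k s hs, hend k s hs]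
    match k, s, hs with
    | 0, s, hs =>
      have : dN (sN s) = 0 := by rw [← qq_one, dN_zero]
      rw [this]
      simp only [Finset.univ_eq_empty, Finset.sum_empty, zero_add, map_zero, add_zero]
      rw [k2_add_cancel]
    | k + 1, s, hs =>
      rw [dN_sN_succ, map_sum]
      have : ∀ i : Fin (k + 1), liftN f (sN (face i 0 s) + sN (face i 1 s)) =
          sN (face i.castSucc 0 (prism (L (k + 1) s))) +
          sN (face i.castSucc 1 (prism (L (k + 1) s))) := by
        intro i
        rw [map_add, hP _ _ (hs.face _ _), hP _ _ (hs.face _ _),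
          face_castSucc_prism _ _ i 0 (fun y t => (hC k).c1 s hs i 0 y t (Or.inl rfl)),
          face_castSucc_prism _ _ i 1 (fun y t => (hC k).c1 s hs i 1 y t (Or.inr rfl))]
      rw [Finset.sum_congr rfl fun i _ => this i]
      generalize (∑ i : Fin (k + 1), (sN (face i.castSucc 0 (prism (L (k + 1) s))) +
          sN (face i.castSucc 1 (prism (L (k + 1) s))))) = S
      generalize sN s = a
      generalize sN (endC (L (k + 1) s)) = b
      calc _ = (a + a) + (S + S) + b := by abel
        _ = b := by rw [k2_add_self, k2_add_self, zero_add, zero_add]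
  refine ⟨liftN f, fun k => nin_le _ _ fun s hs => ?_, fun k => nin_le _ _ fun s hs => ?_,
    fun k => ?_⟩
  · rw [hP k s hs]
    refine sN_mem fun z => ?_
    change p (L k s _) ∈ A
    rw [(hL k).b s hs]
    exact K.mem _ (hs _) _
  · have hs' : Over p A s := fun y => by
      have : p (s y) = c := hs y
      rw [this]; exact K.cA
    rw [hP k s hs']
    refine sN_mem fun z => ?_
    change p (L k s _) = c
    rw [(hL k).b s hs']
    have : p (s fun j => z j.castSucc) = c := hs _
    rw [this, K.hc]
  · refine nin_le (LinearMap.id + dN ∘ₗ liftN f + liftN f ∘ₗ dN) _ fun s hs => ?_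
    simp only [LinearMap.add_apply, LinearMap.comp_apply, LinearMap.id_apply]
    rw [key k s hs]
    refine sN_mem fun z => ?_
    change p (L k s _) = c
    rw [(hL k).b s hs, K.h1 _ (hs _)]

theorem fib_sub (K : Contr A c) : p ⁻¹' {c} ⊆ p ⁻¹' A := by
  intro x hx
  have : p x = c := hx
  change p x ∈ A
  rw [this]; exact K.cA

/-- The fibre includes into the part over a contractible set as a homology isomorphism. -/
theorem fib_bij (hp : IsSerreFibration p) (K : Contr A c) (k : ℕ) :
    Function.Bijective (SubCx.inc (cx_le (fib_sub (p := p) K)) k) := by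
  obtain ⟨P, P1, P2, P3⟩ := exists_prism hp K
  apply SubCx.inc_bij
  · intro z hz
    rw [SubCx.mem_Z] at hz
    have h := P3 k z hz.1
    rw [hz.2, map_zero, add_zero] at h
    refine ⟨z + dN (P z), SubCx.mem_Z.2 ⟨h, ?_⟩, P z, P1 _ _ hz.1, k2_add_cancel _ _⟩
    rw [map_add, hz.2, dN_dN, add_zero]
  · intro z hz y hy e
    rw [SubCx.mem_Z] at hz
    have h := P3 (k + 1) y hy
    rw [e] at h
    refine ⟨y + dN (P y) + P z + P z, add_mem h (P2 _ _ hz.1), ?_⟩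
    rw [add_assoc, k2_add_self, add_zero, map_add, dN_dN, add_zero, e]

end Prism


/-! ### Parts of the total space over subsets of a chart -/

section Chart

open Module

theorem finrank_range_comp_inj {M N P : Type} [AddCommGroup M] [Module K2 M] [AddCommGroup N]
    [Module K2 N] [AddCommGroup P] [Module K2 P] (f : M →ₗ[K2] N) (e : N →ₗ[K2] P)
    (he : Function.Injective e) :
    finrank K2 (LinearMap.range (e ∘ₗ f)) = finrank K2 (LinearMap.range f) := by
  rw [LinearMap.range_comp]
  exact ((Submodule.equivMapOfInjective e he _).finrank_eq).symm

section Sets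
variable {X : Type} [TopologicalSpace X]

noncomputable def iS {P Q : Set X} (h : P ⊆ Q) (k : ℕ) : HS k P →ₗ[K2] HS k Q :=
  SubCx.inc (cx_le h) k

theorem iS_iS {P Q R : Set X} (h : P ⊆ Q) (h' : Q ⊆ R) (k : ℕ) (x : HS k P) :
    iS h' k (iS h k x) = iS (h.trans h') k x := SubCx.inc_inc _ _ _ _ _

theorem iS_bij_of_comp {P Q R : Set X} (h : P ⊆ Q) (h' : Q ⊆ R) (k : ℕ)
    (h1 : Function.Bijective (iS h k)) (h2 : Function.Bijective (iS (h.trans h') k)) :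
    Function.Bijective (iS h' k) := by
  have : (iS (h.trans h') k : _ → _) = iS h' k ∘ iS h k := by
    funext x; exact (iS_iS h h' k x).symm
  rw [this] at h2
  exact (Function.Bijective.of_comp_iff _ h1).1 h2

theorem rank_alS {P Q R : Set X} (hP : P ⊆ R) (hQ : Q ⊆ R) (k : ℕ)
    (h1 : Function.Bijective (iS hP k)) (h2 : Function.Bijective (iS hQ k)) :
    finrank K2 (LinearMap.range (alS P Q k)) =
      finrank K2 (LinearMap.range (iS (Set.inter_subset_left.trans hP : P ∩ Q ⊆ R) k)) := by
  rw [← finrank_range_comp_inj (alS P Q k) ((iS hP k).prodMap (iS hQ k))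
    (by
      rintro ⟨a, b⟩ ⟨a', b'⟩ h
      simp only [LinearMap.prodMap_apply, Prod.mk.injEq] at h
      rw [h1.1 h.1, h2.1 h.2])]
  rw [← finrank_range_comp_inj (iS (Set.inter_subset_left.trans hP : P ∩ Q ⊆ R) k)
    (LinearMap.id.prod LinearMap.id) (by
      intro a b h
      exact (Prod.mk.injEq _ _ _ _ ▸ h).1)]
  have : ((iS hP k).prodMap (iS hQ k)) ∘ₗ alS P Q k = (LinearMap.id.prod LinearMap.id) ∘ₗ
      iS (Set.inter_subset_left.trans hP : P ∩ Q ⊆ R) k :=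
    LinearMap.ext fun x => Prod.ext (iS_iS Set.inter_subset_left hP k x)
      (iS_iS Set.inter_subset_right hQ k x)
  rw [this]

end Sets

variable {E B V : Type} [TopologicalSpace E] [TopologicalSpace B] [NormedAddCommGroup V]
  [NormedSpace ℝ V]

def TS (φ : OpenPartialHomeomorph B V) (S : Set V) : Set B := φ.source ∩ φ ⁻¹' S

def chartContr (φ : OpenPartialHomeomorph B V) (hφ : φ.target = Set.univ) {S : Set V} {a : V}
    (ha : a ∈ S) (hS : StarConvex ℝ a S) : Contr (TS φ S) (φ.symm a) where
  h z := φ.symm ((z.2 : ℝ) • a + (1 - (z.2 : ℝ)) • φ z.1)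
  cont := by
    have h1 : Continuous φ.symm := by
      have := φ.symm.continuousOn
      rw [φ.symm_source, hφ] at this
      exact continuousOn_univ.1 this
    refine h1.comp_continuousOn ?_
    have h2 : ContinuousOn (fun z : B × II => φ z.1) (TS φ S ×ˢ Set.univ) :=
      φ.continuousOn.comp continuousOn_fst fun z hz => hz.1.1
    have h3 : ContinuousOn (fun z : B × II => (z.2 : ℝ)) (TS φ S ×ˢ Set.univ) :=
      (continuous_subtype_val.comp continuous_snd).continuousOn
    exact (h3.smul continuousOn_const).add ((continuousOn_const.sub h3).smul h2)
  mem x hx t := by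
    refine ⟨φ.map_target (by rw [hφ]; trivial), ?_⟩
    change φ (φ.symm _) ∈ S
    rw [φ.right_inv (by rw [hφ]; trivial)]
    exact hS hx.2 t.2.1 (by have := t.2.2; linarith) (by ring)
  h0 x hx := by simp [φ.left_inv hx.1]
  h1 x hx := by simp
  hc t := by
    simp only
    rw [φ.right_inv (by rw [hφ]; trivial), ← add_smul]
    simp
  cA := ⟨φ.map_target (by rw [hφ]; trivial), by
    change φ (φ.symm _) ∈ S
    rw [φ.right_inv (by rw [hφ]; trivial)]; exact ha⟩

/-- Part of the total space over a subset of the chart -/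
def EE (p : C(E, B)) (φ : OpenPartialHomeomorph B V) (S : Set V) : Set E := p ⁻¹' (TS φ S)

variable {p : C(E, B)} {φ : OpenPartialHomeomorph B V}

theorem EE_mono {S T : Set V} (h : S ⊆ T) : EE p φ S ⊆ EE p φ T :=
  fun _ hx => ⟨hx.1, h hx.2⟩

theorem EE_open {S : Set V} (hS : IsOpen S) : IsOpen (EE p φ S) :=
  (φ.isOpen_inter_preimage hS).preimage p.continuous

theorem EE_inter (S T : Set V) : EE p φ (S ∩ T) = EE p φ S ∩ EE p φ T := by
  ext x; simp only [EE, TS, Set.mem_preimage, Set.mem_inter_iff]; tauto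

theorem EE_union (S T : Set V) : EE p φ (S ∪ T) = EE p φ S ∪ EE p φ T := by
  ext x; simp only [EE, TS, Set.mem_preimage, Set.mem_inter_iff, Set.mem_union]; tauto

theorem fib_chart (hp : IsSerreFibration p) (hφ : φ.target = Set.univ) {S : Set V} {a : V}
    (ha : a ∈ S) (hS : StarConvex ℝ a S) (k : ℕ) :
    ∃ h : p ⁻¹' {φ.symm a} ⊆ EE p φ S, Function.Bijective (iS h k) :=
  ⟨fib_sub (chartContr φ hφ ha hS), fib_bij hp (chartContr φ hφ ha hS) k⟩

theorem star_bij (hp : IsSerreFibration p) (hφ : φ.target = Set.univ) {S : Set V} {a : V}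
    (ha : a ∈ S) (hS : StarConvex ℝ a S) (k : ℕ) :
    Function.Bijective (iS (EE_mono (p := p) (φ := φ) (Set.subset_univ S)) k) := by
  obtain ⟨h1, h2⟩ := fib_chart hp hφ ha hS k
  obtain ⟨h3, h4⟩ := fib_chart hp hφ (Set.mem_univ a) (starConvex_univ a) k
  exact iS_bij_of_comp h1 _ k h2 h4

/-! The filtration of the punctured chart -/

def WW (n j : ℕ) : Set (EuclideanSpace ℝ (Fin n)) := {x | ∃ i : Fin n, i.val < j ∧ x i ≠ 0}

def HA (n : ℕ) (j : Fin n) (e : ℝ) : Set (EuclideanSpace ℝ (Fin n)) :=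
  {x | x ∈ WW n j ∨ 0 < e * x j}

theorem WW_open (n j : ℕ) : IsOpen (WW n j) := by
  have : WW n j = ⋃ i : {i : Fin n // i.val < j}, {x | x i.1 ≠ 0} := by
    ext x; simp [WW]
  rw [this]
  refine isOpen_iUnion fun i => isOpen_ne_fun (by fun_prop) continuous_const

theorem HA_open (n : ℕ) (j : Fin n) (e : ℝ) : IsOpen (HA n j e) :=
  (WW_open n j).union (isOpen_lt (f := fun _ => (0:ℝ))
    (g := fun x : EuclideanSpace ℝ (Fin n) => e * x j) continuous_const (by fun_prop))

theorem WW_zero (n : ℕ) : WW n 0 = ∅ := by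
  ext x; simp [WW]

theorem HA_union (n : ℕ) (j : Fin n) : HA n j 1 ∪ HA n j (-1) = WW n (j.val + 1) := by
  ext x
  simp only [HA, WW, Set.mem_union, Set.mem_ofPred_eq]
  constructor
  · rintro ((⟨i, h1, h2⟩ | h) | (⟨i, h1, h2⟩ | h))
    · exact ⟨i, by omega, h2⟩
    · exact ⟨j, by omega, by rintro h'; rw [h'] at h; simp at h⟩
    · exact ⟨i, by omega, h2⟩
    · exact ⟨j, by omega, by rintro h'; rw [h'] at h; simp at h⟩
  · rintro ⟨i, h1, h2⟩
    rcases Nat.lt_succ_iff_lt_or_eq.1 h1 with h | h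
    · exact Or.inl (Or.inl ⟨i, h, h2⟩)
    · obtain rfl : i = j := Fin.ext h
      rcases lt_or_gt_of_ne h2 with h | h
      · right; right; linarith
      · left; right; linarith

theorem HA_inter (n : ℕ) (j : Fin n) : HA n j 1 ∩ HA n j (-1) = WW n j := by
  ext x
  simp only [HA, Set.mem_inter_iff, Set.mem_ofPred_eq]
  constructor
  · rintro ⟨h1 | h1, h2 | h2⟩
    · exact h1
    · exact h1
    · exact h2
    · exfalso; linarith
  · intro h; exact ⟨Or.inl h, Or.inl h⟩

theorem HA_center (n : ℕ) (j : Fin n) (e : ℝ) (he : e * e = 1) :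
    EuclideanSpace.single j e ∈ HA n j e := by
  right
  simp [he]

theorem HA_star (n : ℕ) (j : Fin n) (e : ℝ) (he : e * e = 1) :
    StarConvex ℝ (EuclideanSpace.single j e) (HA n j e) := by
  intro y hy s t hs ht hst
  rcases hy with ⟨i, hi, hy⟩ | hy
  · rcases ht.eq_or_lt with rfl | ht
    · have : s = 1 := by linarith
      subst this
      simpa using HA_center n j e he
    · left
      refine ⟨i, hi, ?_⟩
      have hij : i ≠ j := by rintro rfl; exact lt_irrefl _ hi
      simp [hij, hy, ht.ne']
  · right
    simp only [PiLp.add_apply, PiLp.smul_apply, smul_eq_mul, EuclideanSpace.single_apply, if_true]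
    have h1 : e * (s * e + t * y j) = s * (e * e) + t * (e * y j) := by ring
    rw [h1, he]
    rcases ht.eq_or_lt with rfl | ht
    · have : s = 1 := by linarith
      subst this
      simp
    · have := mul_pos ht hy
      linarith

theorem WW_top (n : ℕ) : WW n n = {0}ᶜ := by
  ext x
  simp only [WW, Set.mem_ofPred_eq, Set.mem_compl_iff, Set.mem_singleton_iff]
  constructor
  · rintro ⟨i, _, h⟩ rfl; simp at h
  · intro h
    by_contra hc
    push Not at hc
    exact h (by ext i; simpa using hc i i.2)

section Dims

variable {n : ℕ} {φ : OpenPartialHomeomorph B (EuclideanSpace ℝ (Fin n))}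

theorem HA_bij (hp : IsSerreFibration p) (hφ : φ.target = Set.univ) (j : Fin n) (e : ℝ)
    (he : e * e = 1) (k : ℕ) :
    Function.Bijective (iS (EE_mono (p := p) (φ := φ) (Set.subset_univ (HA n j e))) k) :=
  star_bij hp hφ (HA_center n j e he) (HA_star n j e he) k

theorem WW_surj (hp : IsSerreFibration p) (hφ : φ.target = Set.univ) (j : Fin n) (k : ℕ) :
    Function.Surjective (iS (EE_mono (p := p) (φ := φ) (Set.subset_univ (WW n (j.val + 1)))) k) := by
  have h : HA n j 1 ⊆ WW n (j.val + 1) := by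
    rw [← HA_union]; exact Set.subset_union_left
  intro y
  obtain ⟨x, rfl⟩ := (HA_bij (p := p) hp hφ j 1 (by norm_num) k).2 y
  exact ⟨iS (EE_mono h) k x, iS_iS _ _ _ _⟩

theorem WW_dims (hp : IsSerreFibration p) (hφ : φ.target = Set.univ)
    (hfin : ∀ k, FiniteDimensional K2 (HS k (EE p φ Set.univ)))
    (f : ℕ → ℕ) (hf : ∀ k, finrank K2 (HS k (EE p φ Set.univ)) = f k) :
    ∀ j : ℕ, j + 1 ≤ n → ∀ k, FiniteDimensional K2 (HS k (EE p φ (WW n (j + 1)))) ∧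
      finrank K2 (HS k (EE p φ (WW n (j + 1)))) = f k + if j ≤ k then f (k - j) else 0 := by
  have hA : ∀ (j : Fin n) (e : ℝ), e * e = 1 → ∀ k, FiniteDimensional K2 (HS k (EE p φ (HA n j e)))
      ∧ finrank K2 (HS k (EE p φ (HA n j e))) = f k := by
    intro j e he k
    let E := LinearEquiv.ofBijective _ (HA_bij (p := p) hp hφ j e he k)
    have := hfin k
    exact ⟨E.symm.finiteDimensional, E.finrank_eq.trans (hf k)⟩
  -- rank of the Mayer-Vietoris map
  have hr : ∀ (j : Fin n) k, finrank K2 (LinearMap.range (alS (EE p φ (HA n j 1))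
      (EE p φ (HA n j (-1))) k)) = if j.val = 0 then 0 else f k := by
    intro j k
    rw [rank_alS _ _ k (HA_bij (p := p) hp hφ j 1 (by norm_num) k)
      (HA_bij (p := p) hp hφ j (-1) (by norm_num) k)]
    have key : ∀ (T : Set E) (_ : EE p φ (WW n j) = T) (h : T ⊆ EE p φ Set.univ),
        finrank K2 (LinearMap.range (iS h k)) = if j.val = 0 then 0 else f k := by
      rintro T rfl h
      split_ifs with h0
      · have : EE p φ (WW n j) = ∅ := by
          rw [h0, WW_zero]; ext x; simp [EE, TS]
        have hs : Subsingleton (HS k (EE p φ (WW n j))) := by rw [this]; exact H_empty k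
        have : iS h k = 0 := by
          refine LinearMap.ext fun x => ?_
          rw [Subsingleton.elim x 0, map_zero, map_zero]
        rw [this]; simp
      · obtain ⟨j', hj'⟩ := Nat.exists_eq_succ_of_ne_zero h0
        have hlt : j' < n := by have := j.2; omega
        have hs := WW_surj (p := p) hp hφ ⟨j', hlt⟩ k
        have : ∀ (m : ℕ) (_ : j'.succ = m) (h : EE p φ (WW n m) ⊆ EE p φ Set.univ),
            finrank K2 (LinearMap.range (iS h k)) = f k := by
          rintro m rfl h
          rw [LinearMap.range_eq_top.2 hs, finrank_top, hf]
        exact this _ hj'.symm h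
    refine key _ ?_ _
    rw [← EE_inter, HA_inter]
  intro j
  induction j with
  | zero =>
    intro hj k
    let j0 : Fin n := ⟨0, hj⟩
    have hu : EE p φ (WW n (0 + 1)) = EE p φ (HA n j0 1) ∪ EE p φ (HA n j0 (-1)) := by
      rw [← EE_union, HA_union]
    rw [hu]
    obtain ⟨i1, d1⟩ := hA j0 1 (by norm_num) k
    obtain ⟨i2, d2⟩ := hA j0 (-1) (by norm_num) k
    have r1 := hr j0
    simp only [j0, if_true] at r1
    simp only [zero_le, if_true, tsub_zero]
    cases k with
    | zero =>
      obtain ⟨h1, h2⟩ := mvS_zero (EE_open (p := p) (φ := φ) (HA_open n j0 1))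
        (EE_open (p := p) (φ := φ) (HA_open n j0 (-1)))
      refine ⟨h1, ?_⟩
      rw [r1, d1, d2] at h2
      simpa using h2
    | succ k =>
      have he : EE p φ (HA n j0 1) ∩ EE p φ (HA n j0 (-1)) = ∅ := by
        rw [← EE_inter, HA_inter]; simp only [j0]; rw [WW_zero]; ext x; simp [EE, TS]
      have hs : Subsingleton (HS k (EE p φ (HA n j0 1) ∩ EE p φ (HA n j0 (-1)))) := by
        rw [he]; exact H_empty k
      obtain ⟨h1, h2⟩ := mvS_succ (EE_open (p := p) (φ := φ) (HA_open n j0 1))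
        (EE_open (p := p) (φ := φ) (HA_open n j0 (-1))) k
      refine ⟨h1, ?_⟩
      have d3 : finrank K2 (HS k (EE p φ (HA n j0 1) ∩ EE p φ (HA n j0 (-1)))) = 0 :=
        finrank_zero_of_subsingleton
      rw [r1, r1, d1, d2, d3] at h2
      simpa using h2
  | succ j ih =>
    intro hj k
    let j0 : Fin n := ⟨j + 1, hj⟩
    have hu : EE p φ (WW n (j + 1 + 1)) = EE p φ (HA n j0 1) ∪ EE p φ (HA n j0 (-1)) := by
      rw [← EE_union, HA_union]
    rw [hu]
    obtain ⟨i1, d1⟩ := hA j0 1 (by norm_num) k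
    obtain ⟨i2, d2⟩ := hA j0 (-1) (by norm_num) k
    have r1 : ∀ k, _ = f k := fun k => (hr j0 k).trans (if_neg (by simp [j0]))
    cases k with
    | zero =>
      obtain ⟨h1, h2⟩ := mvS_zero (EE_open (p := p) (φ := φ) (HA_open n j0 1))
        (EE_open (p := p) (φ := φ) (HA_open n j0 (-1)))
      refine ⟨h1, ?_⟩
      rw [r1, d1, d2] at h2
      simp
      omega
    | succ k =>
      obtain ⟨i3, d3⟩ := ih (by omega) k
      have he : EE p φ (WW n (j + 1)) = EE p φ (HA n j0 1) ∩ EE p φ (HA n j0 (-1)) := by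
        rw [← EE_inter, HA_inter]
      rw [he] at i3 d3
      obtain ⟨h1, h2⟩ := mvS_succ (EE_open (p := p) (φ := φ) (HA_open n j0 1))
        (EE_open (p := p) (φ := φ) (HA_open n j0 (-1))) k
      refine ⟨h1, ?_⟩
      rw [r1, r1, d1, d2, d3] at h2
      have e1 : k + 1 - (j + 1) = k - j := by omega
      have e2 : (j + 1 ≤ k + 1) ↔ (j ≤ k) := by omega
      simp only [e1, e2]
      omega

end Dims

end Chart


/-! ### Two charts -/

section TwoCharts

open Module

variable {E B : Type} [TopologicalSpace E] [TopologicalSpace B] {p : C(E, B)} {n : ℕ}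
  {φ ψ : OpenPartialHomeomorph B (EuclideanSpace ℝ (Fin n))}

theorem k2_one_dim {M : Type} [AddCommGroup M] [Module K2 M] (h : finrank K2 M = 1) {a b : M}
    (ha : a ≠ 0) (hb : b ≠ 0) : a + b = 0 := by
  obtain ⟨c, hc⟩ := (finrank_eq_one_iff_of_nonzero' a ha).1 h b
  have h2 : ∀ c : K2, c = 0 ∨ c = 1 := by decide
  rcases h2 c with rfl | rfl
  · rw [zero_smul] at hc; exact absurd hc.symm hb
  · rw [one_smul] at hc; rw [← hc]; exact k2_add_self a

theorem disj_sum {X : Type} [TopologicalSpace X] {P Q R : Set X} (hP : IsOpen P) (hQ : IsOpen Q)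
    (hd : P ∩ Q = ∅) (hR : P ∪ Q = R) (hPR : P ⊆ R) (hQR : Q ⊆ R) (k : ℕ) (x : HS k P) (y : HS k Q)
    (h : iS hPR k x + iS hQR k y = 0) : x = 0 := by
  subst hR
  have hs : Subsingleton (((cx P).inf (cx Q)).H k) := by
    rw [cx_inf, hd]; exact H_empty k
  have h1 : SubCx.inc (cx_sup_le P Q) k ((cx P).be (cx Q) k (x, y)) = 0 := by
    rw [← h]
    change SubCx.inc _ k (SubCx.inc (SubCx.le_sup_l _ _) k x + SubCx.inc (SubCx.le_sup_r _ _) k y) = _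
    rw [map_add, SubCx.inc_inc, SubCx.inc_inc]
    rfl
  have h2 : (cx P).be (cx Q) k (x, y) = 0 :=
    (cx_sup_bij hP hQ k).1 (h1.trans (map_zero _).symm)
  have h3 : (x, y) ∈ LinearMap.range ((cx P).al (cx Q) k) := by
    rw [SubCx.exact_al_be]; exact h2
  obtain ⟨z, hz⟩ := h3
  rw [Subsingleton.elim z 0, map_zero] at hz
  exact (congrArg Prod.fst hz).symm

theorem HA_sub (j : Fin n) (e : ℝ) : HA n j e ⊆ WW n n := by
  rintro x (⟨i, _, h⟩ | h)
  · exact ⟨i, i.2, h⟩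
  · exact ⟨j, j.2, by rintro h'; rw [h'] at h; simp at h⟩

theorem HA_sub_inter (hcap : φ.source ∩ ψ.source = TS φ (WW n n)) (j : Fin n) (e : ℝ) :
    EE p φ (HA n j e) ⊆ EE p φ Set.univ ∩ EE p ψ Set.univ := by
  intro x hx
  have h1 : p x ∈ TS φ (WW n n) := ⟨hx.1, HA_sub j e hx.2⟩
  rw [← hcap] at h1
  exact ⟨⟨h1.1, trivial⟩, ⟨h1.2, trivial⟩⟩

theorem HA_bij_other (hp : IsSerreFibration p) (hφ : φ.target = Set.univ)
    (hψ : ψ.target = Set.univ) (hcap : φ.source ∩ ψ.source = TS φ (WW n n)) (j : Fin n) (e : ℝ)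
    (he : e * e = 1) (k : ℕ) :
    Function.Bijective (iS ((HA_sub_inter (p := p) hcap j e).trans Set.inter_subset_right) k) := by
  obtain ⟨h1, h2⟩ := fib_chart (p := p) hp hφ (HA_center n j e he) (HA_star n j e he) k
  have hc : φ.symm (EuclideanSpace.single j e) ∈ ψ.source := by
    have : φ.symm (EuclideanSpace.single j e) ∈ TS φ (WW n n) := by
      refine ⟨φ.map_target (by rw [hφ]; trivial), ?_⟩
      change φ (φ.symm _) ∈ WW n n
      rw [φ.right_inv (by rw [hφ]; trivial)]
      exact HA_sub j e (HA_center n j e he)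
    rw [← hcap] at this
    exact this.2
  obtain ⟨h3, h4⟩ := fib_chart (p := p) hp hψ
    (Set.mem_univ (ψ (φ.symm (EuclideanSpace.single j e)))) (starConvex_univ _) k
  have key : ∀ (T : Set E) (_ : p ⁻¹' {φ.symm (EuclideanSpace.single j e)} = T)
      (h3 : T ⊆ EE p ψ Set.univ), Function.Bijective (iS h3 k) →
      Function.Bijective (iS ((HA_sub_inter (p := p) hcap j e).trans Set.inter_subset_right) k) := by
    rintro T rfl h3 h4
    exact iS_bij_of_comp h1 _ k h2 h4
  exact key _ (by rw [ψ.left_inv hc]) h3 h4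

theorem two_charts (hp : IsSerreFibration p) (hn : 1 ≤ n) (hφ : φ.target = Set.univ)
    (hψ : ψ.target = Set.univ) (hcap : φ.source ∩ ψ.source = TS φ (WW n n))
    (hcov : φ.source ∪ ψ.source = Set.univ)
    (hfin : ∀ k, FiniteDimensional K2 (HS k (EE p φ Set.univ)))
    (f : ℕ → ℕ) (hf : ∀ k, finrank K2 (HS k (EE p φ Set.univ)) = f k) :
    (∀ k, FiniteDimensional K2 (HS k (Set.univ : Set E))) ∧
    ∃ d : ℕ → ℕ, (∀ k, d k ≤ f k) ∧ (∀ k, d k ≤ if n - 1 ≤ k then f (k - (n - 1)) else 0) ∧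
      (n = 1 → ∀ k, f k ≤ 1 → d k = 0) ∧
      finrank K2 (HS 0 (Set.univ : Set E)) + d 0 = f 0 ∧
      ∀ k, finrank K2 (HS (k + 1) (Set.univ : Set E)) + d (k + 1) + d k = f (k + 1) +
        if n - 1 ≤ k then f (k - (n - 1)) else 0 := by
  have hj0 : 0 < n := hn
  let j0 : Fin n := ⟨0, hj0⟩
  have hUo : IsOpen (EE p φ Set.univ) := EE_open isOpen_univ
  have hVo : IsOpen (EE p ψ Set.univ) := EE_open isOpen_univ
  have hUV : EE p φ Set.univ ∪ EE p ψ Set.univ = Set.univ := by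
    ext x
    have : p x ∈ φ.source ∪ ψ.source := by rw [hcov]; trivial
    simpa [EE, TS] using this
  have hI : EE p φ (WW n (n - 1 + 1)) = EE p φ Set.univ ∩ EE p ψ Set.univ := by
    rw [Nat.sub_add_cancel hn]
    unfold EE
    rw [← hcap]
    ext x; simp [TS]
  have hID : ∀ k, FiniteDimensional K2 (HS k (EE p φ Set.univ ∩ EE p ψ Set.univ)) ∧
      finrank K2 (HS k (EE p φ Set.univ ∩ EE p ψ Set.univ)) =
        f k + if n - 1 ≤ k then f (k - (n - 1)) else 0 := by
    intro k
    rw [← hI]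
    exact WW_dims hp hφ hfin f hf (n - 1) (by omega) k
  have hVD : ∀ k, FiniteDimensional K2 (HS k (EE p ψ Set.univ)) ∧
      finrank K2 (HS k (EE p ψ Set.univ)) = f k := by
    intro k
    have e1 := LinearEquiv.ofBijective _ (HA_bij (p := p) hp hφ j0 1 (by norm_num) k)
    have e2 := LinearEquiv.ofBijective _ (HA_bij_other (p := p) hp hφ hψ hcap j0 1 (by norm_num) k)
    have := hfin k
    exact ⟨(e1.symm.trans e2).finiteDimensional, (e1.symm.trans e2).finrank_eq.symm.trans (hf k)⟩
  have hsurj : ∀ k, Function.Surjective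
      (iS (Set.inter_subset_left : EE p φ Set.univ ∩ EE p ψ Set.univ ⊆ EE p φ Set.univ) k) := by
    intro k y
    obtain ⟨x, rfl⟩ := (HA_bij (p := p) hp hφ j0 1 (by norm_num) k).2 y
    exact ⟨iS (HA_sub_inter (p := p) hcap j0 1) k x, iS_iS _ _ _ _⟩
  set r : ℕ → ℕ := fun k =>
    finrank K2 (LinearMap.range (alS (EE p φ Set.univ) (EE p ψ Set.univ) k)) with hr
  have r1 : ∀ k, f k ≤ r k := by
    intro k
    have := (hID k).1
    rw [← hf k]
    have e : iS (Set.inter_subset_left : EE p φ Set.univ ∩ EE p ψ Set.univ ⊆ EE p φ Set.univ) k =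
      LinearMap.fst _ _ _ ∘ₗ alS (EE p φ Set.univ) (EE p ψ Set.univ) k := rfl
    have h1 := LinearMap.range_eq_top.2 (hsurj k)
    rw [e, LinearMap.range_comp] at h1
    have h2 := Submodule.finrank_map_le (LinearMap.fst K2 (HS k (EE p φ Set.univ))
      (HS k (EE p ψ Set.univ))) (LinearMap.range (alS (EE p φ Set.univ) (EE p ψ Set.univ) k))
    rw [h1, finrank_top] at h2
    exact h2
  have r2 : ∀ k, r k ≤ f k + f k := by
    intro k
    have := hfin k
    have := (hVD k).1
    have h := Submodule.finrank_le (LinearMap.range (alS (EE p φ Set.univ) (EE p ψ Set.univ) k))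
    rw [finrank_prod, hf, (hVD k).2] at h
    exact h
  have r3 : ∀ k, r k ≤ f k + if n - 1 ≤ k then f (k - (n - 1)) else 0 := by
    intro k
    have := (hID k).1
    rw [← (hID k).2]
    exact LinearMap.finrank_range_le _
  refine ⟨?_, fun k => r k - f k, fun k => ?_, fun k => ?_, ?_, ?_, fun k => ?_⟩
  · intro k
    cases k with
    | zero =>
      have := hfin 0
      have := (hVD 0).1
      have h := (mvS_zero hUo hVo).1
      rwa [hUV] at h
    | succ k =>
      have := hfin (k + 1)
      have := (hVD (k + 1)).1
      have := (hID k).1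
      have h := (mvS_succ hUo hVo k).1
      rwa [hUV] at h
  · have := r2 k; dsimp only; omega
  · have := r3 k; dsimp only; omega
  · intro hn1 k hk
    dsimp only
    rcases Nat.lt_or_ge (f k) 1 with h | h
    · have := r2 k; omega
    have fk : f k = 1 := by omega
    have ifin := (hID k).1
    have id2 : finrank K2 (HS k (EE p φ Set.univ ∩ EE p ψ Set.univ)) = 2 := by
      rw [(hID k).2, hn1]; simp [fk]
    have nz : ∀ e : ℝ, e * e = 1 → ∃ x : HS k (EE p φ (HA n j0 e)), x ≠ 0 := by
      intro e he
      have e1 := LinearEquiv.ofBijective _ (HA_bij (p := p) hp hφ j0 e he k)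
      have : 0 < finrank K2 (HS k (EE p φ (HA n j0 e))) := by
        rw [e1.finrank_eq, hf, fk]; norm_num
      have := Module.nontrivial_of_finrank_pos this
      exact exists_ne 0
    obtain ⟨x, hx⟩ := nz 1 (by norm_num)
    obtain ⟨y, hy⟩ := nz (-1) (by norm_num)
    let z := iS (HA_sub_inter (p := p) hcap j0 1) k x + iS (HA_sub_inter (p := p) hcap j0 (-1)) k y
    have hz : z ≠ 0 := by
      intro hz
      refine hx (disj_sum (EE_open (HA_open n j0 1)) (EE_open (HA_open n j0 (-1))) ?_ ?_
        (HA_sub_inter (p := p) hcap j0 1) (HA_sub_inter (p := p) hcap j0 (-1)) k x y hz)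
      · rw [← EE_inter, HA_inter]; simp only [j0]; rw [WW_zero]; ext x; simp [EE, TS]
      · rw [← EE_union, HA_union, ← hI]; simp [j0, hn1]
    have inj0 : ∀ {M N : Type} [AddCommGroup M] [Module K2 M] [AddCommGroup N] [Module K2 N]
        (g : M →ₗ[K2] N) (_ : Function.Bijective g) (m : M) (_ : m ≠ 0), g m ≠ 0 := by
      intro M N _ _ _ _ g hg m hm h0
      exact hm (hg.1 (h0.trans (map_zero g).symm))
    have hz0 : alS (EE p φ Set.univ) (EE p ψ Set.univ) k z = 0 := by
      refine Prod.ext ?_ ?_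
      · change iS Set.inter_subset_left k (_ + _) = 0
        rw [map_add, iS_iS, iS_iS]
        exact k2_one_dim ((hf k).trans fk)
          (inj0 _ (HA_bij (p := p) hp hφ j0 1 (by norm_num) k) x hx)
          (inj0 _ (HA_bij (p := p) hp hφ j0 (-1) (by norm_num) k) y hy)
      · change iS Set.inter_subset_right k (_ + _) = 0
        rw [map_add, iS_iS, iS_iS]
        exact k2_one_dim ((hVD k).2.trans fk)
          (inj0 _ (HA_bij_other (p := p) hp hφ hψ hcap j0 1 (by norm_num) k) x hx)
          (inj0 _ (HA_bij_other (p := p) hp hφ hψ hcap j0 (-1) (by norm_num) k) y hy)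
    have hrn := LinearMap.finrank_range_add_finrank_ker
      (alS (EE p φ Set.univ) (EE p ψ Set.univ) k)
    have hk0 : 0 < finrank K2 (LinearMap.ker (alS (EE p φ Set.univ) (EE p ψ Set.univ) k)) := by
      rw [Module.finrank_pos_iff_exists_ne_zero]
      exact ⟨⟨z, hz0⟩, fun h => hz (congrArg Subtype.val h)⟩
    rw [id2] at hrn
    have : r k = finrank K2 (LinearMap.range (alS (EE p φ Set.univ) (EE p ψ Set.univ) k)) := rfl
    omega
  · have := hfin 0
    have := (hVD 0).1
    obtain ⟨_, h2⟩ := mvS_zero hUo hVo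
    rw [hUV, hf, (hVD 0).2] at h2
    change _ + r 0 = _ at h2
    have := r1 0
    dsimp only
    omega
  · have := hfin (k + 1)
    have := (hVD (k + 1)).1
    have := (hID k).1
    obtain ⟨_, h2⟩ := mvS_succ hUo hVo k
    rw [hUV, hf, (hVD (k + 1)).2, (hID k).2] at h2
    change _ + r (k + 1) + r k = _ at h2
    have := r1 k
    have := r1 (k + 1)
    dsimp only
    omega

end TwoCharts


/-! ### Spheres -/

section Spheres

open Module

instance fact_dim (n : ℕ) : Fact (finrank ℝ (EuclideanSpace ℝ (Fin (n + 1))) = n + 1) :=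
  ⟨by simp⟩

theorem ster_neg {n : ℕ} (v : Sph n) : stereographic' n (-v) v = 0 := by
  have h : stereographic (norm_eq_of_mem_sphere (-v)) v = 0 := stereographic_neg_apply v
  change (OrthonormalBasis.fromOrthogonalSpanSingleton (𝕜 := ℝ) n
    (ne_zero_of_mem_unit_sphere (-v))).repr
    (stereographic (norm_eq_of_mem_sphere (-v)) v) = 0
  rw [h, map_zero]

theorem sph_ne_neg {n : ℕ} (v : Sph n) : v ≠ -v := by
  intro h
  have h1 : (v : EuclideanSpace ℝ (Fin (n + 1))) = -v := congrArg Subtype.val h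
  have h2 : (v : EuclideanSpace ℝ (Fin (n + 1))) = 0 := by
    have h4 : (2:ℝ) • (v : EuclideanSpace ℝ (Fin (n + 1))) = 0 := by
      rw [two_smul]; nth_rewrite 2 [h1]; exact add_neg_cancel _
    exact (smul_eq_zero.1 h4).resolve_left two_ne_zero
  have h3 := norm_eq_of_mem_sphere v
  rw [h2, norm_zero] at h3
  exact zero_ne_one h3

theorem sph_main {E : Type} [TopologicalSpace E] {n : ℕ} (hn : 1 ≤ n) (p : C(E, Sph n))
    (hp : IsSerreFibration p) (b : Sph n) (hfin : ∀ k, FiniteDimensional K2 (HS k (p ⁻¹' {b})))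
    (f : ℕ → ℕ) (hf : ∀ k, finrank K2 (HS k (p ⁻¹' {b})) = f k) :
    (∀ k, FiniteDimensional K2 (HS k (Set.univ : Set E))) ∧
    ∃ d : ℕ → ℕ, (∀ k, d k ≤ f k) ∧ (∀ k, d k ≤ if n - 1 ≤ k then f (k - (n - 1)) else 0) ∧
      (n = 1 → ∀ k, f k ≤ 1 → d k = 0) ∧
      finrank K2 (HS 0 (Set.univ : Set E)) + d 0 = f 0 ∧
      ∀ k, finrank K2 (HS (k + 1) (Set.univ : Set E)) + d (k + 1) + d k = f (k + 1) +
        if n - 1 ≤ k then f (k - (n - 1)) else 0 := by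
  let φ := stereographic' n (-b)
  let ψ := stereographic' n b
  have hφ : φ.target = Set.univ := stereographic'_target _
  have hψ : ψ.target = Set.univ := stereographic'_target _
  have sφ : φ.source = {-b}ᶜ := stereographic'_source _
  have sψ : ψ.source = {b}ᶜ := stereographic'_source _
  have hb0 : φ b = 0 := ster_neg b
  have hbs : b ∈ φ.source := by rw [sφ]; exact sph_ne_neg b
  have hsb : φ.symm 0 = b := by rw [← hb0, φ.left_inv hbs]
  have hE : ∀ k, Nonempty (HS k (p ⁻¹' {b}) ≃ₗ[K2] HS k (EE p φ Set.univ)) := by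
    intro k
    obtain ⟨h1, h2⟩ := fib_chart (p := p) hp hφ (Set.mem_univ 0) (starConvex_univ _) k
    have e := LinearEquiv.ofBijective _ h2
    rw [hsb] at e
    exact ⟨e⟩
  refine two_charts (φ := φ) (ψ := ψ) hp hn hφ hψ ?_ ?_ ?_ f ?_
  · rw [WW_top]
    ext x
    simp only [TS, Set.mem_inter_iff, Set.mem_preimage, Set.mem_compl_iff, Set.mem_singleton_iff]
    refine and_congr_right fun hx => ?_
    rw [sψ, Set.mem_compl_iff, Set.mem_singleton_iff, not_iff_not]
    constructor
    · rintro rfl; exact hb0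
    · intro h; exact φ.injOn hx hbs (h.trans hb0.symm)
  · rw [sφ, sψ]
    ext x
    simp only [Set.mem_union, Set.mem_compl_iff, Set.mem_singleton_iff, Set.mem_univ, iff_true]
    by_contra h
    push Not at h
    exact sph_ne_neg b (h.2.symm.trans h.1)
  · intro k
    obtain ⟨e⟩ := hE k
    have := hfin k
    exact e.finiteDimensional
  · intro k
    obtain ⟨e⟩ := hE k
    rw [← e.finrank_eq, hf]

theorem id_serre (B : Type) [TopologicalSpace B] : IsSerreFibration (ContinuousMap.id B) :=
  fun _ h _ h0 => ⟨h, fun _ => rfl, fun y => (h0 y).symm⟩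

theorem sph_dims {n : ℕ} (hn : 1 ≤ n) (b : Sph n) (k : ℕ) :
    FiniteDimensional K2 (HS k (Set.univ : Set (Sph n))) ∧
      finrank K2 (HS k (Set.univ : Set (Sph n))) = if k = 0 ∨ k = n then 1 else 0 := by
  obtain ⟨h1, d, h2, h3, h4, h5, h6⟩ := sph_main hn (ContinuousMap.id (Sph n)) (id_serre _) b
    (by
      intro k
      change FiniteDimensional K2 (HS k {b})
      cases k with
      | zero => exact Module.finite_of_finrank_eq_succ (H_point_zero b)
      | succ k => have := H_point_succ k b; infer_instance)
    (fun k => if k = 0 then 1 else 0)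
    (by
      intro k
      change finrank K2 (HS k {b}) = _
      cases k with
      | zero => exact H_point_zero b
      | succ k => have := H_point_succ k b; simp [finrank_zero_of_subsingleton])
  have hd : ∀ k, d k = 0 := by
    intro k
    by_cases hn1 : n = 1
    · exact h4 hn1 k (by split_ifs <;> omega)
    · have a1 := h2 k
      have a2 := h3 k
      split_ifs at a1 a2 <;> omega
  refine ⟨h1 k, ?_⟩
  cases k with
  | zero => rw [hd] at h5; simpa using h5
  | succ k =>
    have := h6 k
    rw [hd, hd] at this
    simp only [Nat.add_zero] at this
    rw [this, if_neg (Nat.succ_ne_zero k)]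
    clear h2 h3 h4 h5 h6 this
    by_cases hk : k + 1 = n
    · subst hk; simp
    · rw [if_neg (show ¬(k + 1 = 0 ∨ k + 1 = n) by omega)]
      split_ifs <;> omega

theorem sph_zero_fin (x y z : Sph 0) : x = y ∨ y = z ∨ x = z := by
  have h : ∀ x : Sph 0, x.1 0 = 1 ∨ x.1 0 = -1 := by
    intro x
    have := norm_eq_of_mem_sphere x
    rw [EuclideanSpace.norm_eq] at this
    simp at this
    exact this
  have e : ∀ x y : Sph 0, x.1 0 = y.1 0 → x = y := by
    intro x y h
    apply Subtype.ext
    ext i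
    fin_cases i
    exact h
  rcases h x with hx | hx <;> rcases h y with hy | hy <;> rcases h z with hz | hz
  all_goals first
    | exact Or.inl (e _ _ (hx.trans hy.symm))
    | exact Or.inr (Or.inl (e _ _ (hy.trans hz.symm)))
    | exact Or.inr (Or.inr (e _ _ (hx.trans hz.symm)))

noncomputable def sphE {n : ℕ} (i : Fin (n + 1)) (e : ℝ) (he : ‖e‖ = 1) : Sph n :=
  ⟨EuclideanSpace.single i e, by simp [he]⟩

theorem not_inj_sph_zero {l : ℕ} (hl : 1 ≤ l) (g : Sph l → Sph 0) (hg : Function.Injective g) :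
    False := by
  let a : Sph l := sphE 0 1 (by simp)
  let b : Sph l := sphE 0 (-1) (by simp)
  let c : Sph l := sphE ⟨1, by omega⟩ 1 (by simp)
  have ea : a.1 0 = 1 := by simp [a, sphE]
  have eb : b.1 0 = -1 := by simp [b, sphE]
  have ec : c.1 0 = 0 := by
    simp [c, sphE, Fin.ext_iff]
  rcases sph_zero_fin (g a) (g b) (g c) with h | h | h
  · have h := hg h; rw [← h, ea] at eb; norm_num at eb
  · have h := hg h; rw [← h, eb] at ec; norm_num at ec
  · have h := hg h; rw [← h, ea] at ec; norm_num at ec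

end Spheres

/-- If `Sˡ → Sᵐ → Sⁿ` is a fibration of spheres (with `l, n ≥ 1`), i.e. a
Serre fibration `Sᵐ → Sⁿ` whose fiber is homeomorphic to `Sˡ`, then
`n = l + 1` and `m = 2n − 1`. -/
theorem stmt_19 (l m n : ℕ) (hl : 1 ≤ l) (hn : 1 ≤ n)
    (p : C(Sph m, Sph n)) (hp : IsSerreFibration p) (b : Sph n)
    (hfib : Nonempty ({x : Sph m // p x = b} ≃ₜ Sph l)) :
    n = l + 1 ∧ m = 2 * n - 1 := by
  obtain ⟨t⟩ := hfib
  let g : C(Sph l, Sph m) := ⟨fun x => (t.symm x).1, continuous_subtype_val.comp t.symm.continuous⟩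
  have hg : Topology.IsEmbedding g :=
    Topology.IsEmbedding.subtypeVal.comp t.symm.isEmbedding
  have hr : Set.range g = p ⁻¹' {b} := by
    ext y
    constructor
    · rintro ⟨x, rfl⟩; exact (t.symm x).2
    · intro hy; exact ⟨t ⟨y, hy⟩, by simp [g]⟩
  have hm : 1 ≤ m := by
    by_contra h
    obtain rfl : m = 0 := by omega
    exact not_inj_sph_zero hl g hg.injective
  have bl : Sph l := sphE 0 1 (by simp)
  have hq : ∀ k, FiniteDimensional K2 (HS k (p ⁻¹' {b})) ∧
      Module.finrank K2 (HS k (p ⁻¹' {b})) = if k = 0 ∨ k = l then 1 else 0 := by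
    intro k
    rw [← hr]
    obtain ⟨e⟩ := embed_equiv g hg k
    obtain ⟨h1, h2⟩ := sph_dims hl bl k
    exact ⟨e.finiteDimensional, e.finrank_eq.symm.trans h2⟩
  obtain ⟨_, d, h2, h3, h4, h5, h6⟩ := sph_main hn p hp b (fun k => (hq k).1)
    (fun k => if k = 0 ∨ k = l then 1 else 0) (fun k => (hq k).2)
  have he := fun k => (sph_dims hm (g bl) k).2
  simp only [he] at h5 h6
  have hd : ∀ k, (n = 1 ∨ k ≠ l ∨ n ≠ l + 1) → (k ≠ 0 → d k = 0) := by
    intro k hk k0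
    by_cases hn1 : n = 1
    · exact h4 hn1 k (by split_ifs <;> omega)
    · have a1 := h2 k
      have a2 := h3 k
      split_ifs at a1 a2 <;> omega
  have hd0 : d 0 = 0 := by
    simpa using h5
  obtain ⟨n, rfl⟩ : ∃ n', n = n' + 1 := ⟨n - 1, by omega⟩
  have A := h6 n
  have B := h6 (n + l)
  simp only [Nat.add_sub_cancel, le_refl, if_true, Nat.sub_self, true_or, Nat.le_add_right,
    Nat.add_sub_cancel_left, or_true] at A B
  have Bd := hd (n + l) (by omega) (by omega)
  have Bd' := hd (n + l + 1) (by omega) (by omega)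
  rw [Bd, Bd'] at B
  have hmB : m = n + l + 1 := by
    by_contra hne
    rw [if_neg (by omega)] at B
    omega
  have hnl : n = l := by
    by_contra hne
    have c1 := hd (n + 1) (by omega) (by omega)
    have c2 : d n = 0 := by
      by_cases h0 : n = 0
      · rw [h0]; exact hd0
      · exact hd n (by omega) h0
    rw [c1, c2, if_neg (by omega)] at A
    omega
  omega
end
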